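/- There are only countably many upper growth rates of permutation classes below ξ: the set {r ∈ ℝ : r < ξ and r = ugr(C) for some permutation class C} is countable. -/

import Mathlib

open Filter

/-- A permutation of some finite length `n`. -/
abbrev Permu : Type := Σ n : ℕ, Equiv.Perm (Fin n)

/-- `PLe σ π` : the permutation `σ` is contained in `π` as a pattern. -/
def PLe (σ π : Permu) : Prop :=
  ∃ f : Fin σ.1 → Fin π.1, StrictMono f ∧
    ∀ i j : Fin σ.1, σ.2 i < σ.2 j ↔ π.2 (f i) < π.2 (f j)

/-- A permutation class: a set of permutations closed downward under containment. -/
def IsPermClass (C : Set Permu) : Prop :=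
  ∀ σ π : Permu, PLe σ π → π ∈ C → σ ∈ C

/-- The number of permutations of length `n` in `C`. -/
noncomputable def pcount (C : Set Permu) (n : ℕ) : ℕ :=
  Set.ncard {π ∈ C | π.1 = n}

/-- The upper growth rate of a class, as an extended real. -/
noncomputable def ugr (C : Set Permu) : EReal :=
  limsup (fun n : ℕ => (((pcount C n : ℝ) ^ ((n : ℝ)⁻¹) : ℝ) : EReal)) atTop

/-- The lower growth rate of a class, as an extended real. -/
noncomputable def lgr (C : Set Permu) : EReal :=
  liminf (fun n : ℕ => (((pcount C n : ℝ) ^ ((n : ℝ)⁻¹) : ℝ) : EReal)) atTop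

theorem pset_finite (C : Set Permu) (n : ℕ) : {π ∈ C | π.1 = n}.Finite := by
  apply Set.Finite.subset (Set.finite_range (fun p : Equiv.Perm (Fin n) => (⟨n, p⟩ : Permu)))
  rintro ⟨m, p⟩ ⟨_, h⟩
  simp only at h
  subst h
  exact ⟨p, rfl⟩

theorem pcount_mono {C D : Set Permu} (h : C ⊆ D) (n : ℕ) : pcount C n ≤ pcount D n :=
  Set.ncard_le_ncard (fun _ hx => ⟨h hx.1, hx.2⟩) (pset_finite D n)

theorem pcount_union (C D : Set Permu) (n : ℕ) : pcount (C ∪ D) n ≤ pcount C n + pcount D n := by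
  unfold pcount
  refine le_trans (Set.ncard_le_ncard ?_ ((pset_finite C n).union (pset_finite D n)))
    (Set.ncard_union_le _ _)
  rintro x ⟨h | h, h'⟩
  · exact .inl ⟨h, h'⟩
  · exact .inr ⟨h, h'⟩

theorem perm_ext {σ π : Permu} (h : σ.1 = π.1)
    (hh : ∀ i j (a b : Fin π.1), a.1 = i.1 → b.1 = j.1 → (σ.2 i < σ.2 j ↔ π.2 a < π.2 b)) :
    σ = π := by
  obtain ⟨m, p⟩ := σ
  obtain ⟨n, q⟩ := π
  simp only at h
  subst h
  have h1 : StrictMono (fun i => p (q.symm i)) := by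
    intro i j hij
    have := (hh (q.symm i) (q.symm j) _ _ rfl rfl)
    simp at this
    exact this.2 hij
  have h2 : ∀ i, p (q.symm i) = i := by
    intro i
    let e : Fin m ≃o Fin m := StrictMono.orderIsoOfSurjective _ h1 (fun x => ⟨q (p.symm x), by simp⟩)
    have : e = OrderIso.refl _ := Subsingleton.elim _ _
    exact congrArg (fun f : Fin m ≃o Fin m => f i) this
  have : p = q := by
    ext i
    have := h2 (q i)
    simp at this
    rw [this]
  rw [this]

theorem PLe.refl (π : Permu) : PLe π π := ⟨id, strictMono_id, fun _ _ => Iff.rfl⟩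

theorem PLe.trans {a b c : Permu} (h : PLe a b) (h' : PLe b c) : PLe a c := by
  obtain ⟨f, hf, hf'⟩ := h
  obtain ⟨g, hg, hg'⟩ := h'
  exact ⟨g ∘ f, hg.comp hf, fun i j => (hf' i j).trans (hg' _ _)⟩

theorem PLe.le {a b : Permu} (h : PLe a b) : a.1 ≤ b.1 := by
  obtain ⟨f, hf, -⟩ := h
  simpa using Fintype.card_le_of_injective f hf.injective

theorem PLe.eq {a b : Permu} (h : PLe a b) (h' : b.1 ≤ a.1) : a = b := by
  have hab : a.1 = b.1 := le_antisymm h.le h'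
  obtain ⟨f, hf, h2⟩ := h
  apply perm_ext hab
  intro i j x y hx hy
  have key : ∀ i : Fin a.1, (f i).1 = i.1 := by
    obtain ⟨m, p⟩ := a
    obtain ⟨n, q⟩ := b
    simp only at hab
    subst hab
    intro i
    have hs : Function.Surjective f := Finite.surjective_of_injective hf.injective
    let e : Fin m ≃o Fin m := StrictMono.orderIsoOfSurjective f hf hs
    have : e = OrderIso.refl _ := Subsingleton.elim _ _
    have := congrArg (fun f => (f i).1) this
    simpa [e] using this
  have e1 : x = f i := Fin.ext (by rw [key, hx])
  have e2 : y = f j := Fin.ext (by rw [key, hy])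
  rw [e1, e2]; exact h2 i j

theorem PLe.of {σ π : Permu} (f : Fin σ.1 → Fin π.1) (h1 : ∀ i j, i < j → f i < f j)
    (h2 : ∀ i j, σ.2 i < σ.2 j → π.2 (f i) < π.2 (f j)) : PLe σ π := by
  refine ⟨f, fun i j h => h1 i j h, fun i j => ⟨h2 i j, fun h => ?_⟩⟩
  by_contra hc
  rcases (not_lt.1 hc).lt_or_eq with h3 | h3
  · exact absurd h (h2 _ _ h3).asymm
  · rw [σ.2.injective h3] at h; exact lt_irrefl _ h

noncomputable def pat (π : Permu) (A : Finset (Fin π.1)) : Permu :=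
  ⟨A.card, (A.orderIsoOfFin rfl).toEquiv.trans
    ((π.2.subtypeEquiv (q := fun x => x ∈ A.map π.2.toEmbedding) (by simp)).trans
      ((A.map π.2.toEmbedding).orderIsoOfFin (Finset.card_map _)).symm.toEquiv)⟩

noncomputable def pemb (π : Permu) (A : Finset (Fin π.1)) : Fin (pat π A).1 → Fin π.1 :=
  fun i => (A.orderIsoOfFin rfl i).1

theorem pemb_mono (π : Permu) (A) : StrictMono (pemb π A) := by
  intro i j h
  exact (A.orderIsoOfFin rfl).strictMono h

theorem pemb_mem (π : Permu) (A) (i) : pemb π A i ∈ A := (A.orderIsoOfFin rfl i).2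

theorem pemb_lt {π : Permu} {A} {i j} : pemb π A i < pemb π A j ↔ i < j := (pemb_mono π A).lt_iff_lt

theorem pemb_surj {π : Permu} {A} {x} (h : x ∈ A) : ∃ i, pemb π A i = x :=
  ⟨(A.orderIsoOfFin rfl).symm ⟨x, h⟩, by simp [pemb]⟩

theorem pat_lt {π : Permu} {A : Finset (Fin π.1)} {i j : Fin (pat π A).1} : (pat π A).2 i < (pat π A).2 j ↔
    π.2 (pemb π A i) < π.2 (pemb π A j) := by
  exact ((A.map π.2.toEmbedding).orderIsoOfFin (Finset.card_map _)).symm.lt_iff_lt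

theorem pat_le (π : Permu) (A) : PLe (pat π A) π := ⟨_, pemb_mono π A, fun _ _ => pat_lt⟩

@[simp] theorem pat_card (π : Permu) (A) : (pat π A).1 = A.card := rfl

theorem pat_rep {π σ : Permu} {A} (h : pat π A = σ) : ∃ f : Fin σ.1 → Fin π.1, StrictMono f ∧
    (∀ x, x ∈ A ↔ ∃ i, f i = x) ∧ ∀ i j, (σ.2 i < σ.2 j ↔ π.2 (f i) < π.2 (f j)) := by
  subst h
  exact ⟨pemb π A, pemb_mono π A, fun x => ⟨pemb_surj, fun ⟨i, h⟩ => h ▸ pemb_mem π A i⟩,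
    fun _ _ => pat_lt⟩

theorem pat_iso {π π' : Permu} {A A'} (h : pat π A = pat π' A') (hA : A.Nonempty) :
    ∃ φ : Fin π.1 → Fin π'.1, Set.BijOn φ A A' ∧ (∀ i ∈ A, ∀ j ∈ A, (i < j ↔ φ i < φ j)) ∧
      (∀ i ∈ A, ∀ j ∈ A, (π.2 i < π.2 j ↔ π'.2 (φ i) < π'.2 (φ j))) := by
  classical
  obtain ⟨f, hf, hf1, hf2⟩ := pat_rep h
  obtain ⟨g, hg, hg1, hg2⟩ := pat_rep (rfl : pat π' A' = pat π' A')
  obtain ⟨x0, hx0⟩ := hA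
  obtain ⟨i0, -⟩ := (hf1 x0).1 hx0
  have : Nonempty (Fin (pat π' A').1) := ⟨i0⟩
  have hinv : ∀ i, Function.invFun f (f i) = i := Function.leftInverse_invFun hf.injective
  refine ⟨fun x => g (Function.invFun f x), ⟨?_, ?_, ?_⟩, ?_, ?_⟩
  · intro x hx
    exact (hg1 _).2 ⟨_, rfl⟩
  · intro x hx y hy hxy
    obtain ⟨i, rfl⟩ := (hf1 x).1 hx
    obtain ⟨j, rfl⟩ := (hf1 y).1 hy
    simp only [hinv] at hxy
    rw [hg.injective hxy]
  · intro y hy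
    obtain ⟨j, rfl⟩ := (hg1 y).1 hy
    exact ⟨f j, (hf1 _).2 ⟨j, rfl⟩, congrArg g (hinv j)⟩
  · intro x hx y hy
    obtain ⟨i, rfl⟩ := (hf1 x).1 hx
    obtain ⟨j, rfl⟩ := (hf1 y).1 hy
    simp only [hinv]
    rw [hf.lt_iff_lt, hg.lt_iff_lt]
  · intro x hx y hy
    obtain ⟨i, rfl⟩ := (hf1 x).1 hx
    obtain ⟨j, rfl⟩ := (hf1 y).1 hy
    simp only [hinv]
    rw [← hf2, ← hg2]

theorem PLe_pat {σ π : Permu} {A : Finset (Fin π.1)} (f : Fin σ.1 → Fin π.1) (hA : ∀ i, f i ∈ A)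
    (h1 : ∀ i j, i < j → f i < f j)
    (h2 : ∀ i j, σ.2 i < σ.2 j → π.2 (f i) < π.2 (f j)) : PLe σ (pat π A) := by
  choose g hg using fun i => pemb_surj (π := π) (hA i)
  refine PLe.of g (fun i j h => pemb_lt.1 ?_) (fun i j h => pat_lt.2 ?_)
  · rw [hg, hg]; exact h1 _ _ h
  · rw [hg, hg]; exact h2 _ _ h

theorem ugr_lt_bound {C : Set Permu} {s : ℝ} (hs : 0 < s) (h : ugr C < (s : EReal)) :
    ∃ K : ℝ, 0 < K ∧ ∀ n, (pcount C n : ℝ) ≤ K * s ^ n := by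
  have h1 := eventually_lt_of_limsup_lt h
  obtain ⟨N, hN⟩ := eventually_atTop.1 h1
  let f : ℕ → ℝ := fun n => (pcount C n : ℝ) / s ^ n
  refine ⟨1 + ∑ n ∈ Finset.range (N + 1), f n, ?_, fun n => ?_⟩
  · have : 0 ≤ ∑ n ∈ Finset.range (N + 1), f n := Finset.sum_nonneg (fun i _ => by positivity)
    linarith
  have hsn : 0 < s ^ n := pow_pos hs n
  rcases Nat.lt_or_ge n (N + 1) with hn | hn
  · have h2 : f n ≤ ∑ n ∈ Finset.range (N + 1), f n :=
      Finset.single_le_sum (f := f) (fun i _ => by positivity) (Finset.mem_range.2 hn)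
    have h3 : (pcount C n : ℝ) = f n * s ^ n := by simp only [f]; field_simp
    rw [h3]
    exact mul_le_mul_of_nonneg_right (by linarith) hsn.le
  · have h2 := hN n (by omega)
    rw [EReal.coe_lt_coe_iff] at h2
    have h3 : (pcount C n : ℝ) ≤ s ^ n := by
      have h4 : ((pcount C n : ℝ) ^ ((n : ℝ)⁻¹)) ^ n ≤ s ^ n :=
        pow_le_pow_left₀ (by positivity) h2.le n
      rwa [Real.rpow_inv_natCast_pow (by positivity) (by omega)] at h4
    have : 0 ≤ ∑ n ∈ Finset.range (N + 1), f n := Finset.sum_nonneg (fun i _ => by positivity)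
    nlinarith

theorem ugr_le_of_bound {C : Set Permu} {K s : ℝ} (hs : 0 < s)
    (h : ∀ n, (pcount C n : ℝ) ≤ K * s ^ n) : ugr C ≤ (s : EReal) := by
  let K' := max K 1
  have hK' : 0 < K' := lt_of_lt_of_le one_pos (le_max_right _ _)
  have h1 : ∀ᶠ n : ℕ in atTop, (((pcount C n : ℝ) ^ ((n : ℝ)⁻¹) : ℝ) : EReal) ≤
      ((K' ^ ((n : ℝ)⁻¹) * s : ℝ) : EReal) := by
    filter_upwards [eventually_gt_atTop 0] with n hn
    rw [EReal.coe_le_coe_iff]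
    have h2 : (pcount C n : ℝ) ≤ K' * s ^ n :=
      (h n).trans (mul_le_mul_of_nonneg_right (le_max_left _ _) (by positivity))
    calc (pcount C n : ℝ) ^ ((n : ℝ)⁻¹) ≤ (K' * s ^ n) ^ ((n : ℝ)⁻¹) :=
          Real.rpow_le_rpow (by positivity) h2 (by positivity)
      _ = K' ^ ((n : ℝ)⁻¹) * s := by
          rw [Real.mul_rpow hK'.le (by positivity), Real.pow_rpow_inv_natCast hs.le (by omega)]
  have h2 : Tendsto (fun n : ℕ => ((K' ^ ((n : ℝ)⁻¹) * s : ℝ) : EReal)) atTop (nhds (s : EReal)) := by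
    rw [EReal.tendsto_coe]
    have h3 : Tendsto (fun n : ℕ => (K' : ℝ) ^ ((n : ℝ)⁻¹)) atTop (nhds (K' ^ (0 : ℝ))) :=
      (Real.continuous_const_rpow hK'.ne').continuousAt.tendsto.comp (tendsto_inv_atTop_nhds_zero_nat (𝕜 := ℝ))
    simpa using h3.mul_const s
  exact (limsup_le_limsup h1).trans h2.limsup_eq.le

theorem ugr_mono {C D : Set Permu} (h : C ⊆ D) : ugr C ≤ ugr D := by
  refine limsup_le_limsup (Eventually.of_forall (fun n => ?_))
  show _ ≤ (((pcount D n : ℝ) ^ ((n : ℝ)⁻¹) : ℝ) : EReal)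
  rw [EReal.coe_le_coe_iff]
  exact Real.rpow_le_rpow (by positivity) (by exact_mod_cast pcount_mono h n) (by positivity)

theorem le_ugr_of_bound {C : Set Permu} {c ρ : ℝ} {q : ℕ} (hc : 0 < c) (hρ : 0 < ρ)
    (h : ∀ n : ℕ, c * ρ ^ n ≤ ((n : ℝ) + 1) ^ q * pcount C n) : (ρ : EReal) ≤ ugr C := by
  by_contra hlt
  push Not at hlt
  obtain ⟨s, h1, h2⟩ := EReal.lt_iff_exists_real_btwn.1 hlt
  have h2' : s < ρ := by exact_mod_cast h2
  obtain ⟨t, ht1, ht2⟩ := exists_between (max_lt h2' hρ)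
  have ht0 : 0 < t := lt_of_le_of_lt (le_max_right _ _) ht1
  have hts : s < t := lt_of_le_of_lt (le_max_left _ _) ht1
  obtain ⟨K, hK, hb⟩ := ugr_lt_bound ht0 (h1.trans (by exact_mod_cast hts))
  have h3 : Tendsto (fun n : ℕ => (n : ℝ) ^ q * (t / ρ) ^ n) atTop (nhds 0) :=
    tendsto_pow_const_mul_const_pow_of_lt_one q (by positivity) ((div_lt_one hρ).2 ht2)
  have h4 : ∀ n : ℕ, 1 ≤ n → c ≤ (2 ^ q * K) * ((n : ℝ) ^ q * (t / ρ) ^ n) := by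
    intro n hn
    have hn' : (1 : ℝ) ≤ n := by exact_mod_cast hn
    have e1 : ((n : ℝ) + 1) ^ q ≤ 2 ^ q * (n : ℝ) ^ q := by
      rw [← mul_pow]; exact pow_le_pow_left₀ (by positivity) (by linarith) _
    have e2 : c * ρ ^ n ≤ (2 ^ q * (n : ℝ) ^ q) * (K * t ^ n) :=
      (h n).trans (mul_le_mul e1 (hb n) (by positivity) (by positivity))
    have hρn : 0 < ρ ^ n := pow_pos hρ n
    rw [div_pow]
    have : (2 ^ q * K) * ((n : ℝ) ^ q * (t ^ n / ρ ^ n)) = (2 ^ q * (n : ℝ) ^ q) * (K * t ^ n) / ρ ^ n := by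
      ring
    rw [this, le_div_iff₀ hρn]
    exact e2
  have h5 : Tendsto (fun n : ℕ => (2 ^ q * K) * ((n : ℝ) ^ q * (t / ρ) ^ n)) atTop (nhds 0) := by
    simpa using h3.const_mul (2 ^ q * K)
  have h6 := ge_of_tendsto h5 (b := c) (by
    filter_upwards [eventually_ge_atTop 1] with n hn using h4 n hn)
  linarith

structure IsSym (s : Permu → Permu) : Prop where
  len : ∀ σ, (s σ).1 = σ.1
  invol : ∀ σ, s (s σ) = σ
  le : ∀ σ π, PLe σ π → PLe (s σ) (s π)

abbrev pinv (σ : Permu) : Permu := ⟨σ.1, σ.2.symm⟩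
abbrev prev (σ : Permu) : Permu := ⟨σ.1, Fin.revPerm.trans σ.2⟩
abbrev pcom (σ : Permu) : Permu := ⟨σ.1, σ.2.trans Fin.revPerm⟩

theorem isSym_pinv : IsSym pinv := by
  refine ⟨fun _ => rfl, fun _ => rfl, ?_⟩
  rintro σ π ⟨f, hf, h⟩
  refine PLe.of (fun v => π.2 (f (σ.2.symm v))) (fun i j hij => ?_) (fun i j hij => ?_)
  · rw [← h]; simpa using hij
  · simp only [pinv, Equiv.symm_apply_apply]
    exact hf hij

theorem isSym_prev : IsSym prev := by
  refine ⟨fun _ => rfl, fun σ => ?_, ?_⟩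
  · obtain ⟨n, p⟩ := σ
    simp only [prev]
    congr 1
    ext i
    simp
  rintro σ π ⟨f, hf, h⟩
  refine PLe.of (fun v => (f v.rev).rev) (fun i j hij => ?_) (fun i j hij => ?_)
  · exact Fin.rev_lt_rev.2 (hf (Fin.rev_lt_rev.2 hij))
  · simp only [prev, Equiv.trans_apply, Fin.revPerm_apply, Fin.rev_rev] at hij ⊢
    exact (h _ _).1 hij

theorem isSym_pcom : IsSym pcom := by
  refine ⟨fun _ => rfl, fun σ => ?_, ?_⟩
  · obtain ⟨n, p⟩ := σ
    simp only [pcom]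
    congr 1
    ext i
    simp
  rintro σ π ⟨f, hf, h⟩
  refine PLe.of (fun v => f v) (fun i j hij => hf hij) (fun i j hij => ?_)
  simp only [pcom, Equiv.trans_apply, Fin.revPerm_apply, Fin.rev_lt_rev] at hij ⊢
  exact (h _ _).1 hij

theorem prev_pcom (σ : Permu) : prev (pcom σ) = pcom (prev σ) := rfl

theorem IsSym.pcount {s} (hs : IsSym s) (C : Set Permu) (n : ℕ) : pcount (s ⁻¹' C) n = pcount C n := by
  have key : ∀ C : Set Permu, _root_.pcount (s ⁻¹' C) n ≤ _root_.pcount C n := fun C =>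
    Set.ncard_le_ncard_of_injOn s (fun σ hσ => ⟨hσ.1, (hs.len σ).trans hσ.2⟩)
      (fun a _ b _ h => by rw [← hs.invol a, h, hs.invol]) (pset_finite C n)
  refine le_antisymm (key C) ?_
  have := key (s ⁻¹' C)
  rwa [← Set.preimage_comp, show s ∘ s = id from funext hs.invol, Set.preimage_id] at this

theorem IsSym.ugr {s} (hs : IsSym s) (C : Set Permu) : ugr (s ⁻¹' C) = ugr C := by
  unfold _root_.ugr
  simp only [hs.pcount]

theorem IsSym.cls {s} (hs : IsSym s) {C : Set Permu} (hC : IsPermClass C) : IsPermClass (s ⁻¹' C) :=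
  fun _ _ h h' => hC _ _ (hs.le _ _ h) h'

abbrev dsum (σ τ : Permu) : Permu := ⟨σ.1 + τ.1,
  finSumFinEquiv.symm.trans ((Equiv.sumCongr σ.2 τ.2).trans finSumFinEquiv)⟩

def SumClosed (C : Set Permu) : Prop := ∀ σ ∈ C, ∀ τ ∈ C, dsum σ τ ∈ C

theorem dsum_l (σ τ : Permu) (i : Fin σ.1) : (dsum σ τ).2 (Fin.castAdd _ i) = Fin.castAdd _ (σ.2 i) := by
  simp [dsum]

theorem dsum_r (σ τ : Permu) (i : Fin τ.1) : (dsum σ τ).2 (Fin.natAdd _ i) = Fin.natAdd _ (τ.2 i) := by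
  simp [dsum]

theorem dsum_PLe {σ τ π : Permu} (f : Fin σ.1 → Fin π.1) (g : Fin τ.1 → Fin π.1)
    (hf1 : ∀ i j, i < j → f i < f j) (hf2 : ∀ i j, σ.2 i < σ.2 j → π.2 (f i) < π.2 (f j))
    (hg1 : ∀ i j, i < j → g i < g j) (hg2 : ∀ i j, τ.2 i < τ.2 j → π.2 (g i) < π.2 (g j))
    (h1 : ∀ i j, f i < g j) (h2 : ∀ i j, π.2 (f i) < π.2 (g j)) : PLe (dsum σ τ) π := by
  refine PLe.of (fun x : Fin (σ.1 + τ.1) => Fin.addCases f g x) ?_ ?_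
  · intro i j
    refine Fin.addCases (fun i => ?_) (fun i => ?_) i <;> refine Fin.addCases (fun j => ?_) (fun j => ?_) j
    all_goals simp only [Fin.addCases_left, Fin.addCases_right]
    · exact fun h => hf1 _ _ h
    · exact fun _ => h1 _ _
    · intro h; have := Fin.lt_def.1 h; simp at this; omega
    · exact fun h => hg1 _ _ (by simpa using h)
  · intro i j
    refine Fin.addCases (fun i => ?_) (fun i => ?_) i <;> refine Fin.addCases (fun j => ?_) (fun j => ?_) j
    all_goals simp only [Fin.addCases_left, Fin.addCases_right, dsum_l, dsum_r]
    · exact fun h => hf2 _ _ (by simpa using Fin.lt_def.1 h)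
    · exact fun _ => h2 _ _
    · intro h; have := Fin.lt_def.1 h; simp at this; omega
    · exact fun h => hg2 _ _ (by simpa using Fin.lt_def.1 h)

def Ind (π : Permu) : Prop := 0 < π.1 ∧ ∀ k, 0 < k → k < π.1 →
  ∃ i j : Fin π.1, i.1 < k ∧ k ≤ j.1 ∧ π.2 j < π.2 i

noncomputable def KK (E : Set Permu) (m : ℕ) : ℕ := pcount (E ∩ {σ | Ind σ}) m

theorem eq_val {σ τ : Permu} (h : σ = τ) (i : ℕ) (hi : i < σ.1) (hi' : i < τ.1) :
    (σ.2 ⟨i, hi⟩).1 = (τ.2 ⟨i, hi'⟩).1 := by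
  subst h; rfl

theorem dsum_vl (σ τ : Permu) (i : ℕ) (h : i < σ.1) (h' : i < (dsum σ τ).1) :
    ((dsum σ τ).2 ⟨i, h'⟩).1 = (σ.2 ⟨i, h⟩).1 := by
  have := congrArg Fin.val (dsum_l σ τ ⟨i, h⟩)
  exact this

theorem dsum_vr (σ τ : Permu) (i : ℕ) (h : i < τ.1) (h' : σ.1 + i < (dsum σ τ).1) :
    ((dsum σ τ).2 ⟨σ.1 + i, h'⟩).1 = σ.1 + (τ.2 ⟨i, h⟩).1 := by
  have := congrArg Fin.val (dsum_r σ τ ⟨i, h⟩)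
  exact this

theorem perm_ext' {σ τ : Permu} (h : σ.1 = τ.1) (hv : ∀ i (hi : i < σ.1) (hi' : i < τ.1),
    (σ.2 ⟨i, hi⟩).1 = (τ.2 ⟨i, hi'⟩).1) : σ = τ := by
  apply perm_ext h
  rintro ⟨i, hi⟩ ⟨j, hj⟩ ⟨a, ha⟩ ⟨b, hb⟩ e1 e2
  simp only at e1 e2
  subst e1 e2
  rw [Fin.lt_def, Fin.lt_def, hv _ _ ha, hv _ _ hb]

theorem dsum_inj {σ τ σ' τ' : Permu} (h : dsum σ τ = dsum σ' τ') (h1 : Ind σ) (h2 : Ind σ') :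
    σ = σ' ∧ τ = τ' := by
  have hlen : σ.1 + τ.1 = σ'.1 + τ'.1 := congrArg Sigma.fst h
  have key : ∀ {σ τ σ' τ' : Permu}, dsum σ τ = dsum σ' τ' → Ind σ → Ind σ' → ¬ σ.1 < σ'.1 := by
    intro σ τ σ' τ' h h1 h2 hlt
    have hlen : σ.1 + τ.1 = σ'.1 + τ'.1 := congrArg Sigma.fst h
    obtain ⟨⟨i, hi⟩, ⟨j, hj⟩, hik, hjk, hij⟩ := h2.2 σ.1 h1.1 hlt
    simp only at hik hjk
    have e1 := eq_val h i (by show i < σ.1 + τ.1; omega) (by show i < σ'.1 + τ'.1; omega)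
    have e2 := eq_val h j (by show j < σ.1 + τ.1; omega) (by show j < σ'.1 + τ'.1; omega)
    rw [dsum_vl _ _ _ hik, dsum_vl _ _ _ hi] at e1
    obtain ⟨t, rfl⟩ := Nat.exists_eq_add_of_le hjk
    rw [dsum_vr _ _ _ (by omega), dsum_vl _ _ _ hj] at e2
    have := (σ.2 ⟨i, hik⟩).2
    rw [Fin.lt_def] at hij
    omega
  have hl : σ.1 = σ'.1 := le_antisymm (not_lt.1 (key h.symm h2 h1)) (not_lt.1 (key h h1 h2))
  constructor
  · refine perm_ext' hl (fun i hi hi' => ?_)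
    have e1 := eq_val h i (by show i < σ.1 + τ.1; omega) (by show i < σ'.1 + τ'.1; omega)
    rwa [dsum_vl _ _ _ hi, dsum_vl _ _ _ hi'] at e1
  · refine perm_ext' (by omega) (fun i hi hi' => ?_)
    have e1 := eq_val h (σ.1 + i) (by show _ < σ.1 + τ.1; omega) (by show _ < σ'.1 + τ'.1; omega)
    rw [dsum_vr _ _ _ hi] at e1
    have e2 : ∀ a (ha : a < (dsum σ' τ').1), a = σ'.1 + i → ((dsum σ' τ').2 ⟨a, ha⟩).1 = σ'.1 + (τ'.2 ⟨i, hi'⟩).1 := by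
      intro a ha h; subst h; exact dsum_vr _ _ _ _ _
    rw [e2 _ _ (by omega)] at e1
    omega

theorem rec_count {E : Set Permu} (hE : SumClosed E) (n M : ℕ) :
    ∑ m ∈ Finset.range M, (if m ≤ n then KK E m * pcount E (n - m) else 0) ≤ pcount E n := by
  classical
  let F : ℕ → Finset Permu := fun m => (pset_finite (E ∩ {σ | Ind σ}) m).toFinset
  let G : ℕ → Finset Permu := fun m => (pset_finite E m).toFinset
  have hF : ∀ m, KK E m = (F m).card := fun m => Set.ncard_eq_toFinset_card _ _
  have hG : ∀ m, pcount E m = (G m).card := fun m => Set.ncard_eq_toFinset_card _ _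
  let S : Finset (Σ _ : ℕ, Permu × Permu) := ((Finset.range M).filter (· ≤ n)).sigma (fun m => F m ×ˢ G (n - m))
  have hS : S.card = ∑ m ∈ Finset.range M, (if m ≤ n then KK E m * pcount E (n - m) else 0) := by
    rw [Finset.card_sigma, Finset.sum_filter]
    simp [hF, hG]
  rw [← hS, hG]
  apply Finset.card_le_card_of_injOn (fun x => dsum x.2.1 x.2.2)
  · rintro ⟨m, σ, τ⟩ hx
    simp [S, F, G] at hx ⊢
    exact ⟨hE _ hx.2.1.1.1 _ hx.2.2.1, by omega⟩
  · rintro ⟨m, σ, τ⟩ hx ⟨m', σ', τ'⟩ hx' h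
    simp [S, F, G] at hx hx'
    obtain ⟨e1, e2⟩ := dsum_inj h hx.2.1.1.2 hx'.2.1.1.2
    subst e1 e2
    have : m = m' := by rw [← hx.2.1.2, hx'.2.1.2]
    subst this
    rfl

theorem growth {E : Set Permu} (hE : SumClosed E) {ρ : ℝ} (hρ : 1 ≤ ρ) (c : ℕ → ℕ) (M : ℕ)
    (hc : ∀ m, m < M → c m ≤ KK E m) (h1 : ∀ n, 1 ≤ pcount E n)
    (hs : 1 ≤ ∑ m ∈ Finset.range M, (c m : ℝ) * (ρ⁻¹) ^ m) (h0 : c 0 = 0) : (ρ : EReal) ≤ ugr E := by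
  have hρ0 : 0 < ρ := by linarith
  apply le_ugr_of_bound (c := (ρ⁻¹) ^ M) (q := 0) (by positivity) hρ0
  intro n
  simp only [pow_zero, one_mul]
  induction n using Nat.strong_induction_on with
  | _ n ih =>
    rcases Nat.lt_or_ge n M with hn | hn
    · have h2 : (1 : ℝ) ≤ pcount E n := by exact_mod_cast h1 n
      refine le_trans ?_ h2
      rw [inv_pow, inv_mul_le_iff₀ (by positivity), mul_one]
      exact pow_le_pow_right₀ hρ hn.le
    · have h2 : ((∑ m ∈ Finset.range M, (if m ≤ n then KK E m * pcount E (n - m) else 0) : ℕ) : ℝ)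
          ≤ pcount E n := by exact_mod_cast rec_count hE n M
      refine le_trans ?_ h2
      push_cast
      calc ρ⁻¹ ^ M * ρ ^ n ≤ (ρ⁻¹ ^ M * ρ ^ n) * ∑ m ∈ Finset.range M, (c m : ℝ) * (ρ⁻¹) ^ m :=
            le_mul_of_one_le_right (by positivity) hs
        _ = ∑ m ∈ Finset.range M, (c m : ℝ) * (ρ⁻¹ ^ M * ρ ^ (n - m)) := by
            rw [Finset.mul_sum]
            refine Finset.sum_congr rfl (fun m hm => ?_)
            have hm' := Finset.mem_range.1 hm
            have : ρ ^ n = ρ ^ (n - m) * ρ ^ m := by rw [← pow_add]; congr 1; omega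
            rw [this, inv_pow ρ m]
            field_simp
        _ ≤ _ := by
            refine Finset.sum_le_sum (fun m hm => ?_)
            have hm' := Finset.mem_range.1 hm
            rw [if_pos (by omega)]
            rcases Nat.eq_zero_or_pos m with h | h
            · subst h; rw [h0]; simp; positivity
            · exact mul_le_mul (by exact_mod_cast hc m hm') (ih _ (by omega)) (by positivity) (by positivity)

def pone : Permu := ⟨1, Equiv.refl _⟩
def pempty : Permu := ⟨0, Equiv.refl _⟩

theorem one_le_pcount {E : Set Permu} (hE : SumClosed E) (h0 : pempty ∈ E) (h1 : pone ∈ E) (n : ℕ) :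
    1 ≤ pcount E n := by
  have : ∀ n, ∃ σ ∈ E, σ.1 = n := by
    intro n
    induction n with
    | zero => exact ⟨_, h0, rfl⟩
    | succ n ih =>
      obtain ⟨σ, hσ, hn⟩ := ih
      exact ⟨dsum σ pone, hE _ hσ _ h1, by show σ.1 + 1 = _; rw [hn]⟩
  obtain ⟨σ, h⟩ := this n
  exact (Set.ncard_pos (pset_finite E n)).2 ⟨σ, h⟩

theorem xi_lo {ξ : ℝ} (hpos : 0 < ξ) (hroot : ξ ^ 5 - 2 * ξ ^ 4 - ξ ^ 2 - ξ - 1 = 0) : 2.305 < ξ := by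
  by_contra h
  push Not at h
  have h2 : 2 < ξ := by
    by_contra h'
    push Not at h'
    have : ξ ^ 4 * (ξ - 2) ≤ 0 := mul_nonpos_of_nonneg_of_nonpos (by positivity) (by linarith)
    nlinarith
  have h3 : ξ ^ 2 ≤ 2.305 ^ 2 := pow_le_pow_left₀ hpos.le h 2
  have h4 : ξ ^ 2 * (ξ - 2) ≤ 2.305 ^ 2 * 0.305 := mul_le_mul h3 (by linarith) (by linarith) (by norm_num)
  have h5 : ξ ^ 2 * (ξ ^ 2 * (ξ - 2)) ≤ ξ ^ 2 * (2.305 ^ 2 * 0.305) := mul_le_mul_of_nonneg_left h4 (by positivity)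
  nlinarith

theorem xi_hi {ξ : ℝ} (hpos : 0 < ξ) (hroot : ξ ^ 5 - 2 * ξ ^ 4 - ξ ^ 2 - ξ - 1 = 0) : ξ < 2.3053 := by
  by_contra h
  push Not at h
  have h3 : 2.3053 ^ 2 ≤ ξ ^ 2 := pow_le_pow_left₀ (by norm_num) h 2
  have h4 : 2.3053 ^ 2 * 0.3053 ≤ ξ ^ 2 * (ξ - 2) := mul_le_mul h3 (by linarith) (by linarith) (by positivity)
  have h5 : ξ ^ 2 * (2.3053 ^ 2 * 0.3053) ≤ ξ ^ 2 * (ξ ^ 2 * (ξ - 2)) := mul_le_mul_of_nonneg_left h4 (by positivity)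
  nlinarith

structure Thin (E : Set Permu) : Prop where
  cls : IsPermClass E
  sum : SumClosed E
  one : pone ∈ E
  hgr : ∃ ξ : ℝ, 0 < ξ ∧ ξ ^ 5 - 2 * ξ ^ 4 - ξ ^ 2 - ξ - 1 = 0 ∧ ugr E < (ξ : EReal)

theorem Thin.emp {E} (h : Thin E) : pempty ∈ E :=
  h.cls _ _ (PLe.of (fun i => i.elim0) (fun i => i.elim0) (fun i => i.elim0)) h.one

theorem Thin.pc {E} (h : Thin E) (n) : 1 ≤ pcount E n := one_le_pcount h.sum h.emp h.one n

theorem Thin.vec {E} (h : Thin E) (c : ℕ → ℕ) (M : ℕ) (h0 : c 0 = 0)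
    (hs : 1 ≤ ∑ m ∈ Finset.range M, (c m : ℝ) * ((2.3053 : ℝ)⁻¹) ^ m) : ∃ m < M, KK E m < c m := by
  by_contra hc
  push Not at hc
  obtain ⟨ξ, h1, h2, h3⟩ := h.hgr
  have h4 := growth h.sum (ρ := 2.3053) (by norm_num) c M hc h.pc hs h0
  have h5 : (ξ : EReal) < ((2.3053 : ℝ) : EReal) := by exact_mod_cast xi_hi h1 h2
  exact absurd (h3.trans h5) (not_lt.2 h4)

def PP (m : ℕ) : ℕ := if m = 0 then 0 else if m ≤ 2 then 1 else if m = 3 then 2 else if m = 4 then 3 else 4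

theorem Thin.noP {E} (h : Thin E) : ∃ m, KK E m < PP m := by
  by_contra hc
  push Not at hc
  obtain ⟨ξ, h1, h2, h3⟩ := h.hgr
  have hlo := xi_lo h1 h2
  obtain ⟨s, hs1, hs2⟩ := EReal.lt_iff_exists_real_btwn.1 h3
  have hs2' : s < ξ := by exact_mod_cast hs2
  obtain ⟨ρ, hr1, hr2⟩ := exists_between (max_lt hs2' hlo)
  have hρ : 2.305 < ρ := lt_of_le_of_lt (le_max_right _ _) hr1
  have hsρ : s < ρ := lt_of_le_of_lt (le_max_left _ _) hr1
  let y := ρ⁻¹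
  have hy0 : 0 < y := by simp only [y]; positivity
  have hy1 : y < 1 := inv_lt_one_of_one_lt₀ (by linarith)
  have hyx : ξ⁻¹ < y := by simp only [y]; gcongr
  have hz : 2 * ξ⁻¹ + ξ⁻¹ ^ 3 + ξ⁻¹ ^ 4 + ξ⁻¹ ^ 5 = 1 := by
    field_simp; linarith
  have hy : 1 < 2 * y + y ^ 3 + y ^ 4 + y ^ 5 := by
    rw [← hz]; gcongr
  obtain ⟨k, hk⟩ := exists_pow_lt_of_lt_one (show 0 < (2 * y + y ^ 3 + y ^ 4 + y ^ 5 - 1) / 4 by linarith) hy1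
  have hsum : 1 ≤ ∑ m ∈ Finset.range (5 + k), (PP m : ℝ) * y ^ m := by
    rw [Finset.sum_range_add]
    have e : ∑ x ∈ Finset.range k, (PP (5 + x) : ℝ) * y ^ (5 + x) = 4 * y ^ 5 * ∑ x ∈ Finset.range k, y ^ x := by
      rw [Finset.mul_sum]
      refine Finset.sum_congr rfl (fun x _ => ?_)
      have : PP (5 + x) = 4 := by unfold PP; split_ifs <;> omega
      rw [this, pow_add]; push_cast; ring
    have g := mul_neg_geom_sum y k
    set G := ∑ x ∈ Finset.range k, y ^ x
    rw [e]
    norm_num [Finset.sum_range_succ, PP]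
    have h5 : y ^ 5 < 1 := pow_lt_one₀ hy0.le hy1 (by norm_num)
    have h6 : y ^ 5 * y ^ k ≤ y ^ k := mul_le_of_le_one_left (by positivity) h5.le
    have : 0 ≤ (1 - y) * (y + y ^ 2 + 2 * y ^ 3 + 3 * y ^ 4 + 4 * y ^ 5 * G - 1) := by
      have : (1 - y) * (y + y ^ 2 + 2 * y ^ 3 + 3 * y ^ 4 + 4 * y ^ 5 * G - 1)
        = (2 * y + y ^ 3 + y ^ 4 + y ^ 5 - 1) - 4 * (y ^ 5 * y ^ k) + 4 * y ^ 5 * ((1 - y) * G - (1 - y ^ k)) := by ring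
      rw [this, g]; linarith
    have := nonneg_of_mul_nonneg_right this (by linarith)
    linarith
  have h4 := growth h.sum (ρ := ρ) (by linarith) PP (5 + k) (fun m _ => hc m) h.pc hsum rfl
  exact absurd ((hs1.trans (by exact_mod_cast hsρ)) : ugr E < (ρ : EReal)) (not_lt.2 h4)

theorem Thin.pinv {E} (h : Thin E) : Thin (pinv ⁻¹' E) := by
  refine ⟨isSym_pinv.cls h.cls, fun σ hσ τ hτ => ?_, h.one, ?_⟩
  · exact h.sum _ hσ _ hτ
  · rw [isSym_pinv.ugr]; exact h.hgr

theorem KK_ge {E : Set Permu} {m : ℕ} (hm : 0 < m) (l : List (Fin m → Fin m)) (hn : l.Nodup)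
    (hl : ∀ f ∈ l, ∀ k < m, 0 < k → ∃ i j : Fin m, i.1 < k ∧ k ≤ j.1 ∧ f j < f i)
    (hE : ∀ f ∈ l, ∃ p : Equiv.Perm (Fin m), (p : Fin m → Fin m) = f ∧ (⟨m, p⟩ : Permu) ∈ E) :
    l.length ≤ KK E m := by
  classical
  choose! p hp using hE
  rw [← List.toFinset_card_of_nodup hn, ← Set.ncard_coe_finset]
  refine Set.ncard_le_ncard_of_injOn (fun f => (⟨m, p f⟩ : Permu)) ?_ ?_ (pset_finite _ m)
  · intro f hf
    have hf' : f ∈ l := by simpa using hf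
    refine ⟨⟨(hp f hf').2, hm, fun k hk hk' => ?_⟩, rfl⟩
    obtain ⟨i, j, h⟩ := hl f hf' k hk' hk
    refine ⟨i, j, ?_⟩
    simp only [(hp f hf').1]
    exact h
  · intro f hf g hg h
    have hf' : f ∈ l := by simpa using hf
    have hg' : g ∈ l := by simpa using hg
    have : p f = p g := by simpa using h
    rw [← (hp f hf').1, ← (hp g hg').1, this]

theorem Thin.excl {E : Set Permu} (h : Thin E) (Q : ∀ m, (Fin m → Fin m) → Prop)
    [∀ m f, Decidable (Q m f)]
    (L : (m : ℕ) → List (Fin m → Fin m)) (M : ℕ)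
    (h1 : ∀ m < M, 0 < m → (L m).Nodup ∧ (L m).all (fun f => decide (Function.Injective f ∧ Q m f ∧
      ∀ k < m, 0 < k → ∃ i j : Fin m, i.1 < k ∧ k ≤ j.1 ∧ f j < f i)) = true)
    (h0 : (L 0).length = 0)
    (hs : 1 ≤ ∑ m ∈ Finset.range M, ((L m).length : ℝ) * ((2.3053 : ℝ)⁻¹) ^ m) :
    ∃ σ : Permu, Q σ.1 σ.2 ∧ σ ∉ E := by
  by_contra hc
  push Not at hc
  obtain ⟨m, hm, hlt⟩ := h.vec (fun m => (L m).length) M h0 hs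
  have hm0 : 0 < m := by
    rcases Nat.eq_zero_or_pos m with h | h
    · subst h; simp only [h0] at hlt; omega
    · exact h
  obtain ⟨hn, hf⟩ := h1 m hm hm0
  simp only [List.all_eq_true, decide_eq_true_eq] at hf
  refine absurd hlt (not_lt.2 (KK_ge hm0 (L m) hn (fun f h => (hf f h).2.2) (fun f h => ?_)))
  refine ⟨Equiv.ofBijective f (Finite.injective_iff_bijective.1 (hf f h).1), rfl, ?_⟩
  exact hc ⟨m, _⟩ (hf f h).2.1

def QV (d1 d2 : Bool) (m : ℕ) (f : Fin m → Fin m) : Prop := ∃ h < m + 1,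
  (∀ i j, i < j → j.1 < h → (f i < f j ↔ d1 = true)) ∧ (∀ i j, i < j → h ≤ i.1 → (f i < f j ↔ d2 = true))
def QS (m : ℕ) (f : Fin m → Fin m) : Prop := ∀ i j, i < j → f i < f j → j.1 = i.1 + 1
def QC1 (m : ℕ) (f : Fin m → Fin m) : Prop :=
  ∀ i j, i < j → (if j.1 + 1 = m then f j < f i else (f j < f i → j.1 = i.1 + 1))
def QC2 (m : ℕ) (f : Fin m → Fin m) : Prop :=
  ∀ i j, i < j → (if i.1 = 0 then f j < f i else (f j < f i → j.1 = i.1 + 1))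

instance (d1 d2 m f) : Decidable (QV d1 d2 m f) := by unfold QV; infer_instance
instance (m f) : Decidable (QS m f) := by unfold QS; infer_instance
instance (m f) : Decidable (QC1 m f) := by unfold QC1; infer_instance
instance (m f) : Decidable (QC2 m f) := by unfold QC2; infer_instance

def LII : (m : ℕ) → List (Fin m → Fin m)
  | 1 => [![0]]
  | 2 => [![1, 0]]
  | 3 => [![1, 2, 0], ![2, 0, 1]]
  | 4 => [![1, 2, 3, 0], ![1, 3, 0, 2], ![2, 3, 0, 1], ![3, 0, 1, 2]]
  | 5 => [![1, 2, 3, 4, 0], ![1, 2, 4, 0, 3], ![1, 3, 4, 0, 2], ![1, 4, 0, 2, 3], ![2, 3, 4, 0, 1]]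
  | _ => []

def LID : (m : ℕ) → List (Fin m → Fin m)
  | 1 => [![0]]
  | 2 => [![1, 0]]
  | 3 => [![1, 2, 0], ![2, 1, 0]]
  | 4 => [![1, 2, 3, 0], ![1, 3, 2, 0], ![2, 3, 1, 0], ![3, 2, 1, 0]]
  | 5 => [![1, 2, 3, 4, 0], ![1, 2, 4, 3, 0], ![1, 3, 4, 2, 0], ![1, 4, 3, 2, 0], ![2, 3, 4, 1, 0]]
  | _ => []

def LDI : (m : ℕ) → List (Fin m → Fin m)
  | 1 => [![0]]
  | 2 => [![1, 0]]
  | 3 => [![2, 0, 1], ![2, 1, 0]]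
  | 4 => [![3, 0, 1, 2], ![3, 1, 0, 2], ![3, 2, 0, 1], ![3, 2, 1, 0]]
  | 5 => [![4, 0, 1, 2, 3], ![4, 1, 0, 2, 3], ![4, 2, 0, 1, 3], ![4, 2, 1, 0, 3], ![4, 3, 0, 1, 2]]
  | _ => []

def LDD : (m : ℕ) → List (Fin m → Fin m)
  | 1 => [![0]]
  | 2 => [![1, 0]]
  | 3 => [![1, 2, 0], ![2, 0, 1], ![2, 1, 0]]
  | 4 => [![1, 3, 2, 0], ![2, 0, 3, 1], ![2, 1, 3, 0], ![2, 3, 1, 0]]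
  | _ => []

def LS : (m : ℕ) → List (Fin m → Fin m)
  | 1 => [![0]]
  | 2 => [![1, 0]]
  | 3 => [![1, 2, 0], ![2, 0, 1], ![2, 1, 0]]
  | 4 => [![2, 3, 0, 1], ![2, 3, 1, 0], ![3, 1, 2, 0], ![3, 2, 0, 1], ![3, 2, 1, 0]]
  | _ => []

def LC1 : (m : ℕ) → List (Fin m → Fin m)
  | 1 => [![0]]
  | 2 => [![1, 0]]
  | 3 => [![1, 2, 0], ![2, 1, 0]]
  | 4 => [![1, 2, 3, 0], ![1, 3, 2, 0], ![2, 1, 3, 0]]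
  | 5 => [![1, 2, 3, 4, 0], ![1, 2, 4, 3, 0], ![1, 3, 2, 4, 0], ![2, 1, 3, 4, 0], ![2, 1, 4, 3, 0]]
  | 6 => [![1, 2, 3, 4, 5, 0], ![1, 2, 3, 5, 4, 0], ![1, 2, 4, 3, 5, 0], ![1, 3, 2, 4, 5, 0], ![1, 3, 2, 5, 4, 0]]
  | _ => []

def LC2 : (m : ℕ) → List (Fin m → Fin m)
  | 1 => [![0]]
  | 2 => [![1, 0]]
  | 3 => [![2, 0, 1], ![2, 1, 0]]
  | 4 => [![3, 0, 1, 2], ![3, 0, 2, 1], ![3, 1, 0, 2]]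
  | 5 => [![4, 0, 1, 2, 3], ![4, 0, 1, 3, 2], ![4, 0, 2, 1, 3], ![4, 1, 0, 2, 3], ![4, 1, 0, 3, 2]]
  | 6 => [![5, 0, 1, 2, 3, 4], ![5, 0, 1, 2, 4, 3], ![5, 0, 1, 3, 2, 4], ![5, 0, 2, 1, 3, 4], ![5, 0, 2, 1, 4, 3]]
  | _ => []

theorem Thin.exV {E} (h : Thin E) (d1 d2 : Bool) : ∃ σ : Permu, QV d1 d2 σ.1 σ.2 ∧ σ ∉ E := by
  cases d1 <;> cases d2
  · refine h.excl _ LDD 5 ?_ rfl ?_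
    · intro m hm hm0; interval_cases m <;> exact ⟨by decide +kernel, by decide +kernel⟩
    · norm_num [Finset.sum_range_succ, LDD]
  · refine h.excl _ LDI 6 ?_ rfl ?_
    · intro m hm hm0; interval_cases m <;> exact ⟨by decide +kernel, by decide +kernel⟩
    · norm_num [Finset.sum_range_succ, LDI]
  · refine h.excl _ LID 6 ?_ rfl ?_
    · intro m hm hm0; interval_cases m <;> exact ⟨by decide +kernel, by decide +kernel⟩
    · norm_num [Finset.sum_range_succ, LID]
  · refine h.excl _ LII 6 ?_ rfl ?_
    · intro m hm hm0; interval_cases m <;> exact ⟨by decide +kernel, by decide +kernel⟩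
    · norm_num [Finset.sum_range_succ, LII]

theorem Thin.exS {E} (h : Thin E) : ∃ σ : Permu, QS σ.1 σ.2 ∧ σ ∉ E := by
  refine h.excl _ LS 5 ?_ rfl ?_
  · intro m hm hm0; interval_cases m <;> exact ⟨by decide +kernel, by decide +kernel⟩
  · norm_num [Finset.sum_range_succ, LS]

theorem Thin.exC1 {E} (h : Thin E) : ∃ σ : Permu, QC1 σ.1 σ.2 ∧ σ ∉ E := by
  refine h.excl _ LC1 7 ?_ rfl ?_
  · intro m hm hm0; interval_cases m <;> exact ⟨by decide +kernel, by decide +kernel⟩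
  · norm_num [Finset.sum_range_succ, LC1]

theorem Thin.exC2 {E} (h : Thin E) : ∃ σ : Permu, QC2 σ.1 σ.2 ∧ σ ∉ E := by
  refine h.excl _ LC2 7 ?_ rfl ?_
  · intro m hm hm0; interval_cases m <;> exact ⟨by decide +kernel, by decide +kernel⟩
  · norm_num [Finset.sum_range_succ, LC2]

theorem ramsey_pre {κ : Type} [Finite κ] (m : ℕ) : ∃ N : ℕ, ∀ (c : ℕ → ℕ → κ) (S : Finset ℕ), N ≤ S.card →
    ∃ (f : ℕ → ℕ) (g : ℕ → κ), (∀ i j, i < j → j < m → f i < f j ∧ c (f i) (f j) = g i) ∧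
      ∀ i < m, f i ∈ S := by
  classical
  have := Fintype.ofFinite κ
  induction m with
  | zero =>
    refine ⟨0, fun c S _ => ⟨id, fun i => c i i, ?_, ?_⟩⟩ <;> intros <;> omega
  | succ m ih =>
    obtain ⟨N, hN⟩ := ih
    refine ⟨Fintype.card κ * N + 1, fun c S hS => ?_⟩
    have hne : S.Nonempty := Finset.card_pos.1 (by omega)
    let x := S.min' hne
    have hx : x ∈ S := Finset.min'_mem _ _
    have hlt : ∀ y ∈ S.erase x, x < y := by
      intro y hy
      have h1 := Finset.mem_erase.1 hy
      exact lt_of_le_of_ne (Finset.min'_le _ _ h1.2) (Ne.symm h1.1)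
    have hne' : (Finset.univ : Finset κ).Nonempty := ⟨c 0 0, Finset.mem_univ _⟩
    obtain ⟨col, -, hcol⟩ := Finset.exists_le_card_fiber_of_mul_le_card_of_maps_to (s := S.erase x)
      (t := (Finset.univ : Finset κ)) (f := fun y => c x y) (n := N) (fun _ _ => Finset.mem_univ _) hne'
      (by rw [Finset.card_erase_of_mem hx, Finset.card_univ]; omega)
    obtain ⟨f, g, h1, h2⟩ := hN c _ hcol
    have h2' : ∀ i < m, f i ∈ S.erase x ∧ c x (f i) = col := fun i hi => by simpa using h2 i hi
    refine ⟨fun i => if i = 0 then x else f (i - 1), fun i => if i = 0 then col else g (i - 1), ?_, ?_⟩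
    · intro i j hij hj
      rcases Nat.eq_zero_or_pos i with h | h
      · have := h2' (j - 1) (by omega)
        simp only [h, if_true, if_neg (show j ≠ 0 by omega)]
        exact ⟨hlt _ this.1, this.2⟩
      · simp only [if_neg (show i ≠ 0 by omega), if_neg (show j ≠ 0 by omega)]
        exact h1 _ _ (by omega) (by omega)
    · intro i hi
      rcases Nat.eq_zero_or_pos i with h | h
      · simpa [h] using hx
      · simp only [if_neg (show i ≠ 0 by omega)]
        exact Finset.mem_of_mem_erase (h2' _ (by omega)).1

theorem ramsey (κ : Type) [Finite κ] (k : ℕ) : ∃ N : ℕ, ∀ (c : ℕ → ℕ → κ),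
    ∃ (f : ℕ → ℕ) (col : κ), (∀ i j, i < j → j < k → f i < f j) ∧ (∀ i < k, f i < N) ∧
      (∀ i j, i < j → j < k → c (f i) (f j) = col) := by
  classical
  have := Fintype.ofFinite κ
  obtain ⟨N, hN⟩ := ramsey_pre (κ := κ) (Fintype.card κ * k)
  refine ⟨N, fun c => ?_⟩
  obtain ⟨f, g, h1, h2⟩ := hN c (Finset.range N) (by simp)
  have hne' : (Finset.univ : Finset κ).Nonempty := ⟨c 0 0, Finset.mem_univ _⟩
  obtain ⟨col, -, hcol⟩ := Finset.exists_le_card_fiber_of_mul_le_card_of_maps_to (s := Finset.range (Fintype.card κ * k))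
      (t := (Finset.univ : Finset κ)) (f := g) (n := k) (fun _ _ => Finset.mem_univ _) hne'
      (by rw [Finset.card_univ, Finset.card_range])
  obtain ⟨T, hT, hTc⟩ := Finset.exists_subset_card_eq hcol
  have hT' : ∀ x ∈ T, x < Fintype.card κ * k ∧ g x = col := fun x hx => by simpa using hT hx
  let e := T.orderEmbOfFin hTc
  have he : ∀ i, e i ∈ T := Finset.orderEmbOfFin_mem T hTc
  refine ⟨fun i => if h : i < k then f (e ⟨i, h⟩) else 0, col, ?_, ?_, ?_⟩
  · intro i j hij hj
    simp only [dif_pos hj, dif_pos (hij.trans hj)]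
    exact (h1 _ _ (e.strictMono (by simpa using hij)) (hT' _ (he _)).1).1
  · intro i hi
    simp only [dif_pos hi]
    simpa using h2 _ (hT' _ (he _)).1
  · intro i j hij hj
    simp only [dif_pos hj, dif_pos (hij.trans hj)]
    rw [(h1 _ _ (e.strictMono (by simpa using hij)) (hT' _ (he _)).1).2]
    exact (hT' _ (he _)).2

def Occ {α : Type} (σ : Permu) (p v : α → ℤ) : Prop := ∃ g : Fin σ.1 → α,
  (∀ i j, i < j → p (g i) < p (g j)) ∧ (∀ i j, σ.2 i < σ.2 j → v (g i) < v (g j))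

theorem embV {α : Type} {p v : α → ℤ} {d1 d2 : Bool} {k : ℕ} (l r : ℕ → α)
    (hv : ∀ a b, a < b → b < k → v (l a) < v (l b) ∧ v (l a) < v (r b) ∧ v (r a) < v (l b) ∧ v (r a) < v (r b))
    (hlr : ∀ a b, a < k → b < k → p (l a) < p (r b))
    (h1 : ∀ a b, a < b → b < k → if d1 then p (l a) < p (l b) else p (l b) < p (l a))
    (h2 : ∀ a b, a < b → b < k → if d2 then p (r a) < p (r b) else p (r b) < p (r a))
    {σ : Permu} (hσ : QV d1 d2 σ.1 σ.2) (hk : σ.1 ≤ k) : Occ σ p v := by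
  obtain ⟨h, -, q1, q2⟩ := hσ
  have hlt : ∀ i, (σ.2 i).1 < k := fun i => lt_of_lt_of_le (σ.2 i).2 hk
  refine ⟨fun i => if i.1 < h then l (σ.2 i).1 else r (σ.2 i).1, ?_, ?_⟩
  · intro i j hij
    have hne : σ.2 i ≠ σ.2 j := fun h => hij.ne (σ.2.injective h)
    by_cases hj : j.1 < h
    · have hi : i.1 < h := lt_trans hij hj
      simp only [hi, hj, if_true]
      have := q1 i j hij hj
      rcases lt_or_gt_of_ne hne with h3 | h3
      · have h4 := h1 _ _ h3 (hlt j); rw [if_pos (this.1 h3)] at h4; exact h4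
      · have h4 := h1 _ _ h3 (hlt i)
        rw [if_neg (fun h => absurd (this.2 h) h3.asymm)] at h4; exact h4
    · by_cases hi : i.1 < h
      · simp only [hi, hj, if_true, if_false]
        exact hlr _ _ (hlt _) (hlt _)
      · simp only [hi, hj, if_false]
        have := q2 i j hij (not_lt.1 hi)
        rcases lt_or_gt_of_ne hne with h3 | h3
        · have h4 := h2 _ _ h3 (hlt j); rw [if_pos (this.1 h3)] at h4; exact h4
        · have h4 := h2 _ _ h3 (hlt i)
          rw [if_neg (fun h => absurd (this.2 h) h3.asymm)] at h4; exact h4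
  · intro i j hij
    obtain ⟨e1, e2, e3, e4⟩ := hv _ _ hij (hlt j)
    dsimp only
    split_ifs <;> assumption

theorem embS {α : Type} {p v : α → ℤ} {k : ℕ} (c : Bool → ℕ → α)
    (h0 : ∀ i < k, p (c false i) < p (c true i) ∧ v (c false i) < v (c true i))
    (h1 : ∀ s t i j, i < j → j < k → p (c s i) < p (c t j) ∧ v (c t j) < v (c s i))
    {σ : Permu} (hσ : QS σ.1 σ.2) (hk : σ.1 ≤ k) : Occ σ p v := by
  classical
  let sec : Fin σ.1 → Prop := fun i => ∃ j : Fin σ.1, j.1 + 1 = i.1 ∧ σ.2 j < σ.2 i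
  refine ⟨fun i => if sec i then c true (i.1 - 1) else c false i.1, ?_, ?_⟩
  · intro i j hij
    have hij' : i.1 < j.1 := hij
    dsimp only
    split_ifs with hi hj hj
    · obtain ⟨a, ha, _⟩ := hi
      exact (h1 _ _ _ _ (by omega) (by omega)).1
    · exact (h1 _ _ _ _ (by omega) (by omega)).1
    · rcases Nat.lt_or_ge i.1 (j.1 - 1) with h | h
      · exact (h1 _ _ _ _ h (by omega)).1
      · rw [show i.1 = j.1 - 1 by omega]; exact (h0 _ (by omega)).1
    · exact (h1 _ _ _ _ (by omega) (by omega)).1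
  · intro i j hij
    rcases lt_trichotomy i j with h | h | h
    · have hj := hσ i j h hij
      have sj : sec j := ⟨i, by omega, hij⟩
      have si : ¬ sec i := by
        rintro ⟨a, ha, ha'⟩
        have := hσ a j (by rw [Fin.lt_def]; omega) (ha'.trans hij)
        omega
      simp only [sj, si, if_true, if_false]
      rw [show i.1 = j.1 - 1 by omega]; exact (h0 _ (by omega)).2
    · subst h; exact absurd hij (lt_irrefl _)
    · have h' : j.1 < i.1 := h
      dsimp only
      split_ifs with hi hj hj
      · obtain ⟨a, ha, _⟩ := hj
        exact (h1 _ _ _ _ (by omega) (by omega)).2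
      · rcases Nat.lt_or_ge j.1 (i.1 - 1) with h | h
        · exact (h1 _ _ _ _ h (by omega)).2
        · obtain ⟨a, ha, ha'⟩ := hi
          have : a = j := Fin.ext (by omega)
          subst this
          exact absurd ha' hij.asymm
      · exact (h1 _ _ _ _ (by omega) (by omega)).2
      · exact (h1 _ _ _ _ (by omega) (by omega)).2

theorem embC1 {α : Type} {p v : α → ℤ} {k : ℕ} (c : Bool → ℕ → α) (w : α)
    (h0 : ∀ i < k, p (c false i) < p (c true i) ∧ v (c true i) < v (c false i))
    (h1 : ∀ s t i j, i < j → j < k → p (c s i) < p (c t j) ∧ v (c s i) < v (c t j))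
    (hw : ∀ s i, i < k → p (c s i) < p w ∧ v w < v (c s i))
    {σ : Permu} (hσ : QC1 σ.1 σ.2) (hk : σ.1 ≤ k) : Occ σ p v := by
  classical
  let sec : Fin σ.1 → Prop := fun i => ∃ j : Fin σ.1, j.1 + 1 = i.1 ∧ σ.2 i < σ.2 j
  refine ⟨fun i => if i.1 + 1 = σ.1 then w else if sec i then c true (i.1 - 1) else c false i.1, ?_, ?_⟩
  · intro i j hij
    have hij' : i.1 < j.1 := hij
    dsimp only
    rw [if_neg (show ¬ (i.1 + 1 = σ.1) by omega)]
    by_cases hl : j.1 + 1 = σ.1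
    · rw [if_pos hl]
      split_ifs <;> exact (hw _ _ (by omega)).1
    rw [if_neg hl]
    split_ifs with hi hj hj
    · obtain ⟨a, ha, _⟩ := hi
      exact (h1 _ _ _ _ (by omega) (by omega)).1
    · exact (h1 _ _ _ _ (by omega) (by omega)).1
    · rcases Nat.lt_or_ge i.1 (j.1 - 1) with h | h
      · exact (h1 _ _ _ _ h (by omega)).1
      · rw [show i.1 = j.1 - 1 by omega]; exact (h0 _ (by omega)).1
    · exact (h1 _ _ _ _ (by omega) (by omega)).1
  · intro i j hij
    have hne : i ≠ j := by rintro rfl; exact lt_irrefl _ hij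
    by_cases hl : j.1 + 1 = σ.1
    · have h := hσ i j (by rw [Fin.lt_def]; have : i.1 ≠ j.1 := fun h => hne (Fin.ext h); omega)
      rw [if_pos hl] at h
      exact absurd hij h.asymm
    dsimp only
    rw [if_neg hl]
    by_cases hl' : i.1 + 1 = σ.1
    · rw [if_pos hl']
      split_ifs <;> exact (hw _ _ (by omega)).2
    rw [if_neg hl']
    rcases lt_or_gt_of_ne hne with h | h
    · have h' : i.1 < j.1 := h
      split_ifs with hi hj hj
      · obtain ⟨a, ha, _⟩ := hi
        exact (h1 _ _ _ _ (by omega) (by omega)).2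
      · exact (h1 _ _ _ _ (by omega) (by omega)).2
      · rcases Nat.lt_or_ge i.1 (j.1 - 1) with h | h
        · exact (h1 _ _ _ _ h (by omega)).2
        · obtain ⟨a, ha, ha'⟩ := hj
          have : a = i := Fin.ext (by omega)
          subst this
          exact absurd ha' hij.asymm
      · exact (h1 _ _ _ _ (by omega) (by omega)).2
    · have hj := hσ j i h
      rw [if_neg hl'] at hj
      have hj := hj hij
      have sj : sec i := ⟨j, by omega, hij⟩
      have si : ¬ sec j := by
        rintro ⟨a, ha, ha'⟩
        have := hσ a i (by rw [Fin.lt_def]; omega)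
        rw [if_neg hl'] at this
        have := this (hij.trans ha')
        omega
      simp only [sj, si, if_true, if_false]
      rw [show j.1 = i.1 - 1 by omega]; exact (h0 _ (by omega)).2

theorem embC2 {α : Type} {p v : α → ℤ} {k : ℕ} (c : Bool → ℕ → α) (w : α)
    (h0 : ∀ i < k, p (c false i) < p (c true i) ∧ v (c true i) < v (c false i))
    (h1 : ∀ s t i j, i < j → j < k → p (c s i) < p (c t j) ∧ v (c s i) < v (c t j))
    (hw : ∀ s i, i < k → p w < p (c s i) ∧ v (c s i) < v w)
    {σ : Permu} (hσ : QC2 σ.1 σ.2) (hk : σ.1 ≤ k) : Occ σ p v := by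
  classical
  let sec : Fin σ.1 → Prop := fun i => ∃ j : Fin σ.1, j.1 ≠ 0 ∧ j.1 + 1 = i.1 ∧ σ.2 i < σ.2 j
  refine ⟨fun i => if i.1 = 0 then w else if sec i then c true (i.1 - 1) else c false i.1, ?_, ?_⟩
  · intro i j hij
    have hij' : i.1 < j.1 := hij
    dsimp only
    rw [if_neg (show ¬ (j.1 = 0) by omega)]
    by_cases hl : i.1 = 0
    · rw [if_pos hl]
      split_ifs <;> exact (hw _ _ (by omega)).1
    rw [if_neg hl]
    split_ifs with hi hj hj
    · exact (h1 _ _ _ _ (by omega) (by omega)).1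
    · exact (h1 _ _ _ _ (by omega) (by omega)).1
    · rcases Nat.lt_or_ge i.1 (j.1 - 1) with h | h
      · exact (h1 _ _ _ _ h (by omega)).1
      · rw [show i.1 = j.1 - 1 by omega]; exact (h0 _ (by omega)).1
    · exact (h1 _ _ _ _ (by omega) (by omega)).1
  · intro i j hij
    have hne : i ≠ j := by rintro rfl; exact lt_irrefl _ hij
    by_cases hl : i.1 = 0
    · have h := hσ i j (by rw [Fin.lt_def]; have : i.1 ≠ j.1 := fun h => hne (Fin.ext h); omega)
      rw [if_pos hl] at h
      exact absurd hij h.asymm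
    dsimp only
    rw [if_neg hl]
    by_cases hl' : j.1 = 0
    · rw [if_pos hl']
      split_ifs <;> exact (hw _ _ (by omega)).2
    rw [if_neg hl']
    rcases lt_or_gt_of_ne hne with h | h
    · have h' : i.1 < j.1 := h
      split_ifs with hi hj hj
      · exact (h1 _ _ _ _ (by omega) (by omega)).2
      · exact (h1 _ _ _ _ (by omega) (by omega)).2
      · rcases Nat.lt_or_ge i.1 (j.1 - 1) with h | h
        · exact (h1 _ _ _ _ h (by omega)).2
        · obtain ⟨a, _, ha, ha'⟩ := hj
          have : a = i := Fin.ext (by omega)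
          subst this
          exact absurd ha' hij.asymm
      · exact (h1 _ _ _ _ (by omega) (by omega)).2
    · have hj := hσ j i h
      rw [if_neg hl'] at hj
      have hj := hj hij
      have sj : sec i := ⟨j, hl', by omega, hij⟩
      have si : ¬ sec j := by
        rintro ⟨a, ha0, ha, ha'⟩
        have := hσ a i (by rw [Fin.lt_def]; omega)
        rw [if_neg ha0] at this
        have := this (hij.trans ha')
        omega
      simp only [sj, si, if_true, if_false]
      rw [show j.1 = i.1 - 1 by omega]; exact (h0 _ (by omega)).2

def CfgV {α : Type} (p v : α → ℤ) (d1 d2 : Bool) (k : ℕ) (l r : ℕ → α) : Prop :=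
    (∀ a b, a < b → b < k → v (l a) < v (l b) ∧ v (l a) < v (r b) ∧ v (r a) < v (l b) ∧ v (r a) < v (r b)) ∧
    (∀ a b, a < k → b < k → p (l a) < p (r b)) ∧
    (∀ a b, a < b → b < k → if d1 then p (l a) < p (l b) else p (l b) < p (l a)) ∧
    (∀ a b, a < b → b < k → if d2 then p (r a) < p (r b) else p (r b) < p (r a))

def Cfg21 {α : Type} (p v : α → ℤ) (k : ℕ) (c : Bool → ℕ → α) : Prop :=
    (∀ i < k, p (c false i) < p (c true i) ∧ v (c true i) < v (c false i)) ∧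
    (∀ s t i j, i < j → j < k → p (c s i) < p (c t j) ∧ v (c s i) < v (c t j))

structure Free {α : Type} (p v : α → ℤ) (k : ℕ) : Prop where
  V : ∀ d1 d2 l r, ¬ CfgV p v d1 d2 k l r
  S : ∀ c, ¬ Cfg21 p (fun x => - v x) k c
  C1 : ∀ c w, Cfg21 p v k c → (∀ s i, i < k → p (c s i) < p w ∧ v w < v (c s i)) → False
  C2 : ∀ c w, Cfg21 p v k c → (∀ s i, i < k → p w < p (c s i) ∧ v (c s i) < v w) → False

def Bas (E : Set Permu) (β : Permu) : Prop := β ∉ E ∧ ∀ σ, PLe σ β → σ ≠ β → σ ∈ E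

def pp (β : Permu) (x : Fin β.1) : ℤ := x.1
def vv (β : Permu) (x : Fin β.1) : ℤ := (β.2 x).1

theorem pp_inj (β : Permu) {x y} (h : pp β x = pp β y) : x = y := by
  unfold pp at h; exact Fin.ext (by omega)
theorem vv_inj (β : Permu) {x y} (h : vv β x = vv β y) : x = y := by
  unfold vv at h; exact β.2.injective (Fin.ext (by omega))

theorem occ_PLe {σ β : Permu} (h : Occ σ (pp β) (vv β)) : PLe σ β := by
  obtain ⟨g, h1, h2⟩ := h
  refine PLe.of g (fun i j hij => ?_) (fun i j hij => ?_)
  · have := h1 i j hij; unfold pp at this; rw [Fin.lt_def]; omega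
  · have := h2 i j hij; unfold vv at this; rw [Fin.lt_def]; omega

theorem occ_PLe' {σ β : Permu} (h : Occ σ (vv β) (pp β)) : PLe (pinv σ) β := by
  obtain ⟨g, h1, h2⟩ := h
  refine PLe.of (fun i => g (σ.2.symm i)) (fun i j hij => ?_) (fun i j hij => ?_)
  · have := h2 (σ.2.symm i) (σ.2.symm j) (by simpa using hij); unfold pp at this; rw [Fin.lt_def]; omega
  · have := h1 (σ.2.symm i) (σ.2.symm j) hij; unfold vv at this; rw [Fin.lt_def]; omega

theorem Thin.free_aux {E} (h : Thin E) : ∃ k : ℕ, ∀ {α : Type} (p v : α → ℤ),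
    (∀ σ, σ ∉ E → σ.1 ≤ k → ¬ Occ σ p v) → Free p v k := by
  choose sV hV using h.exV
  obtain ⟨s1, h1⟩ := h.exS
  obtain ⟨s2, h2⟩ := h.exC1
  obtain ⟨s3, h3⟩ := h.exC2
  let m := (sV true true).1 + (sV true false).1 + (sV false true).1 + (sV false false).1
  have hm : ∀ d1 d2, (sV d1 d2).1 ≤ m := by
    intro d1 d2; rcases d1 <;> rcases d2 <;> simp only [m] <;> omega
  refine ⟨m + s1.1 + s2.1 + s3.1, fun p v hk => ⟨?_, ?_, ?_, ?_⟩⟩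
  · rintro d1 d2 l r ⟨a1, a2, a3, a4⟩
    have := hm d1 d2
    exact hk _ (hV d1 d2).2 (by omega) (embV l r a1 a2 a3 a4 (hV d1 d2).1 (by omega))
  · rintro c ⟨a1, a2⟩
    refine hk _ h1.2 (by omega) (embS (k := m + s1.1 + s2.1 + s3.1) c (fun i hi => ?_) (fun s t i j hij hj => ?_) h1.1 (by omega))
    · have := a1 i hi; dsimp only at this; omega
    · have := a2 s t i j hij hj; dsimp only at this; omega
  · rintro c w ⟨a1, a2⟩ hw
    exact hk _ h2.2 (by omega) (embC1 c w a1 a2 hw h2.1 (by omega))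
  · rintro c w ⟨a1, a2⟩ hw
    exact hk _ h3.2 (by omega) (embC2 c w a1 a2 hw h3.1 (by omega))

theorem Thin.free {E} (h : Thin E) : ∃ k : ℕ, ∀ β, Bas E β → k < β.1 →
    Free (pp β) (vv β) k ∧ Free (vv β) (pp β) k := by
  obtain ⟨k1, h1⟩ := h.free_aux
  obtain ⟨k2, h2⟩ := h.pinv.free_aux
  have mono : ∀ {α : Type} {p v : α → ℤ} {k k'}, Free p v k → k ≤ k' → Free p v k' := by
    intro α p v k k' hF hk
    refine ⟨?_, ?_, ?_, ?_⟩
    · rintro d1 d2 l r ⟨a1, a2, a3, a4⟩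
      exact hF.V d1 d2 l r ⟨fun a b x y => a1 a b x (by omega), fun a b x y => a2 a b (by omega) (by omega),
        fun a b x y => a3 a b x (by omega), fun a b x y => a4 a b x (by omega)⟩
    · rintro c ⟨a1, a2⟩
      exact hF.S c ⟨fun i hi => a1 i (by omega), fun s t i j x y => a2 s t i j x (by omega)⟩
    · rintro c w ⟨a1, a2⟩ hw
      exact hF.C1 c w ⟨fun i hi => a1 i (by omega), fun s t i j x y => a2 s t i j x (by omega)⟩
        fun s i hi => hw s i (by omega)
    · rintro c w ⟨a1, a2⟩ hw
      exact hF.C2 c w ⟨fun i hi => a1 i (by omega), fun s t i j x y => a2 s t i j x (by omega)⟩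
        fun s i hi => hw s i (by omega)
  refine ⟨k1 + k2, fun β hβ hk => ⟨mono (h1 _ _ fun σ hσ hs ho => hσ ?_) (by omega),
    mono (h2 _ _ fun σ hσ hs ho => hσ ?_) (by omega)⟩⟩
  · exact hβ.2 _ (occ_PLe ho) (by rintro rfl; omega)
  · exact hβ.2 _ (occ_PLe' ho) (by intro he; have := congrArg Sigma.fst he; simp only at this; omega)

theorem brk_sum {α : Type} {p v : α → ℤ} (hinj : ∀ x y, p x = p y → x = y) {k : ℕ} (a b w : ℕ → α)
    (hw : ∀ j, j < k + 1 → p (a j) < p (b j))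
    (hs : ∀ j l, j < l → l < k + 1 → p (b j) < p (a l))
    (hd : ∀ j l, j < l → l < k + 1 → v (a j) < v (a l) ∧ v (a j) < v (b l) ∧ v (b j) < v (a l) ∧ v (b j) < v (b l))
    (hc : (∀ j < k + 1, v (b j) < v (a j)) ∨
      ((∀ j < k + 1, v (a j) < v (w j) ∧ v (w j) < v (b j)) ∧
        ((∀ j < k + 1, p (b j) < p (w j)) ∧ ((∀ j l, j < l → l < k + 1 → p (w j) < p (a l)) ∨
          (∀ j l, j < l → l < k + 1 → p (a l) ≤ p (w j))) ∨
        (∀ j < k + 1, p (w j) < p (a j)) ∧ ((∀ j l, j < l → l < k + 1 → p (b j) < p (w l)) ∨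
          (∀ j l, j < l → l < k + 1 → p (w l) ≤ p (b j))))))
    (s : SignType) (hcol : ∀ j l, j < l → l < k + 1 → SignType.sign (p (w l) - p (w j)) = s) :
    (∃ c, Cfg21 p v k c) ∨ ∃ d1 d2 l r, CfgV p v d1 d2 k l r := by
  have hsig : (∀ j < k + 1, v (a j) < v (w j) ∧ v (w j) < v (b j)) →
      ∃ d : Bool, ∀ x y, x < y → y < k + 1 → if d then p (w x) < p (w y) else p (w y) < p (w x) := by
    intro h
    refine ⟨decide (s = 1), fun x y hxy hy => ?_⟩
    have h1 := hcol x y hxy hy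
    have h2 := h x (by omega); have h3 := h y hy
    have h4 := hd x y hxy hy
    rcases lt_trichotomy (p (w x)) (p (w y)) with h5 | h5 | h5
    · rw [sign_pos (by omega)] at h1; rw [← h1]; simpa using h5
    · rw [hinj _ _ h5] at h2; omega
    · rw [sign_neg (by omega)] at h1; rw [← h1]; simpa using h5
  rcases hc with hc | ⟨hc, ⟨h1, h2⟩ | ⟨h1, h2⟩⟩
  · refine .inl ⟨fun s j => if s then b j else a j, fun i hi => ?_, fun s t i j hij hj => ?_⟩
    · exact ⟨hw i (by omega), hc i (by omega)⟩
    · have e1 := hw i (by omega); have e2 := hw j (by omega); have e3 := hs i j hij (by omega)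
      have e4 := hd i j hij (by omega)
      rcases s <;> rcases t <;> simp <;> omega
  · rcases h2 with h2 | h2
    · refine .inl ⟨fun s j => if s then w j else b j, fun i hi => ?_, fun s t i j hij hj => ?_⟩
      · exact ⟨h1 i (by omega), (hc i (by omega)).2⟩
      · have e1 := hw i (by omega); have e2 := hw j (by omega); have e3 := hs i j hij (by omega)
        have e4 := hd i j hij (by omega)
        have e5 := h1 i (by omega); have e6 := h1 j (by omega); have e7 := h2 i j hij (by omega)
        have e8 := hc i (by omega); have e9 := hc j (by omega)
        rcases s <;> rcases t <;> simp <;> omega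
    · obtain ⟨d, hdd⟩ := hsig hc
      refine .inr ⟨true, d, b, w, fun i j hij hj => ?_, fun i j hi hj => ?_, fun i j hij hj => ?_, fun i j hij hj => hdd i j hij (by omega)⟩
      · have e4 := hd i j hij (by omega)
        have e8 := hc i (by omega); have e9 := hc j (by omega)
        omega
      · rcases Nat.lt_or_ge j i with h | h
        · have := h2 j (i+1) (by omega) (by omega); have := hs i (i+1) (by omega) (by omega); omega
        · have e1 := h1 j (by omega)
          rcases Nat.eq_or_lt_of_le h with h | h
          · subst h; exact e1
          · have := hs i j h (by omega); have := hw j (by omega); omega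
      · have := hs i j hij (by omega); have := hw j (by omega); simp; omega
  · rcases h2 with h2 | h2
    · refine .inl ⟨fun s j => if s then a j else w j, fun i hi => ?_, fun s t i j hij hj => ?_⟩
      · exact ⟨h1 i (by omega), (hc i (by omega)).1⟩
      · have e1 := hw i (by omega); have e2 := hw j (by omega); have e3 := hs i j hij (by omega)
        have e4 := hd i j hij (by omega)
        have e5 := h1 i (by omega); have e6 := h1 j (by omega); have e7 := h2 i j hij (by omega)
        have e8 := hc i (by omega); have e9 := hc j (by omega)
        rcases s <;> rcases t <;> simp <;> omega
    · obtain ⟨d, hdd⟩ := hsig hc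
      refine .inr ⟨d, true, fun i => w (i+1), fun i => a (i+1), fun i j hij hj => ?_, fun i j hi hj => ?_, fun i j hij hj => hdd (i+1) (j+1) (by omega) (by omega), fun i j hij hj => ?_⟩
      · have e4 := hd (i+1) (j+1) (by omega) (by omega)
        have e8 := hc (i+1) (by omega); have e9 := hc (j+1) (by omega)
        dsimp only
        omega
      · dsimp only
        rcases Nat.lt_or_ge j (i+1) with h | h
        · have := h2 j (i+1) (by omega) (by omega); have := hs j (j+1) (by omega) (by omega); omega
        · have e1 := h1 (i+1) (by omega)
          have := hs (i+1) (j+1) (by omega) (by omega); have := hw (i+1) (by omega); omega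
      · have := hs (i+1) (j+1) (by omega) (by omega); have := hw (i+1) (by omega); simp; omega

theorem CfgV.le {α : Type} {p v : α → ℤ} {d1 d2 k k' l r} (h : CfgV p v d1 d2 k' l r) (hk : k ≤ k') :
    CfgV p v d1 d2 k l r := by
  obtain ⟨a1, a2, a3, a4⟩ := h
  exact ⟨fun a b x y => a1 a b x (by omega), fun a b x y => a2 a b (by omega) (by omega),
        fun a b x y => a3 a b x (by omega), fun a b x y => a4 a b x (by omega)⟩

theorem Cfg21.le {α : Type} {p v : α → ℤ} {k k' c} (h : Cfg21 p v k' c) (hk : k ≤ k') :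
    Cfg21 p v k c := by
  obtain ⟨a1, a2⟩ := h
  exact ⟨fun i hi => a1 i (by omega), fun s t i j x y => a2 s t i j x (by omega)⟩

theorem CfgV.neg {α : Type} {p v : α → ℤ} {d1 d2 k l r} (h : CfgV p (fun x => - v x) d1 d2 k l r) :
    CfgV p v (!d1) (!d2) k (fun i => l (k - 1 - i)) (fun i => r (k - 1 - i)) := by
  obtain ⟨a1, a2, a3, a4⟩ := h
  refine ⟨fun a b x y => ?_, fun a b x y => a2 _ _ (by omega) (by omega), fun a b x y => ?_, fun a b x y => ?_⟩
  · have := a1 (k - 1 - b) (k - 1 - a) (by omega) (by omega)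
    dsimp only at this ⊢; omega
  · have := a3 (k - 1 - b) (k - 1 - a) (by omega) (by omega)
    rcases d1 <;> simpa using this
  · have := a4 (k - 1 - b) (k - 1 - a) (by omega) (by omega)
    rcases d2 <;> simpa using this

theorem sgn_dec {f : ℕ → ℤ} {k : ℕ} {s : SignType} (h : ∀ x y, x < y → y < k → SignType.sign (f y - f x) = s)
    (hne : ∀ x y, x < y → y < k → f x ≠ f y) : ∃ d : Bool, ∀ x y, x < y → y < k → if d then f x < f y else f y < f x := by
  refine ⟨decide (s = 1), fun x y hxy hy => ?_⟩
  have h1 := h x y hxy hy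
  rcases lt_trichotomy (f x) (f y) with h5 | h5 | h5
  · rw [sign_pos (by omega)] at h1; rw [← h1]; simpa using h5
  · exact absurd h5 (hne x y hxy hy)
  · rw [sign_neg (by omega)] at h1; rw [← h1]; simpa using h5

theorem brk_main (k0 K : ℕ) : ∃ M : ℕ, ∀ {α : Type} (p v : α → ℤ) (_ : ∀ x y, p x = p y → x = y)
    (_ : ∀ x y, v x = v y → x = y) (_ : Free p v k0) (_ : Free v p k0) (a b w : ℕ → α)
    (_ : ∀ j, j < M → p (a j) < p (b j)) (_ : ∀ j l, j < l → l < M → p (b j) < p (a l))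
    (_ : ∀ j, j < M → (v (a j) < v (w j) ∧ v (w j) < v (b j)) ∨ (v (b j) < v (w j) ∧ v (w j) < v (a j)))
    (_ : ∀ j, j < M → p (w j) < p (a j) ∨ p (b j) < p (w j)), ∃ c, Cfg21 p v K c := by
  obtain ⟨M, hM⟩ := ramsey (((Bool × Bool) × (Bool × Bool) × (Bool × Bool)) × (SignType × SignType × SignType)) (K + k0 + 3)
  refine ⟨M, fun p v hp hv F1 F2 a b w hab hs hwv hwp => ?_⟩
  obtain ⟨f, ⟨⟨⟨cD, cS⟩, ⟨cA, cB⟩, ⟨cw1, cw2⟩⟩, ⟨s1, s2, s3⟩⟩, hf, hfM, hcol⟩ := hM fun j l =>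
    (((decide (v (a j) < v (b j)), decide (p (b j) < p (w j))),
      (decide (max (v (a j)) (v (b j)) < min (v (a l)) (v (b l))), decide (max (v (a l)) (v (b l)) < min (v (a j)) (v (b j)))),
      (decide (p (w j) < p (a l)), decide (p (b j) < p (w l)))),
      (SignType.sign (p (w l) - p (w j)), SignType.sign (v (a l) - v (a j)), SignType.sign (v (b l) - v (b j))))
  simp only [Prod.mk.injEq] at hcol
  set k := K + k0 + 1 with hk
  have cD' : ∀ j < k + 1, decide (v (a (f j)) < v (b (f j))) = cD := fun j hj => (hcol j (k+1) (by omega) (by omega)).1.1.1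
  have cS' : ∀ j < k + 1, decide (p (b (f j)) < p (w (f j))) = cS := fun j hj => (hcol j (k+1) (by omega) (by omega)).1.1.2
  have hab' : ∀ j < k + 1, p (a (f j)) < p (b (f j)) := fun j hj => hab _ (hfM _ (by omega))
  have hs' : ∀ j l, j < l → l < k + 1 → p (b (f j)) < p (a (f l)) := fun j l h h' =>
    hs _ _ (hf _ _ h (by omega)) (hfM _ (by omega))
  have hwv' := fun j (hj : j < k + 1) => hwv (f j) (hfM _ (by omega))
  have hwp' := fun j (hj : j < k + 1) => hwp (f j) (hfM _ (by omega))
  have side : ∀ {u : ℤ}, True → ((∀ j < k + 1, p (b (f j)) < p (w (f j))) ∧ ((∀ j l, j < l → l < k + 1 → p (w (f j)) < p (a (f l))) ∨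
          (∀ j l, j < l → l < k + 1 → p (a (f l)) ≤ p (w (f j)))) ∨
        (∀ j < k + 1, p (w (f j)) < p (a (f j))) ∧ ((∀ j l, j < l → l < k + 1 → p (b (f j)) < p (w (f l))) ∨
          (∀ j l, j < l → l < k + 1 → p (w (f l)) ≤ p (b (f j))))) := by
    intro _ _
    rcases cS
    · right
      refine ⟨fun j hj => (hwp' j hj).resolve_right (by simpa using cS' j hj), ?_⟩
      rcases cw2
      · right; intro j l h h'
        simpa using (hcol j l h (by omega)).1.2.2.2
      · left; intro j l h h'
        simpa using (hcol j l h (by omega)).1.2.2.2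
    · left
      refine ⟨fun j hj => by simpa using cS' j hj, ?_⟩
      rcases cw1
      · right; intro j l h h'
        simpa using (hcol j l h (by omega)).1.2.2.1
      · left; intro j l h h'
        simpa using (hcol j l h (by omega)).1.2.2.1
  have side := side (u := 0) trivial
  rcases cA with _ | _
  · rcases cB with _ | _
    · -- overlap
      exfalso
      have o : ∀ j l, j < l → l < k + 1 → min (v (a (f l))) (v (b (f l))) ≤ max (v (a (f j))) (v (b (f j))) ∧
          min (v (a (f j))) (v (b (f j))) ≤ max (v (a (f l))) (v (b (f l))) := fun j l h h' => by
        have := (hcol j l h (by omega)).1.2.1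
        simpa only [decide_eq_false_iff_not, not_lt] using this
      have ne : ∀ j l, j < l → l < k + 1 → p (a (f j)) ≠ p (a (f l)) ∧ p (a (f j)) ≠ p (b (f l)) ∧ p (b (f j)) ≠ p (a (f l)) ∧ p (b (f j)) ≠ p (b (f l)) := by
        intro j l h h'; have := hs' j l h h'; have := hab' j (by omega); have := hab' l h'; omega
      have vne : ∀ x y, p x ≠ p y → v x ≠ v y := fun x y h h' => h (by rw [hv _ _ h'])
      obtain ⟨da, hda⟩ := sgn_dec (f := fun i => v (a (f i))) (k := k + 1) (fun x y h h' => (hcol x y h (by omega)).2.2.1) (fun x y h h' => vne _ _ (ne x y h h').1)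
      obtain ⟨db, hdb⟩ := sgn_dec (f := fun i => v (b (f i))) (k := k + 1) (fun x y h h' => (hcol x y h (by omega)).2.2.2) (fun x y h h' => vne _ _ (ne x y h h').2.2.2)
      rcases cD
      · refine F2.V db da (fun i => b (f i)) (fun i => a (f i)) (CfgV.le (k' := k) ⟨fun i j h h' => ?_, fun i j h h' => ?_, fun i j h h' => hdb i j h (by omega), fun i j h h' => hda i j h (by omega)⟩ (by omega))
        · have := hs' i j h (by omega); have := hab' i (by omega); have := hab' j (by omega)
          dsimp only; omega
        · have e1 := cD' i (by omega); have e2 := cD' j (by omega)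
          have e3 := hwv' i (by omega); have e4 := hwv' j (by omega)
          simp only [decide_eq_false_iff_not, not_lt] at e1 e2
          dsimp only
          rcases lt_trichotomy i j with h3 | h3 | h3
          · have := o i j h3 (by omega); have := vne _ _ (ne i j h3 (by omega)).2.2.1; omega
          · subst h3; omega
          · have := o j i h3 (by omega); have := vne _ _ (ne j i h3 (by omega)).2.1; omega
      · refine F2.V da db (fun i => a (f i)) (fun i => b (f i)) (CfgV.le (k' := k) ⟨fun i j h h' => ?_, fun i j h h' => ?_, fun i j h h' => hda i j h (by omega), fun i j h h' => hdb i j h (by omega)⟩ (by omega))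
        · have := hs' i j h (by omega); have := hab' i (by omega); have := hab' j (by omega)
          dsimp only; omega
        · have e1 := cD' i (by omega); have e2 := cD' j (by omega)
          simp only [decide_eq_true_eq] at e1 e2
          dsimp only
          rcases lt_trichotomy i j with h3 | h3 | h3
          · have := o i j h3 (by omega); have := vne _ _ (ne i j h3 (by omega)).2.1; omega
          · subst h3; omega
          · have := o j i h3 (by omega); have := vne _ _ (ne j i h3 (by omega)).2.2.1; omega
    · exfalso
      have := brk_sum (v := fun x => - v x) hp (k := k) (fun i => a (f i)) (fun i => b (f i)) (fun i => w (f i)) hab' hs'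
        (fun j l h h' => by
          have := (hcol j l h (by omega)).1.2.1.2
          simp only [decide_eq_true_eq] at this
          omega)
        (by
          rcases cD
          · right
            refine ⟨fun j hj => ?_, side⟩
            have e1 := cD' j hj
            have := hwv' j hj
            simp only [decide_eq_false_iff_not, not_lt] at e1
            omega
          · left; intro j hj
            have e1 := cD' j hj
            simp only [decide_eq_true_eq] at e1
            omega)
        s1 (fun j l h h' => (hcol j l h (by omega)).2.1)
      rcases this with ⟨c, hc⟩ | ⟨d1, d2, l, r, hc⟩
      · exact F1.S c (hc.le (by omega))
      · exact F1.V _ _ _ _ (hc.neg.le (by omega))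
  · have := brk_sum (v := v) hp (k := k) (fun i => a (f i)) (fun i => b (f i)) (fun i => w (f i)) hab' hs'
        (fun j l h h' => by
          have := (hcol j l h (by omega)).1.2.1.1
          simp only [decide_eq_true_eq] at this
          omega)
        (by
          rcases cD
          · left; intro j hj
            have e1 := cD' j hj
            have := hwv' j hj
            simp only [decide_eq_false_iff_not, not_lt] at e1
            omega
          · right
            refine ⟨fun j hj => ?_, side⟩
            have e1 := cD' j hj
            have := hwv' j hj
            simp only [decide_eq_true_eq] at e1
            omega)
        s1 (fun j l h h' => (hcol j l h (by omega)).2.1)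
    rcases this with ⟨c, hc⟩ | ⟨d1, d2, l, r, hc⟩
    · exact ⟨c, hc.le (by omega)⟩
    · exact (F1.V _ _ _ _ (hc.le (by omega))).elim

def vl (β : Permu) (i : ℕ) : ℤ := if h : i < β.1 then ((β.2 ⟨i, h⟩).1 : ℤ) else 0

theorem vl_fin (β : Permu) (x : Fin β.1) : vl β x.1 = vv β x := by
  unfold vl vv; rw [dif_pos x.2]

theorem vl_inj {β : Permu} {i j : ℕ} (hi : i < β.1) (hj : j < β.1) (h : vl β i = vl β j) : i = j := by
  have := vv_inj β (x := ⟨i, hi⟩) (y := ⟨j, hj⟩) (by rw [← vl_fin, ← vl_fin]; exact h)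
  exact congrArg Fin.val this

def brks (β : Permu) : Finset ℕ := (Finset.range β.1).filter fun i => i + 1 < β.1 ∧
  ¬ (vl β (i+1) = vl β i + 1 ∨ vl β (i+1) = vl β i - 1)

def rho (β : Permu) (i : ℕ) : ℕ := ((brks β).filter (· < i)).card
def rrun (β : Permu) (r : ℕ) : Finset ℕ := (Finset.range β.1).filter fun i => rho β i = r

theorem rho_mono {β : Permu} {i j : ℕ} (h : i ≤ j) : rho β i ≤ rho β j :=
  Finset.card_le_card (fun x hx => by simp only [Finset.mem_filter] at hx ⊢; exact ⟨hx.1, by omega⟩)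

theorem rho_step {β : Permu} {i : ℕ} (h : i + 1 < β.1) (he : rho β (i+1) = rho β i) :
    vl β (i+1) = vl β i + 1 ∨ vl β (i+1) = vl β i - 1 := by
  by_contra hc
  have : i ∈ brks β := by simp only [brks, Finset.mem_filter, Finset.mem_range]; exact ⟨by omega, h, hc⟩
  have h2 : rho β i < rho β (i+1) := by
    refine Finset.card_lt_card ⟨fun x hx => ?_, fun hh => ?_⟩
    · simp only [Finset.mem_filter] at hx ⊢; exact ⟨hx.1, by omega⟩
    · have := hh (Finset.mem_filter.2 ⟨this, Nat.lt_succ_self i⟩)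
      simp at this
  omega

theorem run_lin {β : Permu} {i : ℕ} (d : ℕ) (h : i + d < β.1) (he : rho β (i + d) = rho β i) :
    (∀ e ≤ d, vl β (i + e) = vl β i + e) ∨ (∀ e ≤ d, vl β (i + e) = vl β i - e) := by
  induction d with
  | zero => left; intro e he; obtain rfl : e = 0 := by omega
            simp
  | succ d ih =>
    have h1 := rho_mono (β := β) (show i ≤ i + d by omega)
    have h2 := rho_mono (β := β) (show i + d ≤ i + (d + 1) by omega)
    have h3 := rho_step (β := β) (i := i + d) (by omega) (by rw [show i + d + 1 = i + (d + 1) by omega]; omega)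
    have key : ∀ s : ℤ, (s = 1 ∨ s = -1) → (∀ e ≤ d, vl β (i + e) = vl β i + s * e) → 
        (d = 0 ∨ ∀ e ≤ d + 1, vl β (i + e) = vl β i + s * e) := by
      intro s hs hh
      rcases Nat.eq_zero_or_pos d with h0 | h0
      · exact .inl h0
      right
      intro e he'
      rcases Nat.lt_or_ge e (d+1) with h4 | h4
      · exact hh e (by omega)
      obtain rfl : e = d + 1 := by omega
      have h5 := hh d le_rfl
      have h6 := hh (d-1) (by omega)
      by_contra hcon
      have : vl β (i + (d+1)) = vl β (i + (d-1)) := by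
        rw [h6]; rw [← add_assoc] at hcon ⊢
        have : ((d - 1 : ℕ) : ℤ) = d - 1 := by omega
        rw [this]; push_cast at hcon
        rcases hs with rfl | rfl <;> omega
      have := vl_inj (by omega) (by omega) this
      omega
    have fin0 : d = 0 → (∀ e ≤ d + 1, vl β (i + e) = vl β i + e) ∨ (∀ e ≤ d + 1, vl β (i + e) = vl β i - e) := by
      rintro rfl
      rcases h3 with h3 | h3
      · left; intro e he
        rcases (show e = 0 ∨ e = 1 by omega) with rfl | rfl <;> simp_all
      · right; intro e he
        rcases (show e = 0 ∨ e = 1 by omega) with rfl | rfl <;> simp_all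
    rcases ih (by omega) (by omega) with ih | ih
    · rcases key 1 (by simp) (fun e he => by rw [ih e he]; ring) with h | h
      · exact fin0 h
      · left; intro e he; rw [h e he]; ring
    · rcases key (-1) (by simp) (fun e he => by rw [ih e he]; ring) with h | h
      · exact fin0 h
      · right; intro e he; rw [h e he]; ring

theorem run_dir {β : Permu} {x y x' y' : ℕ} (h : x < y) (h' : x' < y') (hy : y < β.1) (hy' : y' < β.1)
    (e1 : rho β y = rho β x) (e2 : rho β x' = rho β x) (e3 : rho β y' = rho β x) (hv : vl β x < vl β y) :
    vl β x' < vl β y' := by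
  have hm : rho β (min x x') = rho β x ∧ rho β (max y y') = rho β x := by
    rcases min_choice x x' with h | h <;> rcases max_choice y y' with h' | h' <;> rw [h, h'] <;> omega
  have := run_lin (β := β) (i := min x x') (max y y' - min x x') (by omega)
    (by rw [show min x x' + (max y y' - min x x') = max y y' by omega, hm.1, hm.2])
  rcases this with hh | hh
  · have h1 := hh (x' - min x x') (by omega)
    have h2 := hh (y' - min x x') (by omega)
    rw [show min x x' + (x' - min x x') = x' by omega] at h1
    rw [show min x x' + (y' - min x x') = y' by omega] at h2
    omega
  · have h1 := hh (x - min x x') (by omega)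
    have h2 := hh (y - min x x') (by omega)
    rw [show min x x' + (x - min x x') = x by omega] at h1
    rw [show min x x' + (y - min x x') = y by omega] at h2
    omega

theorem run_sep {β : Permu} {x x' y : ℕ} (hx : x < β.1) (hx' : x' < β.1) (hy : y < β.1) 
    (e : rho β x = rho β x') (ne : rho β y ≠ rho β x) (h : vl β x < vl β y) : vl β x' < vl β y := by
  by_contra hc
  have h0 : vl β x' ≠ vl β y := fun h => ne (by rw [← vl_inj hx' hy h, e])
  have key : ∀ a d, a + d < β.1 → rho β (a + d) = rho β a → rho β y ≠ rho β a →
      ¬ (vl β a < vl β y ∧ vl β y < vl β (a + d)) ∧ ¬ (vl β (a + d) < vl β y ∧ vl β y < vl β a) := by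
    intro a d had he hne
    have hin : ∀ e ≤ d, vl β y ≠ vl β (a + e) := by
      intro e he' hh
      have := vl_inj hy (by omega) hh
      have h1 := rho_mono (β := β) (show a ≤ a + e by omega)
      have h2 := rho_mono (β := β) (show a + e ≤ a + d by omega)
      rw [this] at hne; omega
    rcases run_lin d had he with hh | hh
    · have := hh d le_rfl
      refine ⟨fun h => ?_, fun h => by omega⟩
      refine hin (vl β y - vl β a).toNat (by omega) ?_
      rw [hh _ (by omega)]; omega
    · have := hh d le_rfl
      refine ⟨fun h => by omega, fun h => ?_⟩
      refine hin (vl β a - vl β y).toNat (by omega) ?_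
      rw [hh _ (by omega)]; omega
  rcases Nat.le_total x x' with hl | hl
  · have := key x (x' - x) (by omega) (by rw [show x + (x' - x) = x' by omega, e]) ne
    rw [show x + (x' - x) = x' by omega] at this
    omega
  · have := key x' (x - x') (by omega) (by rw [show x' + (x - x') = x by omega, e]) (by rwa [← e])
    rw [show x' + (x - x') = x by omega] at this
    omega

theorem rho_le (β : Permu) (i) : rho β i ≤ (brks β).card := Finset.card_le_card (Finset.filter_subset _ _)

open Classical in
noncomputable def rcol (b : ℕ) (β : Permu) : (Fin (b+1) → Bool) × (Fin (b+1) → Fin (b+1) → Bool) :=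
  (fun r => decide (∀ x y, x < y → y < β.1 → rho β x = r → rho β y = r → vl β x < vl β y),
   fun r s => decide (∀ x y, x < β.1 → y < β.1 → rho β x = r → rho β y = s → vl β x < vl β y))

theorem runs_PLe {b : ℕ} {β β' : Permu} (hb : (brks β).card ≤ b)
    (hc : rcol b β = rcol b β') (hl : ∀ r : Fin (b+1), (rrun β r).card ≤ (rrun β' r).card) : PLe β β' := by
  classical
  have hr : ∀ i, rho β i < b + 1 := fun i => by have := rho_le β i; omega
  have ho : ∀ x : Fin β.1, ((rrun β (rho β x)).filter (· < x.1)).card < (rrun β' (rho β x)).card := by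
    intro x
    refine lt_of_lt_of_le ?_ (hl ⟨_, hr x⟩)
    refine Finset.card_lt_card ⟨Finset.filter_subset _ _, fun h => ?_⟩
    have := h (show x.1 ∈ rrun β (rho β x) by simp [rrun])
    simp at this
  let g : Fin β.1 → ℕ := fun x => (rrun β' (rho β x)).orderEmbOfFin rfl ⟨_, ho x⟩
  have hg : ∀ x, g x < β'.1 ∧ rho β' (g x) = rho β x := by
    intro x
    have := Finset.orderEmbOfFin_mem (rrun β' (rho β x)) rfl ⟨_, ho x⟩
    have := Finset.mem_filter.1 this
    exact ⟨Finset.mem_range.1 this.1, this.2⟩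
  have hgs : ∀ x y, rho β x.1 = rho β y.1 → x < y → g x < g y := by
    intro x y h hxy
    have key : ∀ (r s : ℕ) (hrs : r = s) (i j : ℕ) (hi : i < (rrun β' r).card) (hj : j < (rrun β' s).card), i < j →
        (rrun β' r).orderEmbOfFin rfl ⟨i, hi⟩ < (rrun β' s).orderEmbOfFin rfl ⟨j, hj⟩ := by
      rintro r s rfl i j hi hj hij
      exact ((rrun β' r).orderEmbOfFin rfl).strictMono hij
    refine key _ _ h _ _ _ _ ?_
    rw [h]
    refine Finset.card_lt_card ⟨fun z hz => ?_, fun hh => ?_⟩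
    · simp only [Finset.mem_filter] at hz ⊢; exact ⟨hz.1, hz.2.trans hxy⟩
    · have := hh (Finset.mem_filter.2 ⟨show x.1 ∈ rrun β (rho β y) by simp [rrun, h], hxy⟩)
      simp at this
  have hv' : ∀ x : Fin β.1, ((β'.2 ⟨g x, (hg x).1⟩).1 : ℤ) = vl β' (g x) := by
    intro x; unfold vl; rw [dif_pos]
  have hv : ∀ x : Fin β.1, ((β.2 x).1 : ℤ) = vl β x := fun x => (vl_fin β x).symm
  simp only [rcol, Prod.mk.injEq, funext_iff, decide_eq_decide] at hc
  obtain ⟨hc1, hc2⟩ := hc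
  refine PLe.of (fun x => ⟨g x, (hg x).1⟩) (fun x y hxy => ?_) (fun x y hxy => ?_)
  · rw [Fin.lt_def]
    dsimp only
    rcases Nat.eq_or_lt_of_le (rho_mono (β := β) (le_of_lt (show x.1 < y.1 from hxy))) with h | h
    · exact hgs x y h hxy
    · by_contra hcon
      have := rho_mono (β := β') (not_lt.1 hcon)
      rw [(hg x).2, (hg y).2] at this
      omega
  · have hxy' : vl β x < vl β y := by rw [← hv, ← hv]; rw [Fin.lt_def] at hxy; omega
    have : vl β' (g x) < vl β' (g y) := by
      by_cases h : rho β x = rho β y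
      · rcases lt_trichotomy x y with h2 | h2 | h2
        · have := (hc1 ⟨rho β x, hr x⟩).1 fun a c hac hc ha hcc =>
            run_dir (x := x) (y := y) h2 hac y.2 hc h.symm ha hcc hxy'
          exact this _ _ (hgs x y h h2) (hg y).1 (hg x).2 ((hg y).2.trans h.symm)
        · subst h2; omega
        · by_contra hcon
          have h3 := hgs y x h.symm h2
          have hne : vl β' (g x) ≠ vl β' (g y) := fun h => h3.ne (vl_inj (hg y).1 (hg x).1 h.symm)
          have := (hc1 ⟨rho β x, hr x⟩).2 fun a c hac hc ha hcc =>
            run_dir (x := g y) (y := g x) h3 hac (hg x).1 hc (by rw [(hg x).2, (hg y).2, h])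
              (by rw [ha, (hg y).2, ← h]) (by rw [hcc, (hg y).2, ← h]) (by omega)
          have := this _ _ h2 x.2 h.symm rfl
          omega
      · have := (hc2 ⟨rho β x, hr x⟩ ⟨rho β y, hr y⟩).1 fun a c ha hc ha' hc' => by
          dsimp only at ha' hc'
          have h1 := run_sep x.2 ha y.2 ha'.symm (Ne.symm h) hxy'
          by_contra hcon
          have hne : vl β c ≠ vl β a := fun hh => h (by rw [← ha', ← hc', vl_inj hc ha hh])
          have := run_sep (x := c) (x' := y) (y := a) hc y.2 ha hc' (by omega) (by omega)
          omega
        exact this _ _ (hg x).1 (hg y).1 (hg x).2 (hg y).2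
    rw [← hv', ← hv'] at this
    rw [Fin.lt_def]; omega

theorem few_breaks (b : ℕ) (A : Set Permu) (hA : ∀ x ∈ A, ∀ y ∈ A, PLe x y → x = y)
    (hb : ∀ x ∈ A, (brks x).card ≤ b) : A.Finite := by
  by_contra hinf
  have : Infinite A := Set.infinite_coe_iff.2 hinf
  obtain ⟨c, hc⟩ := Finite.exists_infinite_fiber (fun x : A => rcol b x.1)
  let e := Infinite.natEmbedding ((fun x : A => rcol b x.1) ⁻¹' {c})
  obtain ⟨m, n, hmn, hle⟩ := wellQuasiOrdered_le (α := Fin (b+1) → ℕ)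
    (fun i r => (rrun (e i).1.1 r).card)
  have h1 : rcol b (e m).1.1 = c := (e m).2
  have h2 : rcol b (e n).1.1 = c := (e n).2
  have := hA _ (e m).1.2 _ (e n).1.2 (runs_PLe (hb _ (e m).1.2) (h1.trans h2.symm) hle)
  exact hmn.ne (e.injective (Subtype.ext (Subtype.ext this)))

theorem every_other (S : Finset ℕ) (M : ℕ) (h : 2 * M ≤ S.card) : ∃ t : ℕ → ℕ, (∀ j < M, t j ∈ S) ∧
    ∀ j l, j < l → l < M → t j + 1 < t l := by
  let e := S.orderEmbOfFin rfl
  refine ⟨fun j => if h : 2 * j < S.card then e ⟨2 * j, h⟩ else 0, fun j hj => ?_, fun j l hjl hl => ?_⟩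
  · dsimp only; rw [dif_pos (by omega)]; exact S.orderEmbOfFin_mem rfl _
  · dsimp only
    rw [dif_pos (by omega), dif_pos (by omega)]
    have h1 : e ⟨2 * j, by omega⟩ < e ⟨2 * j + 1, by omega⟩ := e.strictMono (by rw [Fin.lt_def]; dsimp only; omega)
    have h2 : e ⟨2 * j + 1, by omega⟩ < e ⟨2 * l, by omega⟩ := e.strictMono (by rw [Fin.lt_def]; dsimp only; omega)
    omega

theorem many_breaks (k0 K : ℕ) : ∃ b : ℕ, ∀ β, Free (pp β) (vv β) k0 → Free (vv β) (pp β) k0 →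
    b < (brks β).card → ∃ c, Cfg21 (pp β) (vv β) K c := by
  obtain ⟨M, hM⟩ := brk_main k0 K
  refine ⟨2 * M, fun β F1 F2 hb => ?_⟩
  obtain ⟨t, ht, ht2⟩ := every_other (brks β) M hb.le
  have hn : 0 < β.1 := by
    obtain ⟨x, hx⟩ := Finset.card_pos.1 (show 0 < (brks β).card by omega)
    simp only [brks, Finset.mem_filter, Finset.mem_range] at hx; omega
  have : ∀ j, ∃ a b w : Fin β.1, j < M → a.1 = t j ∧ b.1 = t j + 1 ∧
      ((vv β a < vv β w ∧ vv β w < vv β b) ∨ (vv β b < vv β w ∧ vv β w < vv β a)) := by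
    intro j
    by_cases hj : j < M
    swap
    · exact ⟨⟨0, hn⟩, ⟨0, hn⟩, ⟨0, hn⟩, fun h => absurd h hj⟩
    have := ht j hj
    simp only [brks, Finset.mem_filter, Finset.mem_range] at this
    obtain ⟨h1, h2, h3⟩ := this
    have e1 := vl_fin β ⟨t j, h1⟩
    have e2 := vl_fin β ⟨t j + 1, h2⟩
    dsimp only at e1 e2
    rw [e1, e2] at h3
    have hne : vv β ⟨t j, h1⟩ ≠ vv β ⟨t j + 1, h2⟩ := fun h => by
      have := congrArg Fin.val (vv_inj β h); dsimp only at this; omega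
    have hsur : ∀ z : ℕ, z < β.1 → ∃ w, vv β w = z := fun z hz =>
      ⟨β.2.symm ⟨z, hz⟩, by simp [vv]⟩
    have b1 := (β.2 ⟨t j, h1⟩).2
    have b2 := (β.2 ⟨t j + 1, h2⟩).2
    obtain ⟨w, hw⟩ := hsur ((min (vv β ⟨t j, h1⟩) (vv β ⟨t j + 1, h2⟩)).toNat + 1) (by unfold vv at *; omega)
    refine ⟨⟨t j, h1⟩, ⟨t j + 1, h2⟩, w, fun _ => ⟨rfl, rfl, ?_⟩⟩
    unfold vv at *; omega
  choose a b w h using this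
  refine hM (pp β) (vv β) (fun _ _ => pp_inj β) (fun _ _ => vv_inj β) F1 F2 a b w ?_ ?_ ?_ ?_
  · intro j hj; have := h j hj; unfold pp; omega
  · intro j l hjl hl; have := h j (by omega); have := h l hl; have := ht2 j l hjl hl; unfold pp; omega
  · intro j hj; exact (h j hj).2.2
  · intro j hj
    have h1 := h j hj
    have h2 : w j ≠ a j := by intro h2; rw [h2] at h1; omega
    have h3 : w j ≠ b j := by intro h2; rw [h2] at h1; omega
    have h2' : (w j).1 ≠ (a j).1 := fun h => h2 (Fin.ext h)
    have h3' : (w j).1 ≠ (b j).1 := fun h => h3 (Fin.ext h)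
    unfold pp; omega

def Adj {α : Type} (p v : α → ℤ) (x y : α) : Prop := (p x < p y ∧ v y < v x) ∨ (p y < p x ∧ v x < v y)
def ng {α : Type} (p : α → ℤ) (x : α) : ℤ := - p x

theorem Adj.swap {α : Type} (p v : α → ℤ) : Adj v p = Adj p v := by
  funext x y; simp only [Adj]; apply propext; omega
theorem Adj.ng {α : Type} (p v : α → ℤ) : Adj (ng p) (ng v) = Adj p v := by
  funext x y; simp only [Adj, _root_.ng]; apply propext; omega
theorem Adj.symm {α : Type} {p v : α → ℤ} {x y} (h : Adj p v x y) : Adj p v y x := by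
  simp only [Adj] at *; omega

def Cnn {α : Type} (R : α → α → Prop) (A : Finset α) : Prop :=
  A.Nonempty ∧ ∀ S ⊆ A, S.Nonempty → S ≠ A → ∃ x ∈ S, ∃ y ∈ A, y ∉ S ∧ R x y

theorem Cnn.ins {α : Type} [DecidableEq α] {R : α → α → Prop} (hR : ∀ x y, R x y → R y x) {A : Finset α} (h : Cnn R A)
    {a x : α} (ha : a ∈ A) (hax : R a x) : Cnn R (insert x A) := by
  refine ⟨Finset.insert_nonempty _ _, fun S hS hne hS' => ?_⟩
  rcases (S ∩ A).eq_empty_or_nonempty with h0 | h0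
  · obtain ⟨y, hy⟩ := hne
    have hn : ∀ y ∈ A, y ∉ S := fun y h1 h2 => by
      have : y ∈ S ∩ A := Finset.mem_inter.2 ⟨h2, h1⟩
      rw [h0] at this; simp at this
    have : y = x := by
      rcases Finset.mem_insert.1 (hS hy) with h | h
      · exact h
      · exact absurd hy (hn y h)
    subst this
    exact ⟨y, hy, a, Finset.mem_insert_of_mem ha, hn a ha, hR _ _ hax⟩
  · by_cases h1 : S ∩ A = A
    · have h2 : x ∉ S := fun hx => hS' (Finset.Subset.antisymm hS (Finset.insert_subset hx (Finset.inter_eq_right.1 h1)))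
      exact ⟨a, Finset.inter_eq_right.1 h1 ha, x, Finset.mem_insert_self _ _, h2, hax⟩
    · obtain ⟨y, hy, z, hz, hzS, hyz⟩ := h.2 (S ∩ A) Finset.inter_subset_right h0 h1
      exact ⟨y, (Finset.mem_inter.1 hy).1, z, Finset.mem_insert_of_mem hz,
        fun hh => hzS (Finset.mem_inter.2 ⟨hh, hz⟩), hyz⟩

theorem con_single {α : Type} {R : α → α → Prop} (x : α) : Cnn R {x} := by
  refine ⟨Finset.singleton_nonempty x, fun S hS hne hS' => ?_⟩
  rcases Finset.subset_singleton_iff.1 hS with h | h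
  · exact absurd hne (by simp [h])
  · exact absurd h hS'

theorem Cnn.grow {α : Type} [Fintype α] [DecidableEq α] {R : α → α → Prop} (hR : ∀ x y, R x y → R y x)
    (hu : Cnn R (Finset.univ : Finset α)) {A : Finset α} (h : Cnn R A) (m : ℕ) (hm : A.card ≤ m) (hm' : m ≤ Fintype.card α) :
    ∃ B, A ⊆ B ∧ B.card = m ∧ Cnn R B := by
  induction m, hm using Nat.le_induction with
  | base => exact ⟨A, subset_rfl, rfl, h⟩
  | succ m hm ih =>
    obtain ⟨B, h1, h2, h3⟩ := ih (by omega)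
    obtain ⟨x, hx, y, -, hy, hxy⟩ := hu.2 B (Finset.subset_univ _) h3.1 (fun hB => by
      rw [hB, Finset.card_univ] at h2; omega)
    exact ⟨insert y B, h1.trans (Finset.subset_insert _ _), by rw [Finset.card_insert_of_notMem hy, h2],
      h3.ins hR hx hxy⟩

theorem adj_def {β : Permu} {x y : Fin β.1} (h : Adj (pp β) (vv β) x y) :
    (x < y ∧ β.2 y < β.2 x) ∨ (y < x ∧ β.2 x < β.2 y) := by
  simp only [Adj, pp, vv] at h; simp only [Fin.lt_def]; omega

theorem Cnn.ind {β : Permu} {A} (h : Cnn (Adj (pp β) (vv β)) A) : Ind (pat β A) := by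
  classical
  refine ⟨Finset.card_pos.2 h.1, fun k hk hk' => ?_⟩
  let S : Finset (Fin β.1) := (Finset.univ.filter (fun i : Fin (pat β A).1 => i.1 < k)).image (pemb β A)
  have memS : ∀ i, pemb β A i ∈ S ↔ i.1 < k := by
    intro i
    simp only [S, Finset.mem_image, Finset.mem_filter, Finset.mem_univ, true_and]
    exact ⟨fun ⟨j, hj, e⟩ => (pemb_mono β A).injective e ▸ hj, fun h => ⟨i, h, rfl⟩⟩
  have h0 : S ⊆ A := fun x hx => by
    obtain ⟨i, -, rfl⟩ := Finset.mem_image.1 hx; exact pemb_mem _ _ _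
  obtain ⟨x, hx, y, hy, hyS, hxy⟩ := h.2 S h0 ⟨_, (memS ⟨0, by omega⟩).2 hk⟩ (fun he => by
    have := (memS ⟨k, hk'⟩).1 (by rw [he]; exact pemb_mem _ _ _); simp at this)
  obtain ⟨i, rfl⟩ := pemb_surj (h0 hx)
  obtain ⟨j, rfl⟩ := pemb_surj hy
  rw [memS] at hx hyS
  have := adj_def hxy
  rw [pemb_lt, pemb_lt, ← pat_lt, ← pat_lt] at this
  refine ⟨i, j, hx, not_lt.1 hyS, ?_⟩
  rcases this with h | h
  · exact h.2
  · have := Fin.lt_def.1 h.1; omega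

theorem Ind.con {β : Permu} (h : Ind β) : Cnn (Adj (pp β) (vv β)) Finset.univ := by
  classical
  let o : Fin β.1 := ⟨0, h.1⟩
  refine ⟨⟨o, Finset.mem_univ _⟩, fun S _ hne hS => ?_⟩
  by_contra hc
  push Not at hc
  have hc' : ∀ x y, (x ∈ S) ≠ (y ∈ S) → ¬ Adj (pp β) (vv β) x y := by
    intro x y hxy ha
    by_cases hx : x ∈ S <;> by_cases hy : y ∈ S
    · simp [hx, hy] at hxy
    · exact hc x hx y (Finset.mem_univ _) hy ha
    · exact hc y hy x (Finset.mem_univ _) hx ha.symm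
    · simp [hx, hy] at hxy
  have hex : ∃ k, ∃ hk : k < β.1, ((⟨k, hk⟩ : Fin β.1) ∈ S) ≠ (o ∈ S) := by
    by_contra hh
    push Not at hh
    obtain ⟨x, hx⟩ := hne
    apply hS
    have ho : o ∈ S := by rw [← hh x.1 x.2]; exact hx
    exact Finset.eq_univ_of_forall fun y => by rw [← Fin.eta y y.2, hh y.1 y.2]; exact ho
  obtain ⟨hk, hk2⟩ := Nat.find_spec hex
  have hmin : ∀ i : Fin β.1, i.1 < Nat.find hex → (i ∈ S) = (o ∈ S) := fun i hi => by
    have := Nat.find_min hex hi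
    push Not at this
    exact this i.2
  set k := Nat.find hex
  have hk0 : 0 < k := by
    rcases Nat.eq_zero_or_pos k with h0 | h0
    · exact absurd (by rw [show (⟨k, hk⟩ : Fin β.1) = o from Fin.ext h0]) hk2
    · exact h0
  obtain ⟨i, j, hi, hj, hij⟩ := h.2 k hk0 hk
  have e1 := hmin i hi
  have e2 : (j ∈ S) = (o ∈ S) := by
    by_contra hh
    refine hc' i j (by rw [e1]; exact fun h => hh h.symm) ?_
    left; simp only [pp, vv]; rw [Fin.lt_def] at hij; omega
  have a1 := hc' i ⟨k, hk⟩ (by rw [e1]; exact hk2.symm)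
  have a2 := hc' ⟨k, hk⟩ j (by rw [e2]; exact hk2)
  have n1 : i ≠ ⟨k, hk⟩ := by rintro rfl; simp at hi
  have n2 : j ≠ ⟨k, hk⟩ := by rintro rfl; exact hk2 e2
  have n1' : vv β i ≠ vv β ⟨k, hk⟩ := fun h => n1 (vv_inj β h)
  have n2' : vv β j ≠ vv β ⟨k, hk⟩ := fun h => n2 (vv_inj β h)
  have n3 : j.1 ≠ k := fun h => n2 (Fin.ext h)
  simp only [Adj, pp] at a1 a2
  have : vv β j < vv β i := by simp only [vv]; rw [Fin.lt_def] at hij; omega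
  omega

theorem Bas.ind {E β} (hE : Thin E) (h : Bas E β) : Ind β := by
  classical
  have h0 : 0 < β.1 := by
    rcases Nat.eq_zero_or_pos β.1 with h0 | h0
    · exact absurd hE.emp (by
        rw [show pempty = β from PLe.eq (PLe.of (fun i => i.elim0) (fun i => i.elim0) (fun i => i.elim0)) (by rw [h0]; exact le_rfl)]
        exact h.1)
    · exact h0
  refine ⟨h0, fun k hk hk' => ?_⟩
  by_contra hc
  push Not at hc
  let A : Finset (Fin β.1) := Finset.univ.filter fun i => i.1 < k
  have hA : ∀ x, x ∈ A ↔ x.1 < k := by simp [A]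
  have cA : A.card = k := by
    rw [show A = (Finset.univ : Finset (Fin k)).map (Fin.castLEEmb hk'.le) from ?_]
    · simp
    · ext x; rw [hA]; simp only [Finset.mem_map, Finset.mem_univ, true_and]
      exact ⟨fun h => ⟨⟨x, h⟩, rfl⟩, fun ⟨y, hy⟩ => hy ▸ y.2⟩
  have cB : (Aᶜ).card = β.1 - k := by rw [Finset.card_compl, cA, Fintype.card_fin]
  have m1 : pat β A ∈ E := h.2 _ (pat_le _ _) (fun he => by have := congrArg Sigma.fst he; simp [cA] at this; omega)
  have m2 : pat β Aᶜ ∈ E := h.2 _ (pat_le _ _) (fun he => by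
    have := congrArg Sigma.fst he; rw [pat_card, cB] at this; omega)
  have hl : ∀ (i : Fin (pat β A).1) (j : Fin (pat β Aᶜ).1), (pemb β A i).1 < k ∧ k ≤ (pemb β Aᶜ j).1 := by
    intro i j
    have e1 := (hA _).1 (pemb_mem β A i)
    have e2 := pemb_mem β Aᶜ j
    rw [Finset.mem_compl, hA] at e2
    omega
  have key : PLe (dsum (pat β A) (pat β Aᶜ)) β := by
    refine dsum_PLe (pemb β A) (pemb β Aᶜ) (fun i j h => pemb_lt.2 h) (fun i j h => pat_lt.1 h)
      (fun i j h => pemb_lt.2 h) (fun i j h => pat_lt.1 h) (fun i j => ?_) (fun i j => ?_)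
    · rw [Fin.lt_def]; have := hl i j; omega
    · have h3 := hl i j
      refine lt_of_le_of_ne (hc _ _ h3.1 h3.2) fun he => ?_
      have := congrArg Fin.val (β.2.injective he); omega
  have := key.eq (by simp only [pat_card, cA, cB]; omega)
  exact h.1 (this ▸ hE.sum _ m1 _ m2)

structure Geo {α : Type} [Fintype α] (κ : ℕ → ℕ) (eqv : Finset α → Finset α → Prop) (p v : α → ℤ) : Prop where
  pinj : ∀ {x y}, p x = p y → x = y
  vinj : ∀ {x y}, v x = v y → x = y
  iso : ∀ {A B}, eqv A B → A.Nonempty → ∃ φ : α → α, Set.BijOn φ A B ∧ (∀ i ∈ A, ∀ j ∈ A, (p i < p j ↔ p (φ i) < p (φ j))) ∧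
      (∀ i ∈ A, ∀ j ∈ A, (v i < v j ↔ v (φ i) < v (φ j)))
  con : Cnn (Adj p v) (Finset.univ : Finset α)
  cnt : ∀ {m}, m < Fintype.card α → ∀ l : List (Finset α), l.Pairwise (fun A B => ¬ eqv A B) →
    (∀ A ∈ l, A.card = m ∧ Cnn (Adj p v) A) → l.length ≤ κ m

theorem Geo.swap {α : Type} [Fintype α] {κ} {eqv : Finset α → Finset α → Prop} {p v} (h : Geo κ eqv p v) : Geo κ eqv v p := by
  obtain ⟨a, b, c, d, e⟩ := h
  refine ⟨b, a, fun h h' => ?_, by rwa [Adj.swap], by rwa [Adj.swap]⟩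
  obtain ⟨φ, h1, h2, h3⟩ := c h h'
  exact ⟨φ, h1, h3, h2⟩

theorem Geo.ng {α : Type} [Fintype α] {κ} {eqv : Finset α → Finset α → Prop} {p v} (h : Geo κ eqv p v) : Geo κ eqv (ng p) (ng v) := by
  obtain ⟨a, b, c, d, e⟩ := h
  refine ⟨fun h => a (by simp only [_root_.ng] at h; omega), fun h => b (by simp only [_root_.ng] at h; omega), fun h h' => ?_, by rwa [Adj.ng], by rwa [Adj.ng]⟩
  obtain ⟨φ, h1, h2, h3⟩ := c h h'
  refine ⟨φ, h1, fun i hi j hj => ?_, fun i hi j hj => ?_⟩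
  · have := h2 j hj i hi; simp only [_root_.ng]; omega
  · have := h3 j hj i hi; simp only [_root_.ng]; omega

theorem Bas.geo {E β} (hE : Thin E) (h : Bas E β) :
    Geo (KK E) (fun A B => pat β A = pat β B) (pp β) (vv β) := by
  classical
  refine ⟨pp_inj β, vv_inj β, fun h h' => ?_, (h.ind hE).con, fun {m} hm l hl hA => ?_⟩
  · obtain ⟨φ, h1, h2, h3⟩ := pat_iso h h'
    refine ⟨φ, h1, fun i hi j hj => ?_, fun i hi j hj => ?_⟩
    · have := h2 i hi j hj; simp only [pp]; rw [Fin.lt_def, Fin.lt_def] at this; omega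
    · have := h3 i hi j hj; simp only [vv]; rw [Fin.lt_def, Fin.lt_def] at this; omega
  · have hnd : (l.map (pat β)).Nodup := List.pairwise_map.2 hl
    rw [← List.length_map (pat β), ← List.toFinset_card_of_nodup hnd, ← Set.ncard_coe_finset]
    refine Set.ncard_le_ncard ?_ (pset_finite _ m)
    intro σ hσ
    simp only [List.coe_toFinset, Set.mem_setOf_eq, List.mem_map] at hσ
    obtain ⟨A, hAl, rfl⟩ := hσ
    refine ⟨⟨h.2 _ (pat_le _ _) (fun he => ?_), (hA A hAl).2.ind⟩, (hA A hAl).1⟩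
    have := congrArg Sigma.fst he
    rw [pat_card, (hA A hAl).1] at this
    rw [Fintype.card_fin] at hm; omega

def IP {α : Type} (R : α → α → Prop) (z : ℕ → α) (T : ℕ) : Prop :=
  (∀ i < T, R (z i) (z (i+1))) ∧ ∀ i j, i + 2 ≤ j → j ≤ T → ¬ R (z i) (z j) ∧ z i ≠ z j

def GG {α : Type} (p v : α → ℤ) : SimpleGraph α where
  Adj := Adj p v
  symm := ⟨fun _ _ h => h.symm⟩
  loopless := ⟨fun x h => by simp [Adj] at h⟩

theorem GG_conn {α : Type} [Fintype α] {p v : α → ℤ} (h : Cnn (Adj p v) (Finset.univ : Finset α)) : (GG p v).Connected := by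
  classical
  obtain ⟨x0, -⟩ := h.1
  have : Nonempty α := ⟨x0⟩
  refine ⟨fun x y => ?_⟩
  by_contra hc
  obtain ⟨a, ha, b, -, hb, hab⟩ := h.2 (Finset.univ.filter fun z => (GG p v).Reachable x z) (Finset.subset_univ _)
    ⟨x, by simp⟩ (fun he => hc (by
      have : y ∈ Finset.univ.filter fun z => (GG p v).Reachable x z := by rw [he]; exact Finset.mem_univ _
      simpa using this))
  simp only [Finset.mem_filter, Finset.mem_univ, true_and] at ha hb
  exact hb (ha.trans (SimpleGraph.Adj.reachable (G := GG p v) hab))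

theorem geodesic {α : Type} {G : SimpleGraph α} (hG : G.Connected) (x y : α) :
    ∃ z : ℕ → α, IP G.Adj z (G.dist x y) := by
  obtain ⟨w, hw⟩ := hG.exists_walk_length_eq_dist x y
  refine ⟨w.getVert, fun i hi => w.adj_getVert_succ (by omega), fun i j hij hj => ?_⟩
  have h1 : G.dist x (w.getVert i) ≤ i := (SimpleGraph.dist_le (w.take i)).trans (by simp)
  have h2 : G.dist (w.getVert j) y ≤ G.dist x y - j := (SimpleGraph.dist_le (w.drop j)).trans (by simp [hw])
  have t1 := hG.dist_triangle (u := x) (v := w.getVert i) (w := y)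
  have t2 := hG.dist_triangle (u := w.getVert i) (v := w.getVert j) (w := y)
  refine ⟨fun h => ?_, fun h => ?_⟩
  · have := SimpleGraph.dist_eq_one_iff_adj.2 h; omega
  · rw [h, SimpleGraph.dist_self] at t2; rw [h] at t1 h1; omega

theorem lip {α : Type} {G : SimpleGraph α} (hG : G.Connected) (L : α → ℕ) (k : ℕ)
    (hL : ∀ x y, G.Adj x y → L y ≤ L x + k) (x y : α) : L y ≤ L x + k * G.dist x y := by
  obtain ⟨w, hw⟩ := hG.exists_walk_length_eq_dist x y
  rw [← hw]
  clear hw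
  induction w with
  | nil => simp
  | cons h w ih => have := hL _ _ h; simp only [SimpleGraph.Walk.length_cons, mul_add]; omega

theorem long_path {α : Type} [Fintype α] {p v : α → ℤ} (hp : ∀ {x y}, p x = p y → x = y) (hv : ∀ {x y}, v x = v y → x = y)
    (hcon : Cnn (Adj p v) (Finset.univ : Finset α)) {k0 : ℕ} (hF : Free p v k0) {K T0 : ℕ} {c}
    (hc : Cfg21 p v K c) (hK : k0 * T0 + k0 + 2 ≤ K) : ∃ z T, T0 ≤ T ∧ IP (Adj p v) z T := by
  classical
  let B : ℕ → α → Prop := fun i x => ∀ s, p (c s i) < p x ∧ v (c s i) < v x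
  have hB : ∀ i j x, i < j → j < K → B j x → B i x := by
    intro i j x hij hj h s
    have := hc.2 s s i j hij hj; have := h s; omega
  let L : α → ℕ := fun x => ((Finset.range K).filter fun i => B i x).card
  have hL1 : ∀ x i, i < K → B i x → i < L x := by
    intro x i hi h
    have : Finset.range (i+1) ⊆ (Finset.range K).filter fun i => B i x := by
      intro j hj
      simp only [Finset.mem_filter, Finset.mem_range] at hj ⊢
      refine ⟨by omega, ?_⟩
      rcases Nat.lt_or_ge j i with h1 | h1
      · exact hB j i x h1 hi h
      · rwa [show j = i by omega]
    have := Finset.card_le_card this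
    rw [Finset.card_range] at this; exact this
  have hL2 : ∀ x i, i < K → ¬ B i x → L x ≤ i := by
    intro x i hi h
    have : ((Finset.range K).filter fun i => B i x) ⊆ Finset.range i := by
      intro j hj
      simp only [Finset.mem_filter, Finset.mem_range] at hj ⊢
      by_contra hh
      rcases Nat.eq_or_lt_of_le (not_lt.1 hh) with h1 | h1
      · subst h1; exact h hj.2
      · exact h (hB i j x h1 hj.1 hj.2)
    have := Finset.card_le_card this
    rw [Finset.card_range] at this; exact this
  have hLB : ∀ x i, i < L x → B i x := by
    intro x i hi
    by_contra h
    have hK : L x ≤ K := by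
      have := Finset.card_filter_le (Finset.range K) fun i => B i x
      rw [Finset.card_range] at this; exact this
    have := hL2 x i (by omega) h; omega
  have hLK : ∀ x, L x ≤ K := by
    intro x
    have := Finset.card_filter_le (Finset.range K) fun i => B i x
    rw [Finset.card_range] at this; exact this
  have edge : ∀ x y, (GG p v).Adj x y → L y ≤ L x + k0 := by
    intro x y (hxy : Adj p v x y)
    by_contra hlt
    have hyK := hLK y
    set a := L x with ha
    have hna : ¬ B a x := fun h => by have := hL1 x a (by omega) h; omega
    have key : ∀ s i, i < k0 → B (a + 1 + i) y ∧ (p (c s (a + 1 + i)) ≠ p x) ∧ (v (c s (a + 1 + i)) ≠ v x) ∧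
        ¬ (p (c s (a + 1 + i)) < p x ∧ v (c s (a + 1 + i)) < v x) := by
      intro s i hi
      have hby : B (a + 1 + i) y := hLB y _ (by omega)
      have hny : c s (a + 1 + i) ≠ x := by
        rintro h; have := hby s; rw [h] at this; simp only [Adj] at hxy; omega
      refine ⟨hby, fun h => hny (hp h), fun h => hny (hv h), fun h => hna fun t => ?_⟩
      have := hc.2 t s a (a + 1 + i) (by omega) (by omega); omega
    have cfg : Cfg21 p v k0 (fun s i => c s (a + 1 + i)) := 
      ⟨fun i hi => hc.1 _ (by omega), fun s t i j hij hj => hc.2 s t _ _ (by omega) (by omega)⟩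
    rcases hxy with hxy | hxy
    · refine hF.C2 _ x cfg fun s i hi => ?_
      obtain ⟨h1, h2, h3, h4⟩ := key s i hi
      have := h1 s
      omega
    · refine hF.C1 _ x cfg fun s i hi => ?_
      obtain ⟨h1, h2, h3, h4⟩ := key s i hi
      have := h1 s
      omega
  have hG := GG_conn hcon
  have h1 := lip hG L k0 edge (c true 0) (c true (K-1))
  have h2 : L (c true 0) ≤ 0 := hL2 _ _ (by omega) (fun h => by have := h true; omega)
  have h3 : K - 2 < L (c true (K - 1)) := hL1 _ _ (by omega) (fun s => hc.2 s true (K-2) (K-1) (by omega) (by omega))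
  obtain ⟨z, hz⟩ := geodesic hG (c true 0) (c true (K-1))
  refine ⟨z, _, ?_, hz⟩
  by_contra hlt
  have : k0 * (GG p v).dist (c true 0) (c true (K-1)) ≤ k0 * T0 := Nat.mul_le_mul_left _ (by omega)
  omega

def Std {α : Type} (p v : α → ℤ) (e : ℕ) (z : ℕ → α) (T : ℕ) : Prop :=
  (∀ i j, i + 2 ≤ j → j ≤ T → p (z i) < p (z j) ∧ v (z i) < v (z j)) ∧
  (∀ i, i < T → (i + e) % 2 = 0 → p (z i) < p (z (i+1)) ∧ v (z (i+1)) < v (z i)) ∧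
  (∀ i, i < T → (i + e) % 2 = 1 → p (z (i+1)) < p (z i) ∧ v (z i) < v (z (i+1)))

theorem Std.swap {α : Type} {p v : α → ℤ} {e z T} (h : Std p v e z T) : Std v p (e+1) z T :=
  ⟨fun i j hi hj => (h.1 i j hi hj).symm, fun i hi he => (h.2.2 i hi (by omega)).symm, fun i hi he => (h.2.1 i hi (by omega)).symm⟩

theorem Std.par {α : Type} {p v : α → ℤ} {e e' z T} (h : Std p v e z T) (he : e % 2 = e' % 2) : Std p v e' z T :=
  ⟨h.1, fun i hi he => h.2.1 i hi (by omega), fun i hi he => h.2.2 i hi (by omega)⟩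

theorem Std.rev {α : Type} {p v : α → ℤ} {e z T} (h : Std p v e z T) : Std (ng p) (ng v) (e + T + 1) (fun i => z (T - i)) T := by
  obtain ⟨h1, h2, h3⟩ := h
  simp only [Std, ng]
  refine ⟨fun i j hi hj => ?_, fun i hi he => ?_, fun i hi he => ?_⟩
  · have := h1 (T - j) (T - i) (by omega) (by omega); omega
  · have := h2 (T - (i+1)) (by omega) (by omega); rw [show T - (i+1) + 1 = T - i by omega] at this; omega
  · have := h3 (T - (i+1)) (by omega) (by omega); rw [show T - (i+1) + 1 = T - i by omega] at this; omega

theorem Std.shift {α : Type} {p v : α → ℤ} {e z T} (h : Std p v e z T) (s T' : ℕ) (hs : s + T' ≤ T) :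
    Std p v (e + s) (fun i => z (s + i)) T' := by
  obtain ⟨h1, h2, h3⟩ := h
  exact ⟨fun i j hi hj => h1 _ _ (by omega) (by omega), fun i hi he => h2 (s + i) (by omega) (by omega),
    fun i hi he => h3 (s + i) (by omega) (by omega)⟩

theorem Std.adj {α : Type} {p v : α → ℤ} {e z T} (h : Std p v e z T) {i j} (hi : i ≤ T) (hj : j ≤ T) :
    Adj p v (z i) (z j) ↔ i + 1 = j ∨ j + 1 = i := by
  obtain ⟨h1, h2, h3⟩ := h
  have key : ∀ i, i < T → Adj p v (z i) (z (i+1)) := by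
    intro i hi
    rcases Nat.mod_two_eq_zero_or_one (i + e) with he | he
    · exact .inl (h2 i hi he)
    · exact .inr (h3 i hi he)
  constructor
  · intro h
    by_contra hc
    rcases Nat.lt_or_ge (i + 1) j with h4 | h4
    · have := h1 i j h4 hj; simp only [Adj] at h; omega
    rcases Nat.lt_or_ge (j + 1) i with h5 | h5
    · have := h1 j i h5 hi; simp only [Adj] at h; omega
    obtain rfl : i = j := by omega
    simp [Adj] at h
  · rintro (rfl | rfl)
    · exact key _ (by omega)
    · exact (key _ (by omega)).symm

theorem Std.inj {α : Type} {p v : α → ℤ} {e z T} (h : Std p v e z T) {i j} (hi : i ≤ T) (hj : j ≤ T)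
    (hz : z i = z j) : i = j := by
  by_contra hne
  by_cases h1 : i + 1 = j ∨ j + 1 = i
  · have := (h.adj hi hj).2 h1; rw [hz] at this; simp [Adj] at this
  · rcases Nat.lt_or_ge i j with h2 | h2
    · have := h.1 i j (by omega) hj; rw [hz] at this; omega
    · have := h.1 j i (by omega) hi; rw [hz] at this; omega

theorem IP.std {α : Type} {p v : α → ℤ} (hp : ∀ {x y}, p x = p y → x = y) (hv : ∀ {x y}, v x = v y → x = y) {z T}
    (h : IP (Adj p v) z T) (h02 : p (z 0) < p (z 2)) (h01 : p (z 0) < p (z 1)) (hT : 2 ≤ T) : Std p v 0 z T := by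
  have nadj : ∀ i j, i + 2 ≤ j → j ≤ T → (p (z i) < p (z j) ∧ v (z i) < v (z j)) ∨ (p (z j) < p (z i) ∧ v (z j) < v (z i)) := by
    intro i j hi hj
    obtain ⟨h1, h2⟩ := h.2 i j hi hj
    have : p (z i) ≠ p (z j) := fun h => h2 (hp h)
    have : v (z i) ≠ v (z j) := fun h => h2 (hv h)
    simp only [Adj] at h1; omega
  have hadj : ∀ i, i < T → (p (z i) < p (z (i+1)) ∧ v (z (i+1)) < v (z i)) ∨ (p (z (i+1)) < p (z i) ∧ v (z i) < v (z (i+1))) :=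
    fun i hi => h.1 i hi
  have key : ∀ t, 2 ≤ t → t ≤ T → Std p v 0 z t := by
    intro t ht
    induction t, ht using Nat.le_induction with
    | base =>
      intro _
      have e1 := nadj 0 2 (by omega) hT
      have e2 := hadj 0 (by omega)
      have e3 := hadj 1 (by omega)
      norm_num at e2 e3
      refine ⟨fun i j hi hj => ?_, fun i hi he => ?_, fun i hi he => ?_⟩
      · have hi0 : i = 0 := by omega
        have hj0 : j = 2 := by omega
        rw [hi0, hj0]; omega
      · obtain rfl : i = 0 := by omega
        norm_num; omega
      · obtain rfl : i = 1 := by omega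
        norm_num; omega
    | succ t ht ih =>
      intro hT'
      obtain ⟨h1, h2, h3⟩ := ih (by omega)
      have a1 := hadj t (by omega)
      have main : (∀ i, i + 2 ≤ t → p (z i) < p (z (t+1)) ∧ v (z i) < v (z (t+1))) := by
        intro i hi
        have := h1 i t hi le_rfl
        have := nadj i (t+1) (by omega) hT'
        omega
      have m2 := main (t-2) (by omega)
      have m3 := nadj (t-1) (t+1) (by omega) hT'
      have last : (p (z (t-1)) < p (z (t+1)) ∧ v (z (t-1)) < v (z (t+1))) ∧
        ((t + 0) % 2 = 0 → p (z t) < p (z (t+1)) ∧ v (z (t+1)) < v (z t)) ∧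
        ((t + 0) % 2 = 1 → p (z (t+1)) < p (z t) ∧ v (z t) < v (z (t+1))) := by
        have f1 := h2 (t-2) (by omega)
        have f2 := h3 (t-2) (by omega)
        have f3 := h2 (t-1) (by omega)
        have f4 := h3 (t-1) (by omega)
        rw [show t - 2 + 1 = t - 1 by omega] at f1 f2
        rw [show t - 1 + 1 = t by omega] at f3 f4
        rcases Nat.mod_two_eq_zero_or_one t with he | he
        · have := f1 (by omega); have := f4 (by omega); omega
        · have := f2 (by omega); have := f3 (by omega); omega
      refine ⟨fun i j hi hj => ?_, fun i hi he => ?_, fun i hi he => ?_⟩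
      · rcases Nat.lt_or_ge j (t+1) with hj' | hj'
        · exact h1 i j hi (by omega)
        obtain rfl : j = t + 1 := by omega
        rcases Nat.lt_or_ge i (t-1) with hi' | hi'
        · exact main i (by omega)
        · rw [show i = t - 1 by omega]; exact last.1
      · rcases Nat.lt_or_ge i t with hi' | hi'
        · exact h2 i hi' he
        · obtain rfl : i = t := by omega
          exact last.2.1 he
      · rcases Nat.lt_or_ge i t with hi' | hi'
        · exact h3 i hi' he
        · obtain rfl : i = t := by omega
          exact last.2.2 he
  exact key T hT le_rfl

open Classical in
noncomputable def nb {α : Type} (p v : α → ℤ) (A : Finset α) (x : α) : ℕ := (A.filter (Adj p v x)).card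

def LB {α : Type} (p v : α → ℤ) (A : Finset α) (a b : ℕ) : Prop :=
  (∃ x ∈ A, (∀ y ∈ A, p x ≤ p y) ∧ nb p v A x = a) ∧ ∃ x ∈ A, (∀ y ∈ A, v x ≤ v y) ∧ nb p v A x = b
def PR {α : Type} (p v : α → ℤ) (A : Finset α) (c : ℕ) : Prop := ∃ a b, LB p v A a b ∧ a * b = c
def ND {α : Type} (p v : α → ℤ) (A : Finset α) : Prop := ∀ x ∈ A, nb p v A x ≤ 2
def NC {α : Type} (p v : α → ℤ) (A : Finset α) : Prop :=
  ∀ x ∈ A, ∀ y ∈ A, ∀ w ∈ A, p x < p y → v y < v x → p y < p w → v w < v y → False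

theorem nb_swap {α : Type} (p v : α → ℤ) (A : Finset α) (x : α) : nb v p A x = nb p v A x := by
  simp only [nb]; congr 1; ext y; simp only [Finset.mem_filter, Adj.swap]
theorem LB.swap {α : Type} {p v : α → ℤ} {A : Finset α} {a b} (h : LB p v A a b) : LB v p A b a := by
  simp only [LB, nb_swap] at *; exact h.symm
theorem PR.swap {α : Type} {p v : α → ℤ} {A : Finset α} {c} (h : PR p v A c) : PR v p A c := by
  obtain ⟨a, b, h, e⟩ := h; exact ⟨b, a, h.swap, by rw [mul_comm, e]⟩
theorem ND.swap {α : Type} {p v : α → ℤ} {A : Finset α} (h : ND p v A) : ND v p A := by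
  simpa only [ND, nb_swap] using h
theorem NC.swap {α : Type} {p v : α → ℤ} {A : Finset α} (h : NC p v A) : NC v p A :=
  fun x hx y hy w hw a b c d => h w hw y hy x hx d c b a

theorem nb_eq {α : Type} {p v : α → ℤ} {A : Finset α} {x : α} {S : Finset α} (h : ∀ y, y ∈ S ↔ y ∈ A ∧ Adj p v x y) :
    nb p v A x = S.card := by
  classical
  rw [nb]; congr 1; ext y; rw [Finset.mem_filter, h]

section
variable {α : Type} [Fintype α] {κ : ℕ → ℕ} {eqv : Finset α → Finset α → Prop} {p v : α → ℤ}

theorem Geo.nb (h : Geo κ eqv p v) {A B : Finset α} (e : eqv A B) (hA : A.Nonempty) :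
    ∃ φ : α → α, Set.BijOn φ A B ∧ (∀ i ∈ A, ∀ j ∈ A, (p i < p j ↔ p (φ i) < p (φ j))) ∧
      (∀ i ∈ A, ∀ j ∈ A, (v i < v j ↔ v (φ i) < v (φ j))) ∧ ∀ x ∈ A, nb p v B (φ x) = nb p v A x := by
  classical
  obtain ⟨φ, h1, h2, h3⟩ := h.iso e hA
  refine ⟨φ, h1, h2, h3, fun x hx => ?_⟩
  rw [nb_eq (S := (A.filter (Adj p v x)).image φ), Finset.card_image_of_injOn, _root_.nb]
  · exact h1.injOn.mono (fun y hy => (Finset.mem_filter.1 hy).1)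
  · intro y
    have ad : ∀ w ∈ A, (Adj p v (φ x) (φ w) ↔ Adj p v x w) := fun w hw => by
      simp only [Adj]; rw [h2 x hx w hw, h3 x hx w hw, h2 w hw x hx, h3 w hw x hx]
    constructor
    · intro hy
      obtain ⟨w, hw, rfl⟩ := Finset.mem_image.1 hy
      rw [Finset.mem_filter] at hw
      exact ⟨h1.mapsTo hw.1, (ad w hw.1).2 hw.2⟩
    · rintro ⟨hy, ha⟩
      obtain ⟨w, hw, rfl⟩ := h1.surjOn hy
      exact Finset.mem_image.2 ⟨w, Finset.mem_filter.2 ⟨hw, (ad w hw).1 ha⟩, rfl⟩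

theorem Geo.LB (h : Geo κ eqv p v) {A B : Finset α} (e : eqv A B) {a b a' b'} (hA : LB p v A a b) (hB : LB p v B a' b') :
    a = a' ∧ b = b' := by
  obtain ⟨⟨x, hx, hx1, rfl⟩, ⟨y, hy, hy1, rfl⟩⟩ := hA
  obtain ⟨⟨x', hx', hx1', rfl⟩, ⟨y', hy', hy1', rfl⟩⟩ := hB
  obtain ⟨φ, h1, h2, h3, h4⟩ := h.nb e ⟨x, hx⟩
  obtain ⟨w, hw, rfl⟩ := h1.surjOn hx'
  obtain ⟨w', hw', rfl⟩ := h1.surjOn hy'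
  have a1 := h2 w hw x hx
  have a2 := hx1 w hw
  have a3 := hx1' _ (h1.mapsTo hx)
  have b1 := h3 w' hw' y hy
  have b2 := hy1 w' hw'
  have b3 := hy1' _ (h1.mapsTo hy)
  have e1 : φ x = φ w := h.pinj (by omega)
  have e2 : φ y = φ w' := h.vinj (by omega)
  rw [← e1, ← e2, h4 x hx, h4 y hy]
  exact ⟨rfl, rfl⟩

theorem Geo.PR (h : Geo κ eqv p v) {A B : Finset α} (e : eqv A B) {c c'} (hA : PR p v A c) (hB : PR p v B c') : c = c' := by
  obtain ⟨a, b, h1, rfl⟩ := hA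
  obtain ⟨a', b', h2, rfl⟩ := hB
  obtain ⟨rfl, rfl⟩ := h.LB e h1 h2; rfl

theorem Geo.ND (h : Geo κ eqv p v) {A B : Finset α} (e : eqv A B) (hn : A.Nonempty) (hA : ND p v A) : ND p v B := by
  obtain ⟨φ, h1, h2, h3, h4⟩ := h.nb e hn
  intro y hy
  obtain ⟨w, hw, rfl⟩ := h1.surjOn hy
  rw [h4 w hw]; exact hA w hw

theorem Geo.NC (h : Geo κ eqv p v) {A B : Finset α} (e : eqv A B) (hn : A.Nonempty) (hA : NC p v A) : NC p v B := by
  obtain ⟨φ, h1, h2, h3, h4⟩ := h.nb e hn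
  intro x' hx' y' hy' w' hw'
  obtain ⟨x, hx, rfl⟩ := h1.surjOn hx'
  obtain ⟨y, hy, rfl⟩ := h1.surjOn hy'
  obtain ⟨w, hw, rfl⟩ := h1.surjOn hw'
  rw [← h2 x hx y hy, ← h3 y hy x hx, ← h2 y hy w hw, ← h3 w hw y hy]
  exact hA x hx y hy w hw

end

open Classical in
noncomputable def WW {α : Type} (z : ℕ → α) (L : ℕ) (X : Finset α) : Finset α := (Finset.range (L+1)).image z ∪ X

theorem mem_WW {α : Type} {z : ℕ → α} {L X y} : y ∈ WW z L X ↔ (∃ i ≤ L, z i = y) ∨ y ∈ X := by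
  classical
  simp [WW, Nat.lt_succ_iff]

theorem WW_con {α : Type} {p v : α → ℤ} {e z L} (h : Std p v e z L) {X : Finset α}
    (hX : ∀ x ∈ X, ∃ i ≤ L, Adj p v (z i) x) : Cnn (Adj p v) (WW z L X) := by
  classical
  have h0 : ∀ l, l ≤ L → Cnn (Adj p v) (WW z l ∅) := by
    intro l hl
    induction l with
    | zero => simpa [WW] using con_single (z 0)
    | succ l ih =>
      have := (ih (by omega)).ins (fun _ _ h => h.symm) (a := z l) (x := z (l+1)) (mem_WW.2 (.inl ⟨l, le_rfl, rfl⟩))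
        ((h.adj (by omega) (by omega)).2 (.inl rfl))
      rwa [show insert (z (l+1)) (WW z l ∅) = WW z (l+1) ∅ by simp [WW, Finset.range_add_one (n := l+1)]] at this
  induction X using Finset.induction_on with
  | empty => exact h0 L le_rfl
  | insert x X hx ih =>
    obtain ⟨i, hi, ha⟩ := hX x (Finset.mem_insert_self _ _)
    have := (ih fun y hy => hX y (Finset.mem_insert_of_mem hy)).ins (fun _ _ h => h.symm) (mem_WW.2 (.inl ⟨i, hi, rfl⟩)) ha
    rwa [show insert x (WW z L X) = WW z L (insert x X) by simp [WW]] at this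

theorem WW_card {α : Type} {p v : α → ℤ} {e z L} (h : Std p v e z L) {X : Finset α}
    (hX : ∀ x ∈ X, ∀ i ≤ L, z i ≠ x) : (WW z L X).card = L + 1 + X.card := by
  classical
  rw [WW, Finset.card_union_of_disjoint, Finset.card_image_of_injOn, Finset.card_range]
  · intro i hi j hj hij
    simp at hi hj
    exact h.inj (by omega) (by omega) hij
  · rw [Finset.disjoint_right]
    intro x hx hc
    simp at hc
    obtain ⟨i, hi, e⟩ := hc
    exact hX x hx i (by omega) e

theorem WW_fork {α : Type} {p v : α → ℤ} {z L} (h : Std p v 0 z L) (hL : 2 ≤ L) {X : Finset α}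
    (hX : ∀ x ∈ X, (p x < p (z 1) ∧ v (z 1) < v x) ∧ (∀ i ≤ L, i ≠ 1 → ¬ Adj p v (z i) x) ∧ (∀ y ∈ X, ¬ Adj p v x y) ∧ ∀ i ≤ L, z i ≠ x) :
    LB p v (WW z L X) 1 (2 + X.card) := by
  classical
  have a01 := h.2.1 0 (by omega) rfl
  have a12 := h.2.2 1 (by omega) rfl
  norm_num at a01 a12
  refine ⟨?_, z 1, mem_WW.2 (.inl ⟨1, by omega, rfl⟩), ?_, ?_⟩
  · obtain ⟨x, hx, hmin⟩ := (WW z L X).exists_min_image p ⟨z 0, mem_WW.2 (.inl ⟨0, by omega, rfl⟩)⟩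
    refine ⟨x, hx, hmin, ?_⟩
    have hm0 := hmin (z 0) (mem_WW.2 (.inl ⟨0, by omega, rfl⟩))
    rw [nb_eq (S := {z 1}), Finset.card_singleton]
    intro y
    rw [Finset.mem_singleton]
    rcases mem_WW.1 hx with ⟨i, hi, rfl⟩ | hxX
    · obtain rfl : i = 0 := by
        by_contra hi0
        rcases Nat.lt_or_ge 1 i with h1 | h1
        · have := h.1 0 i (by omega) hi; omega
        · rw [show i = 1 by omega] at hm0; omega
      constructor
      · rintro rfl; exact ⟨mem_WW.2 (.inl ⟨1, by omega, rfl⟩), .inl a01⟩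
      · rintro ⟨hy, ha⟩
        rcases mem_WW.1 hy with ⟨j, hj, rfl⟩ | hy
        · have := (h.adj (by omega) hj).1 ha
          rw [show j = 1 by omega]
        · exact absurd ha ((hX y hy).2.1 0 (by omega) (by omega))
    · obtain ⟨h1, h2, h3, h4⟩ := hX x hxX
      constructor
      · rintro rfl; exact ⟨mem_WW.2 (.inl ⟨1, by omega, rfl⟩), .inl h1⟩
      · rintro ⟨hy, ha⟩
        rcases mem_WW.1 hy with ⟨j, hj, rfl⟩ | hy
        · by_contra hj1
          exact h2 j hj (by rintro rfl; exact hj1 rfl) ha.symm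
        · exact absurd ha (h3 y hy)
  · intro y hy
    rcases mem_WW.1 hy with ⟨j, hj, rfl⟩ | hy
    · rcases Nat.lt_or_ge 2 j with h1 | h1
      · have := h.1 1 j (by omega) hj; omega
      · interval_cases j <;> omega
    · have := hX y hy; omega
  · rw [nb_eq (S := {z 0, z 2} ∪ X), Finset.card_union_of_disjoint, Finset.card_pair]
    · exact fun hh => by have := h.inj (by omega) (by omega) hh; omega
    · rw [Finset.disjoint_right]
      intro x hx hc
      have := (hX x hx).2.2.2
      simp only [Finset.mem_insert, Finset.mem_singleton] at hc
      rcases hc with rfl | rfl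
      · exact this 0 (by omega) rfl
      · exact this 2 (by omega) rfl
    · intro y
      simp only [Finset.mem_union, Finset.mem_insert, Finset.mem_singleton]
      constructor
      · rintro ((rfl | rfl) | hy)
        · exact ⟨mem_WW.2 (.inl ⟨0, by omega, rfl⟩), .inr a01⟩
        · exact ⟨mem_WW.2 (.inl ⟨2, by omega, rfl⟩), .inr a12⟩
        · exact ⟨mem_WW.2 (.inr hy), .inr (hX y hy).1⟩
      · rintro ⟨hy, ha⟩
        rcases mem_WW.1 hy with ⟨j, hj, rfl⟩ | hy
        · have := (h.adj (by omega) hj).1 ha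
          left
          obtain rfl | rfl : j = 0 ∨ j = 2 := by omega
          · exact .inl rfl
          · exact .inr rfl
        · exact .inr hy

theorem WW_deg {α : Type} {p v : α → ℤ} {z L} (h : Std p v 0 z L) {x : α} {i : ℕ} (hi : 2 ≤ i) (hiL : i < L)
    (ha : Adj p v (z i) x) (hN : ∀ j ≤ L, j ≠ i → ¬ Adj p v (z j) x) (h0 : p (z 0) < p x) (h1 : v (z 1) < v x)
    (hne : ∀ j ≤ L, z j ≠ x) :
    LB p v (WW z L {x}) 1 2 ∧ ¬ ND p v (WW z L {x}) := by
  classical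
  have a01 := h.2.1 0 (by omega) rfl
  have a12 := h.2.2 1 (by omega) rfl
  norm_num at a01 a12
  have mz : ∀ j, j ≤ L → z j ∈ WW z L {x} := fun j hj => mem_WW.2 (.inl ⟨j, hj, rfl⟩)
  have nz : ∀ j k, j ≤ L → k ≤ L → j ≠ k → z j ≠ z k := fun j k hj hk hjk e => hjk (h.inj hj hk e)
  refine ⟨⟨⟨z 0, mz 0 (by omega), ?_, ?_⟩, ⟨z 1, mz 1 (by omega), ?_, ?_⟩⟩, fun hh => ?_⟩
  · intro y hy
    rcases mem_WW.1 hy with ⟨j, hj, rfl⟩ | hy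
    · rcases Nat.lt_or_ge 1 j with h1 | h1
      · have := h.1 0 j (by omega) hj; omega
      · interval_cases j <;> omega
    · rw [Finset.mem_singleton.1 hy]; omega
  · rw [nb_eq (S := {z 1}), Finset.card_singleton]
    intro y
    rw [Finset.mem_singleton]
    constructor
    · rintro rfl; exact ⟨mz 1 (by omega), .inl a01⟩
    · rintro ⟨hy, ha⟩
      rcases mem_WW.1 hy with ⟨j, hj, rfl⟩ | hy
      · have := (h.adj (by omega) hj).1 ha
        rw [show j = 1 by omega]
      · rw [Finset.mem_singleton.1 hy] at ha; exact absurd ha (hN 0 (by omega) (by omega))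
  · intro y hy
    rcases mem_WW.1 hy with ⟨j, hj, rfl⟩ | hy
    · rcases Nat.lt_or_ge 2 j with h1 | h1
      · have := h.1 1 j (by omega) hj; omega
      · interval_cases j <;> omega
    · rw [Finset.mem_singleton.1 hy]; omega
  · rw [nb_eq (S := {z 0, z 2}), Finset.card_pair (nz 0 2 (by omega) (by omega) (by omega))]
    intro y
    simp only [Finset.mem_insert, Finset.mem_singleton]
    constructor
    · rintro (rfl | rfl)
      · exact ⟨mz 0 (by omega), .inr a01⟩
      · exact ⟨mz 2 (by omega), .inr a12⟩
    · rintro ⟨hy, ha⟩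
      rcases mem_WW.1 hy with ⟨j, hj, rfl⟩ | hy
      · have := (h.adj (by omega) hj).1 ha
        obtain rfl | rfl : j = 0 ∨ j = 2 := by omega
        · exact .inl rfl
        · exact .inr rfl
      · rw [Finset.mem_singleton.1 hy] at ha; exact absurd ha (hN 1 (by omega) (by omega))
  · have := hh (z i) (mz i (by omega))
    rw [nb] at this
    have hs : {z (i-1), z (i+1), x} ⊆ (WW z L {x}).filter (Adj p v (z i)) := by
      intro y hy
      rw [Finset.mem_filter]
      simp only [Finset.mem_insert, Finset.mem_singleton] at hy
      rcases hy with rfl | rfl | rfl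
      · exact ⟨mz _ (by omega), (h.adj (by omega) (by omega)).2 (by omega)⟩
      · exact ⟨mz _ (by omega), (h.adj (by omega) (by omega)).2 (by omega)⟩
      · exact ⟨mem_WW.2 (.inr (by simp)), ha⟩
    have := Finset.card_le_card hs
    rw [Finset.card_insert_of_notMem, Finset.card_pair (hne _ (by omega))] at this
    · omega
    · simp only [Finset.mem_insert, Finset.mem_singleton, not_or]
      exact ⟨nz _ _ (by omega) (by omega) (by omega), hne _ (by omega)⟩

theorem WW_cyc {α : Type} {p v : α → ℤ} {z L} (h : Std p v 0 z L) (hL : 2 ≤ L) {x : α}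
    (hx0 : p (z 0) < p x ∧ v x < v (z 0)) (hx2 : p (z 2) < p x ∧ v x < v (z 2))
    (hN : ∀ j ≤ L, j ≠ 0 → j ≠ 2 → ¬ Adj p v (z j) x) (hne : ∀ j ≤ L, z j ≠ x) :
    LB p v (WW z L {x}) 2 2 := by
  classical
  have a01 := h.2.1 0 (by omega) rfl
  have a12 := h.2.2 1 (by omega) rfl
  norm_num at a01 a12
  have mz : ∀ j, j ≤ L → z j ∈ WW z L {x} := fun j hj => mem_WW.2 (.inl ⟨j, hj, rfl⟩)
  have mx : x ∈ WW z L {x} := mem_WW.2 (.inr (by simp))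
  have nz : ∀ j k, j ≤ L → k ≤ L → j ≠ k → z j ≠ z k := fun j k hj hk hjk e => hjk (h.inj hj hk e)
  refine ⟨⟨z 0, mz 0 (by omega), ?_, ?_⟩, ?_⟩
  · intro y hy
    rcases mem_WW.1 hy with ⟨j, hj, rfl⟩ | hy
    · rcases Nat.lt_or_ge 1 j with h1 | h1
      · have := h.1 0 j (by omega) hj; omega
      · interval_cases j <;> omega
    · rw [Finset.mem_singleton.1 hy]; omega
  · rw [nb_eq (S := {z 1, x}), Finset.card_pair (hne 1 (by omega))]
    intro y
    simp only [Finset.mem_insert, Finset.mem_singleton]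
    constructor
    · rintro (rfl | rfl)
      · exact ⟨mz 1 (by omega), .inl a01⟩
      · exact ⟨mx, .inl hx0⟩
    · rintro ⟨hy, ha⟩
      rcases mem_WW.1 hy with ⟨j, hj, rfl⟩ | hy
      · have := (h.adj (by omega) hj).1 ha
        rw [show j = 1 by omega]; exact .inl rfl
      · exact .inr (Finset.mem_singleton.1 hy)
  · obtain ⟨w, hw, hmin⟩ := (WW z L {x}).exists_min_image v ⟨z 0, mz 0 (by omega)⟩
    refine ⟨w, hw, hmin, ?_⟩
    have m1 := hmin _ (mz 1 (by omega))
    rw [nb_eq (S := {z 0, z 2}), Finset.card_pair (nz 0 2 (by omega) (by omega) (by omega))]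
    intro y
    simp only [Finset.mem_insert, Finset.mem_singleton]
    rcases mem_WW.1 hw with ⟨i, hi, rfl⟩ | hw
    · obtain rfl : i = 1 := by
        by_contra hi1
        rcases Nat.lt_or_ge 2 i with h1 | h1
        · have := h.1 1 i (by omega) hi; omega
        · interval_cases i <;> omega
      constructor
      · rintro (rfl | rfl)
        · exact ⟨mz 0 (by omega), .inr a01⟩
        · exact ⟨mz 2 (by omega), .inr a12⟩
      · rintro ⟨hy, ha⟩
        rcases mem_WW.1 hy with ⟨j, hj, rfl⟩ | hy
        · have := (h.adj (by omega) hj).1 ha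
          obtain rfl | rfl : j = 0 ∨ j = 2 := by omega
          · exact .inl rfl
          · exact .inr rfl
        · rw [Finset.mem_singleton.1 hy] at ha; exact absurd ha (hN 1 (by omega) (by omega) (by omega))
    · rw [Finset.mem_singleton.1 hw]
      constructor
      · rintro (rfl | rfl)
        · exact ⟨mz 0 (by omega), .inr hx0⟩
        · exact ⟨mz 2 (by omega), .inr hx2⟩
      · rintro ⟨hy, ha⟩
        rcases mem_WW.1 hy with ⟨j, hj, rfl⟩ | hy
        · by_contra hc
          push Not at hc
          exact hN j hj (by rintro rfl; exact hc.1 rfl) (by rintro rfl; exact hc.2 rfl) ha.symm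
        · rw [Finset.mem_singleton.1 hy] at ha; simp [Adj] at ha

theorem WW_nice {α : Type} {p v : α → ℤ} {e z L} (h : Std p v e z L) : ND p v (WW z L ∅) ∧ NC p v (WW z L ∅) := by
  classical
  have mz : ∀ y ∈ WW z L ∅, ∃ j ≤ L, z j = y := fun y hy => by simpa using mem_WW.1 hy
  constructor
  · intro x hx
    obtain ⟨i, hi, rfl⟩ := mz x hx
    have hs : (WW z L ∅).filter (Adj p v (z i)) ⊆ {z (i-1), z (i+1)} := by
      intro y hy
      rw [Finset.mem_filter] at hy
      obtain ⟨j, hj, rfl⟩ := mz y hy.1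
      have := (h.adj hi hj).1 hy.2
      simp only [Finset.mem_insert, Finset.mem_singleton]
      obtain rfl | rfl : j = i - 1 ∨ j = i + 1 := by omega
      · exact .inl rfl
      · exact .inr rfl
    exact (Finset.card_le_card hs).trans Finset.card_le_two
  · intro x hx y hy w hw h1 h2 h3 h4
    obtain ⟨i, hi, rfl⟩ := mz x hx
    obtain ⟨j, hj, rfl⟩ := mz y hy
    obtain ⟨k, hk, rfl⟩ := mz w hw
    have e1 := (h.adj hi hj).1 (.inl ⟨h1, h2⟩)
    have e2 := (h.adj hj hk).1 (.inl ⟨h3, h4⟩)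
    have e3 := (h.adj hi hk).1 (.inl ⟨by omega, by omega⟩)
    omega

def Chn {α : Type} (p v : α → ℤ) : Prop := ∀ x y w : α, p x < p y → v y < v x → p y < p w → v w < v y → False
theorem Chn.swap {α : Type} {p v : α → ℤ} (h : Chn p v) : Chn v p := fun x y w a b c d => h w y x d c b a
theorem Chn.ng {α : Type} {p v : α → ℤ} (h : Chn p v) : Chn (ng p) (ng v) := fun x y w a b c d => by
  simp only [_root_.ng] at a b c d; exact h w y x (by omega) (by omega) (by omega) (by omega)

theorem Std.norm {α : Type} {p v : α → ℤ} {e z L} (h : Std p v e z L) : Std p v 0 z L ∨ Std v p 0 z L := by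
  rcases Nat.mod_two_eq_zero_or_one e with he | he
  · exact .inl (h.par he)
  · exact .inr (h.swap.par (by omega))

theorem fork0 {α : Type} {p v : α → ℤ} {z L} (hC : Chn p v) (h : Std p v 0 z L) (hL : 2 ≤ L) {X : Finset α}
    (hX : ∀ x ∈ X, Adj p v (z 1) x ∧ (∀ i ≤ L, i ≠ 1 → ¬ Adj p v (z i) x) ∧ ∀ i ≤ L, z i ≠ x) :
    PR p v (WW z L X) (2 + X.card) := by
  have a01 := h.2.1 0 (by omega) rfl
  norm_num at a01
  have U : ∀ x ∈ X, (p x < p (z 1) ∧ v (z 1) < v x) := fun x hx => by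
    rcases (hX x hx).1 with h1 | h1
    · exact (hC _ _ _ a01.1 a01.2 h1.1 h1.2).elim
    · exact h1
  refine ⟨1, _, WW_fork h hL fun x hx => ⟨U x hx, (hX x hx).2.1, fun y hy ha => ?_, (hX x hx).2.2⟩, one_mul _⟩
  rcases ha with ha | ha
  · exact hC _ _ _ ha.1 ha.2 (U y hy).1 (U y hy).2
  · exact hC _ _ _ ha.1 ha.2 (U x hx).1 (U x hx).2

theorem fork1 {α : Type} {p v : α → ℤ} {e z L} (hC : Chn p v) (h : Std p v e z L) (hL : 2 ≤ L) {X : Finset α}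
    (hX : ∀ x ∈ X, Adj p v (z 1) x ∧ (∀ i ≤ L, i ≠ 1 → ¬ Adj p v (z i) x) ∧ ∀ i ≤ L, z i ≠ x) :
    PR p v (WW z L X) (2 + X.card) := by
  rcases h.norm with h | h
  · exact fork0 hC h hL hX
  · rw [← Adj.swap] at hX
    exact (fork0 hC.swap h hL hX).swap

theorem deg0 {α : Type} {p v : α → ℤ} {z L} (hp : ∀ {x y}, p x = p y → x = y) (hv : ∀ {x y}, v x = v y → x = y)
    (hC : Chn p v) (h : Std p v 0 z L) {x : α} {i : ℕ} (hi : 2 ≤ i) (hiL : i < L)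
    (ha : Adj p v (z i) x) (hN : ∀ j ≤ L, j ≠ i → ¬ Adj p v (z j) x) (hne : ∀ j ≤ L, z j ≠ x) :
    PR p v (WW z L {x}) 2 ∧ ¬ ND p v (WW z L {x}) := by
  have a01 := h.2.1 0 (by omega) rfl
  have a12 := h.2.2 1 (by omega) rfl
  norm_num at a01 a12
  have n0 := hN 0 (by omega) (by omega)
  have n1 := hN 1 (by omega) (by omega)
  have q0 : p (z 0) ≠ p x := fun h => hne 0 (by omega) (hp h)
  have q1 : v (z 1) ≠ v x := fun h => hne 1 (by omega) (hv h)
  have q2 : v (z 0) ≠ v x := fun h => hne 0 (by omega) (hv h)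
  have q3 : p (z 1) ≠ p x := fun h => hne 1 (by omega) (hp h)
  have z0 := h.1 0 i hi (by omega)
  simp only [Adj] at n0 n1
  have h1 : v (z 1) < v x := by
    rcases Nat.lt_or_ge 2 i with h2 | h2
    · have := h.1 1 i (by omega) (by omega)
      simp only [Adj] at ha; omega
    · obtain rfl : i = 2 := by omega
      rcases ha with ha | ha
      · omega
      · exact (hC _ _ _ ha.1 ha.2 a12.1 a12.2).elim
  have := WW_deg h hi hiL ha hN (by simp only [Adj] at ha; omega) h1 hne
  exact ⟨⟨1, 2, this.1, rfl⟩, this.2⟩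

theorem deg1 {α : Type} {p v : α → ℤ} {e z L} (hp : ∀ {x y}, p x = p y → x = y) (hv : ∀ {x y}, v x = v y → x = y)
    (hC : Chn p v) (h : Std p v e z L) {x : α} {i : ℕ} (hi : 2 ≤ i) (hiL : i < L)
    (ha : Adj p v (z i) x) (hN : ∀ j ≤ L, j ≠ i → ¬ Adj p v (z j) x) (hne : ∀ j ≤ L, z j ≠ x) :
    PR p v (WW z L {x}) 2 ∧ ¬ ND p v (WW z L {x}) := by
  rcases h.norm with h | h
  · exact deg0 hp hv hC h hi hiL ha hN hne
  · rw [← Adj.swap] at ha hN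
    have := deg0 hv hp hC.swap h hi hiL ha hN hne
    exact ⟨this.1.swap, fun hh => this.2 hh.swap⟩

theorem cyc1 {α : Type} {p v : α → ℤ} {e z L} (hC : Chn p v) (h : Std p v e z L) (hL : 2 ≤ L) {x : α}
    (h0 : Adj p v (z 0) x) (h2 : Adj p v (z 2) x)
    (hN : ∀ j ≤ L, j ≠ 0 → j ≠ 2 → ¬ Adj p v (z j) x) (hne : ∀ j ≤ L, z j ≠ x) : PR p v (WW z L {x}) 4 := by
  have key : ∀ {p v : α → ℤ}, Chn p v → Std p v 0 z L → Adj p v (z 0) x → Adj p v (z 2) x →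
      (∀ j ≤ L, j ≠ 0 → j ≠ 2 → ¬ Adj p v (z j) x) → PR p v (WW z L {x}) 4 := by
    intro p v hC h h0 h2 hN
    have a01 := h.2.1 0 (by omega) rfl
    have a12 := h.2.2 1 (by omega) rfl
    norm_num at a01 a12
    refine ⟨2, 2, WW_cyc h hL ?_ ?_ hN hne, rfl⟩
    · rcases h0 with h0 | h0
      · exact h0
      · exact (hC _ _ _ h0.1 h0.2 a01.1 a01.2).elim
    · rcases h2 with h0 | h0
      · exact h0
      · exact (hC _ _ _ h0.1 h0.2 a12.1 a12.2).elim
  rcases h.norm with h | h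
  · exact key hC h h0 h2 hN
  · rw [← Adj.swap] at h0 h2 hN
    exact (key hC.swap h h0 h2 hN).swap

section
variable {α : Type} [Fintype α] {κ : ℕ → ℕ} {eqv : Finset α → Finset α → Prop} {p v : α → ℤ}

theorem Std.card_lt {e z T} (h : Std p v e z T) : T < Fintype.card α := by
  have := WW_card h (X := ∅) (by simp)
  have h2 := Finset.card_le_univ (WW z T ∅)
  rw [this] at h2; simp at h2; omega

theorem windows (G : Geo κ eqv p v) {z T m} (h : Std p v 0 z T) (hm : 3 ≤ m) (hT : m ≤ T) :
    ∃ A B : Finset α, (A.card = m ∧ Cnn (Adj p v) A) ∧ (B.card = m ∧ Cnn (Adj p v) B) ∧ ¬ eqv A B ∧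
      (ND p v A ∧ NC p v A ∧ PR p v A 2) ∧ (ND p v B ∧ NC p v B ∧ PR p v B 2) := by
  have hA := h.shift 0 (m-1) (by omega)
  have hB := h.shift 1 (m-1) (by omega)
  have lA := WW_fork hA (by omega) (X := ∅) (by simp)
  have lB := (WW_fork (hB.swap.par (e' := 0) (by omega)) (by omega) (X := ∅) (by simp)).swap
  refine ⟨_, _, ⟨by rw [WW_card hA (X := ∅) (by simp)]; simp; omega, WW_con hA (X := ∅) (by simp)⟩,
    ⟨by rw [WW_card hB (X := ∅) (by simp)]; simp; omega, WW_con hB (X := ∅) (by simp)⟩, fun e => ?_, ?_, ?_⟩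
  · have := (G.LB e lA lB).1; simp at this
  · exact ⟨(WW_nice hA).1, (WW_nice hA).2, _, _, lA, by simp⟩
  · exact ⟨(WW_nice hB).1, (WW_nice hB).2, _, _, lB, by simp⟩

theorem noChain (G : Geo κ eqv p v) {z T} (h : Std p v 0 z T) (hT : 10 ≤ T)
    (hκ : ∃ m < 6, κ m < if m = 0 then 0 else if m ≤ 2 then 1 else 3) : Chn p v := by
  classical
  intro x y w h1 h2 h3 h4
  have hc := h.card_lt
  obtain ⟨m, hm, hκ⟩ := hκ
  rcases Nat.lt_or_ge m 3 with h5 | h5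
  · have hm0 : m ≠ 0 := by rintro rfl; simp at hκ
    rw [if_neg hm0, if_pos (by omega)] at hκ
    have hA := h.shift 0 (m-1) (by omega)
    have := G.cnt (m := m) (by omega) [WW (fun i => z (0 + i)) (m-1) ∅] (by simp) (by
      simp only [List.mem_singleton, forall_eq]
      exact ⟨by rw [WW_card hA (X := ∅) (by simp)]; simp; omega, WW_con hA (X := ∅) (by simp)⟩)
    simp at this; omega
  · rw [if_neg (by omega), if_neg (by omega)] at hκ
    obtain ⟨A, B, hA, hB, hAB, nA, nB⟩ := windows G h h5 (by omega)
    have c0 : Cnn (Adj p v) (insert w (insert y {x})) := by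
      refine ((con_single x).ins (fun _ _ h => h.symm) (Finset.mem_singleton_self x) (x := y) (.inl ⟨h1, h2⟩)).ins
        (fun _ _ h => h.symm) (Finset.mem_insert_self y _) (.inl ⟨h3, h4⟩)
    obtain ⟨C, hC1, hC2, hC3⟩ := Cnn.grow (fun _ _ h => h.symm) G.con c0 m (Finset.card_le_three.trans h5) (by omega)
    have nC : ¬ NC p v C := fun hh => hh x (hC1 (by simp)) y (hC1 (by simp)) w (hC1 (by simp)) h1 h2 h3 h4
    have := G.cnt (m := m) (by omega) [A, B, C] (by
      simp only [List.pairwise_cons, List.mem_cons, List.not_mem_nil, or_false, forall_eq_or_imp, forall_eq]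
      refine ⟨⟨hAB, fun e => nC (G.NC e hA.2.1 nA.2.1)⟩, fun e => nC (G.NC e hB.2.1 nB.2.1), by simp⟩) (by
      simp only [List.mem_cons, List.not_mem_nil, or_false, forall_eq_or_imp, forall_eq]
      exact ⟨hA, hB, hC2, hC3⟩)
    simp at this; omega

theorem m_ge (G : Geo κ eqv p v) {z T m} (h : Std p v 0 z T) (hT : 10 ≤ T) (hκ : κ m < PP m) : 4 ≤ m := by
  by_contra hm
  have hc := h.card_lt
  rcases Nat.lt_or_ge m 3 with h5 | h5
  · have hm0 : m ≠ 0 := by rintro rfl; simp [PP] at hκ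
    have hA := h.shift 0 (m-1) (by omega)
    have := G.cnt (m := m) (by omega) [WW (fun i => z (0 + i)) (m-1) ∅] (by simp) (by
      simp only [List.mem_singleton, forall_eq]
      exact ⟨by rw [WW_card hA (X := ∅) (by simp)]; simp; omega, WW_con hA (X := ∅) (by simp)⟩)
    have : PP m = 1 := by obtain rfl | rfl : m = 1 ∨ m = 2 := by omega
                          all_goals rfl
    simp at *; omega
  · obtain rfl : m = 3 := by omega
    obtain ⟨A, B, hA, hB, hAB, nA, nB⟩ := windows G h h5 (by omega)
    have := G.cnt (m := 3) (by omega) [A, B] (by simpa using hAB) (by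
      simp only [List.mem_cons, List.not_mem_nil, or_false, forall_eq_or_imp, forall_eq]
      exact ⟨hA, hB⟩)
    have : PP 3 = 2 := rfl
    simp at *; omega
end

theorem ng_ng {α : Type} (p : α → ℤ) : ng (ng p) = p := by funext x; simp [ng]

def Var {α : Type} (p v p' v' : α → ℤ) : Prop :=
  (p' = p ∧ v' = v) ∨ (p' = v ∧ v' = p) ∨ (p' = ng p ∧ v' = ng v) ∨ (p' = ng v ∧ v' = ng p)

theorem Var.trans {α : Type} {p v p' v' p'' v'' : α → ℤ} (h : Var p v p' v') (h' : Var p' v' p'' v'') : Var p v p'' v'' := by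
  rcases h with ⟨rfl, rfl⟩ | ⟨rfl, rfl⟩ | ⟨rfl, rfl⟩ | ⟨rfl, rfl⟩ <;>
  rcases h' with ⟨rfl, rfl⟩ | ⟨rfl, rfl⟩ | ⟨rfl, rfl⟩ | ⟨rfl, rfl⟩ <;> simp [Var, ng_ng]

theorem Var.adj {α : Type} {p v p' v' : α → ℤ} (h : Var p v p' v') : Adj p' v' = Adj p v := by
  rcases h with ⟨rfl, rfl⟩ | ⟨rfl, rfl⟩ | ⟨rfl, rfl⟩ | ⟨rfl, rfl⟩
  · rfl
  · exact Adj.swap _ _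
  · exact Adj.ng _ _
  · rw [Adj.ng, Adj.swap]

theorem Var.chn {α : Type} {p v p' v' : α → ℤ} (h : Var p v p' v') (g : Chn p v) : Chn p' v' := by
  rcases h with ⟨rfl, rfl⟩ | ⟨rfl, rfl⟩ | ⟨rfl, rfl⟩ | ⟨rfl, rfl⟩
  · exact g
  · exact g.swap
  · exact g.ng
  · exact g.swap.ng

section
variable {α : Type} [Fintype α] {κ : ℕ → ℕ} {eqv : Finset α → Finset α → Prop} {p v : α → ℤ}

theorem Var.geo {p' v' : α → ℤ} (h : Var p v p' v') (g : Geo κ eqv p v) : Geo κ eqv p' v' := by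
  rcases h with ⟨rfl, rfl⟩ | ⟨rfl, rfl⟩ | ⟨rfl, rfl⟩ | ⟨rfl, rfl⟩
  · exact g
  · exact g.swap
  · exact g.ng
  · exact g.swap.ng

structure Cx (κ : ℕ → ℕ) (eqv : Finset α → Finset α → Prop) (p v : α → ℤ) (m : ℕ) (z : ℕ → α) (T : ℕ) : Prop where
  G : Geo κ eqv p v
  S : Std p v 0 z T
  mx : ∀ z' T', IP (Adj p v) z' T' → T' ≤ T
  km : κ m < PP m
  m4 : 4 ≤ m
  mT : 4 * m + 20 ≤ T
  C : Chn p v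

variable {m : ℕ} {z : ℕ → α} {T : ℕ}

theorem Cx.rev (h : Cx κ eqv p v m z T) : ∃ p' v', Var p v p' v' ∧ Cx κ eqv p' v' m (fun i => z (T - i)) T := by
  have main : ∀ p' v', Var p v p' v' → Std p' v' 0 (fun i => z (T - i)) T → Cx κ eqv p' v' m (fun i => z (T - i)) T :=
    fun p' v' hv hs => ⟨hv.geo h.G, hs, by rw [hv.adj]; exact h.mx, h.km, h.m4, h.mT, hv.chn h.C⟩
  rcases h.S.rev.norm with hs | hs
  · exact ⟨_, _, .inr (.inr (.inl ⟨rfl, rfl⟩)), main _ _ (.inr (.inr (.inl ⟨rfl, rfl⟩))) hs⟩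
  · exact ⟨_, _, .inr (.inr (.inr ⟨rfl, rfl⟩)), main _ _ (.inr (.inr (.inr ⟨rfl, rfl⟩))) hs⟩

theorem Cx.three (h : Cx κ eqv p v m z T) {A : Finset α} (hA : A.card = m ∧ Cnn (Adj p v) A) {c} (hc : PR p v A c) (h2 : c ≠ 2) :
    5 ≤ m := by
  by_contra hm
  have hm4 := h.m4
  obtain rfl : m = 4 := by omega
  have := h.S.card_lt
  have := h.mT
  obtain ⟨W, W', w1, w2, w3, w4, w5⟩ := windows h.G h.S (m := 4) (by omega) (by omega)
  have := h.G.cnt (m := 4) (by omega) [W, W', A] (by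
    simp only [List.pairwise_cons, List.mem_cons, List.not_mem_nil, or_false, forall_eq_or_imp, forall_eq]
    exact ⟨⟨w3, fun e => h2 (h.G.PR e w4.2.2 hc).symm⟩, fun e => h2 (h.G.PR e w5.2.2 hc).symm, by simp⟩) (by
    simp only [List.mem_cons, List.not_mem_nil, or_false, forall_eq_or_imp, forall_eq]
    exact ⟨w1, w2, hA⟩)
  have hk := h.km
  have : PP 4 = 3 := rfl
  simp at *; omega

theorem Cx.four (h : Cx κ eqv p v m z T) {A B : Finset α} (hA : A.card = m ∧ Cnn (Adj p v) A) {c} (hc : PR p v A c) (h2 : c ≠ 2)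
    (hB : B.card = m ∧ Cnn (Adj p v) B) {c'} (hc' : PR p v B c') (h3 : c ≠ c') (h4 : c' ≠ 2 ∨ ¬ ND p v B) : False := by
  have hm4 := h.m4
  have := h.S.card_lt
  have := h.mT
  obtain ⟨W, W', w1, w2, w3, w4, w5⟩ := windows h.G h.S (m := m) (by omega) (by omega)
  have := h.G.cnt (m := m) (by omega) [W, W', A, B] (by
    simp only [List.pairwise_cons, List.mem_cons, List.not_mem_nil, or_false, forall_eq_or_imp, forall_eq]
    refine ⟨⟨w3, fun e => h2 (h.G.PR e w4.2.2 hc).symm, fun e => ?_⟩, ⟨fun e => h2 (h.G.PR e w5.2.2 hc).symm, fun e => ?_⟩,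
      fun e => h3 (h.G.PR e hc hc'), by simp⟩
    · rcases h4 with h4 | h4
      · exact h4 (h.G.PR e w4.2.2 hc').symm
      · exact h4 (h.G.ND e w1.2.1 w4.1)
    · rcases h4 with h4 | h4
      · exact h4 (h.G.PR e w5.2.2 hc').symm
      · exact h4 (h.G.ND e w2.2.1 w5.1)) (by
    simp only [List.mem_cons, List.not_mem_nil, or_false, forall_eq_or_imp, forall_eq]
    exact ⟨w1, w2, hA, hB⟩)
  have hk := h.km
  have : PP m ≤ 4 := by unfold PP; split_ifs <;> omega
  simp at *; omega

theorem Cx.par (h : Cx κ eqv p v m z T) {x i} (hi : i ≤ T) (ha : Adj p v (z i) x) :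
    (i % 2 = 0 → p (z i) < p x ∧ v x < v (z i)) ∧ (i % 2 = 1 → p x < p (z i) ∧ v (z i) < v x) := by
  have hT := h.mT
  have hw : ∃ w, (i % 2 = 0 → p (z i) < p w ∧ v w < v (z i)) ∧ (i % 2 = 1 → p w < p (z i) ∧ v (z i) < v w) := by
    rcases Nat.lt_or_ge i T with h1 | h1
    · exact ⟨z (i+1), h.S.2.1 i h1, h.S.2.2 i h1⟩
    · have a := h.S.2.1 (i-1) (by omega)
      have b := h.S.2.2 (i-1) (by omega)
      rw [show i - 1 + 1 = i by omega] at a b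
      exact ⟨z (i-1), fun e => b (by omega), fun e => a (by omega)⟩
  obtain ⟨w, w1, w2⟩ := hw
  refine ⟨fun e => ?_, fun e => ?_⟩
  · rcases ha with ha | ha
    · exact ha
    · exact (h.C _ _ _ ha.1 ha.2 (w1 e).1 (w1 e).2).elim
  · rcases ha with ha | ha
    · exact (h.C _ _ _ (w2 e).1 (w2 e).2 ha.1 ha.2).elim
    · exact ha

theorem Cx.par2 (h : Cx κ eqv p v m z T) {x i j} (hi : i ≤ T) (ha : Adj p v (z i) x) (hj : j ≤ T) (hb : Adj p v (z j) x) :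
    i % 2 = j % 2 := by
  by_contra hne
  rcases Nat.mod_two_eq_zero_or_one i with e | e
  · have a := (h.par hi ha).1 e
    have b := (h.par hj hb).2 (by omega)
    exact h.C _ _ _ a.1 a.2 b.1 b.2
  · have a := (h.par hi ha).2 e
    have b := (h.par hj hb).1 (by omega)
    exact h.C _ _ _ b.1 b.2 a.1 a.2

theorem Cx.conv (h : Cx κ eqv p v m z T) {x i j k} (ha : Adj p v (z i) x) (hj : j ≤ T) (hb : Adj p v (z j) x)
    (hik : i + 2 ≤ k) (hkj : k + 2 ≤ j) : Adj p v (z k) x := by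
  have a := h.par (by omega) ha
  have b := h.par hj hb
  have c := h.par2 (by omega) ha hj hb
  have d := h.S.1 i k hik (by omega)
  have e := h.S.1 k j hkj hj
  rcases Nat.mod_two_eq_zero_or_one i with o | o
  · left; have := a.1 o; have := b.1 (by omega); omega
  · right; have := a.2 o; have := b.2 (by omega); omega

theorem Cx.span (h : Cx κ eqv p v m z T) {x i j} (ha : Adj p v (z i) x) (hj : j ≤ T) (hb : Adj p v (z j) x) : j ≤ i + 4 := by
  by_contra hc
  have e1 := h.par2 (by omega) ha hj hb
  have := h.conv ha hj hb (k := i + 3) (by omega) (by omega)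
  have := h.par2 (by omega) ha (by omega) this
  omega

theorem Cx.sizes (h : Cx κ eqv p v m z T) (s : ℕ) (X : Finset α) (hX : ∀ x ∈ X, ∀ i ≤ T, z i ≠ x) (L : ℕ) (hL : L + 1 + X.card = m)
    (hs : s + L ≤ T) (hc : ∀ x ∈ X, ∃ i ≤ L, Adj p v (z (s + i)) x) :
    (WW (fun i => z (s + i)) L X).card = m ∧ Cnn (Adj p v) (WW (fun i => z (s + i)) L X) :=
  ⟨by rw [WW_card (h.S.shift s L hs) fun x hx i hi => hX x hx _ (by omega)]; exact hL, WW_con (h.S.shift s L hs) hc⟩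

theorem Cx.fork (h : Cx κ eqv p v m z T) {x} (hx : ∀ i ≤ T, z i ≠ x) {i} (hi : 1 ≤ i) (hiT : i + m ≤ T + 3) (ha : Adj p v (z i) x)
    (hN : ∀ j, j ≤ T → i - 1 ≤ j → j ≠ i → ¬ Adj p v (z j) x) :
    ∃ A : Finset α, (A.card = m ∧ Cnn (Adj p v) A) ∧ PR p v A 3 := by
  have := h.m4
  have hs := h.S.shift (i-1) (m-2) (by omega)
  refine ⟨WW (fun j => z (i - 1 + j)) (m-2) {x}, h.sizes _ _ (by simpa using hx) _ (by simp; omega) (by omega) ?_, 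
    fork1 h.C hs (by omega) (X := {x}) ?_⟩
  · simp only [Finset.mem_singleton, forall_eq]
    exact ⟨1, by omega, by rwa [show i - 1 + 1 = i by omega]⟩
  · simp only [Finset.mem_singleton, forall_eq]
    exact ⟨by rwa [show i - 1 + 1 = i by omega], fun j hj h1 => hN _ (by omega) (by omega) (by omega), fun j hj => hx _ (by omega)⟩

theorem Cx.deg (h : Cx κ eqv p v m z T) {x} (hx : ∀ i ≤ T, z i ≠ x) (s i : ℕ) (hi : s + 2 ≤ i) (hi2 : i + 3 ≤ s + m) (hsT : s + m ≤ T + 2)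
    (ha : ∀ j ≤ T, (Adj p v (z j) x ↔ j = i)) :
    ∃ A : Finset α, (A.card = m ∧ Cnn (Adj p v) A) ∧ PR p v A 2 ∧ ¬ ND p v A := by
  have hs := h.S.shift s (m-2) (by omega)
  have hai := (ha i (by omega)).2 rfl
  refine ⟨WW (fun j => z (s + j)) (m-2) {x}, h.sizes _ _ (by simpa using hx) _ (by simp; omega) (by omega) ?_,
    deg1 h.G.pinj h.G.vinj h.C hs (i := i - s) (by omega) (by omega) ?_ ?_ ?_⟩
  · simp only [Finset.mem_singleton, forall_eq]
    exact ⟨i - s, by omega, by rwa [show s + (i - s) = i by omega]⟩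
  · rwa [show s + (i - s) = i by omega]
  · exact fun j hj h1 h2 => by have := (ha _ (by omega)).1 h2; omega
  · exact fun j hj => hx _ (by omega)

theorem Cx.A (h : Cx κ eqv p v m z T) {x} (hx : ∀ i ≤ T, z i ≠ x) {j} (hj : 2 ≤ j) (hjT : j + m ≤ T) (ha : Adj p v (z j) x)
    (hb : Adj p v (z (j-2)) x) (hmax : ∀ k, k ≤ T → j < k → ¬ Adj p v (z k) x) : False := by
  have hm := h.m4
  have hN : ∀ k, k ≤ T → j - 1 ≤ k → k ≠ j → ¬ Adj p v (z k) x := by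
    intro k hk h1 h2 h3
    rcases Nat.lt_or_ge j k with h4 | h4
    · exact hmax k hk h4 h3
    · have := h.par2 hk h3 (by omega) ha; omega
  obtain ⟨A, hA, hA'⟩ := h.fork hx (by omega) (by omega) ha hN
  have hs := h.S.shift (j-2) (m-2) (by omega)
  refine h.four hA hA' (by omega) (h.sizes (j-2) {x} (by simpa using hx) (m-2) (by simp; omega) (by omega) ?_) 
    (cyc1 h.C hs (by omega) hb ?_ ?_ ?_) (by omega) (.inl (by omega))
  · simp only [Finset.mem_singleton, forall_eq]; exact ⟨0, by omega, hb⟩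
  · rwa [show j - 2 + 2 = j by omega]
  · exact fun k hk h1 h2 => hN _ (by omega) (by omega) (by omega)
  · exact fun k hk => hx _ (by omega)

theorem Cx.B (h : Cx κ eqv p v m z T) {x} (hx : ∀ i ≤ T, z i ≠ x) {i} (hi : 2 ≤ i) (hiT : i + m ≤ T)
    (ha : ∀ j ≤ T, (Adj p v (z j) x ↔ j = i)) : False := by
  obtain ⟨A, hA, hA'⟩ := h.fork hx (by omega) (by omega) ((ha i (by omega)).2 rfl) (fun j hj h1 h2 h3 => h2 ((ha j hj).1 h3))
  have := h.three hA hA' (by omega)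
  obtain ⟨B, hB, hB'⟩ := h.deg hx (i-2) i (by omega) (by omega) (by omega) ha
  exact h.four hA hA' (by omega) hB hB'.1 (by omega) (.inr hB'.2)

theorem Cx.not0 (h : Cx κ eqv p v m z T) {x} (hx : ∀ i ≤ T, z i ≠ x) (ha : ∀ j ≤ T, (Adj p v (z j) x ↔ j = 0)) : False := by
  have := h.mx (fun i => if i = 0 then x else z (i-1)) (T+1) ⟨fun i hi => ?_, fun i j hij hj => ?_⟩
  · omega
  · rcases Nat.eq_zero_or_pos i with rfl | h0
    · simpa using ((ha 0 (by omega)).2 rfl).symm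
    · simp only [if_neg (show i ≠ 0 by omega), if_neg (show i + 1 ≠ 0 by omega)]
      exact (h.S.adj (by omega) (by omega)).2 (by omega)
  · simp only [if_neg (show j ≠ 0 by omega)]
    split_ifs with h0
    · exact ⟨fun hh => by have := (ha _ (by omega)).1 hh.symm; omega, (hx _ (by omega)).symm⟩
    · exact ⟨fun hh => by have := (h.S.adj (by omega) (by omega)).1 hh; omega,
        fun hh => by have := h.S.inj (by omega) (by omega) hh; omega⟩

theorem Cx.N (h : Cx κ eqv p v m z T) {x} (hx : ∀ i ≤ T, z i ≠ x) {i0} (hi0 : i0 ≤ T) (h0 : Adj p v (z i0) x) :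
    (∀ j ≤ T, (Adj p v (z j) x ↔ j = 1)) ∨ ∀ j ≤ T, (Adj p v (z j) x ↔ j = T - 1) := by
  classical
  have hT := h.mT
  have hm := h.m4
  obtain ⟨p', v', hV, h'⟩ := h.rev
  have hx' : ∀ i ≤ T, z (T - i) ≠ x := fun i hi => hx _ (by omega)
  have ex : ∃ i, i ≤ T ∧ Adj p v (z i) x := ⟨i0, hi0, h0⟩
  obtain ⟨hiT, hiA⟩ := Nat.find_spec ex
  have hmin : ∀ k < Nat.find ex, k ≤ T → ¬ Adj p v (z k) x := fun k hk hkT ha => Nat.find_min ex hk ⟨hkT, ha⟩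
  set i := Nat.find ex
  have hgr := Nat.findGreatest_spec (P := fun k => Adj p v (z k) x) hi0 h0
  have hmax : ∀ k, Nat.findGreatest (fun k => Adj p v (z k) x) T < k → k ≤ T → ¬ Adj p v (z k) x :=
    fun k h1 h2 => Nat.findGreatest_is_greatest h1 h2
  have hjT := Nat.findGreatest_le (P := fun k => Adj p v (z k) x) T
  set j := Nat.findGreatest (fun k => Adj p v (z k) x) T
  have hij : i ≤ j := by by_contra hc; exact hmax i (by omega) hiT hiA
  rcases Nat.eq_or_lt_of_le hij with e | hlt
  · have ha : ∀ k ≤ T, (Adj p v (z k) x ↔ k = i) := by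
      intro k hk
      constructor
      · intro hh
        by_contra hne
        rcases Nat.lt_or_ge k i with h1 | h1
        · exact hmin k h1 hk hh
        · exact hmax k (by omega) hk hh
      · rintro hki; rw [hki]; exact hiA
    have ha' : ∀ k ≤ T, (Adj p' v' (z (T - k)) x ↔ k = T - i) := by
      intro k hk; rw [hV.adj, ha _ (by omega)]; omega
    by_cases e1 : i = 1
    · rw [e1] at ha; exact .inl ha
    by_cases e2 : i = T - 1
    · rw [e2] at ha; exact .inr ha
    exfalso
    by_cases e3 : i = 0
    · rw [e3] at ha; exact h.not0 hx ha
    by_cases e4 : i = T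
    · exact h'.not0 hx' (fun k hk => by rw [ha' k hk]; omega)
    rcases Nat.lt_or_ge T (i + m) with h1 | h1
    · exact h'.B hx' (i := T - i) (by omega) (by omega) ha'
    · exact h.B hx (by omega) h1 ha
  · exfalso
    have e1 := h.par2 hiT hiA hjT hgr
    have e2 := h.span hiA hjT hgr
    rcases Nat.lt_or_ge T (j + m) with h1 | h1
    · refine h'.A hx' (j := T - i) (by omega) (by omega) ?_ ?_ ?_
      · rw [hV.adj, show T - (T - i) = i by omega]; exact hiA
      · rw [hV.adj, show T - (T - i - 2) = i + 2 by omega]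
        rcases Nat.lt_or_ge (i + 2) j with h2 | h2
        · exact h.conv hiA hjT hgr (by omega) (by omega)
        · rw [show i + 2 = j by omega]; exact hgr
      · intro k hk h2; rw [hV.adj]; exact hmin _ (by omega) (by omega)
    · refine h.A hx (by omega) h1 hgr ?_ (fun k hk h2 => hmax k h2 hk)
      rcases Nat.lt_or_ge (i + 2) j with h2 | h2
      · exact h.conv hiA hjT hgr (by omega) (by omega)
      · rw [show j - 2 = i by omega]; exact hiA
end

def RR (k : Option Bool) (i j : ℕ) : Prop := match k with
  | none => i + 2 ≤ j ∨ (j = i + 1 ∧ i % 2 = 0) ∨ (i = j + 1 ∧ j % 2 = 1)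
  | some b => (i = 0 ∧ j = 1 ∧ b = true) ∨ (i = 0 ∧ 2 ≤ j) ∨ (j = 0 ∧ i = 1 ∧ b = false) ∨
      (1 ≤ i ∧ 1 ≤ j ∧ (i + 2 ≤ j ∨ (j = i + 1 ∧ i % 2 = 1) ∨ (i = j + 1 ∧ j % 2 = 0)))
def SS (k : Option Bool) (i j : ℕ) : Prop := match k with
  | none => i + 2 ≤ j ∨ (j = i + 1 ∧ i % 2 = 1) ∨ (i = j + 1 ∧ j % 2 = 0)
  | some b => (i = 0 ∧ j = 1 ∧ b = true) ∨ (i = 0 ∧ 3 ≤ j) ∨ (j = 0 ∧ i = 1 ∧ b = false) ∨ (j = 0 ∧ i = 2) ∨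
      (1 ≤ i ∧ 1 ≤ j ∧ (i + 2 ≤ j ∨ (j = i + 1 ∧ i % 2 = 0) ∨ (i = j + 1 ∧ j % 2 = 1)))

theorem RR_tot (k : Option Bool) {i j : ℕ} (h : i ≠ j) : RR k i j ∨ RR k j i := by
  rcases k with _ | b
  · simp only [RR]; grind
  · rcases b <;> simp only [RR] <;> grind
theorem SS_tot (k : Option Bool) {i j : ℕ} (h : i ≠ j) : SS k i j ∨ SS k j i := by
  rcases k with _ | b
  · simp only [SS]; grind
  · rcases b <;> simp only [SS] <;> grind (splits := 30)

def Enm {α : Type} (p v : α → ℤ) (k : Option Bool) (y : ℕ → α) (N : ℕ) : Prop :=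
  (∀ x, ∃ i < N, y i = x) ∧ ∀ i < N, ∀ j < N, (RR k i j → p (y i) < p (y j)) ∧ (SS k i j → v (y i) < v (y j))

theorem Enm.iff {α : Type} {p v : α → ℤ} {k y N} (h : Enm p v k y N) {i j} (hi : i < N) (hj : j < N) :
    (p (y i) < p (y j) → RR k i j) ∧ (v (y i) < v (y j) → SS k i j) := by
  have h1 := h.2 j hj i hi
  constructor
  · intro h2
    have hne : i ≠ j := by rintro rfl; omega
    rcases RR_tot k hne with h3 | h3
    · exact h3
    · have := h1.1 h3; omega
  · intro h2
    have hne : i ≠ j := by rintro rfl; omega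
    rcases SS_tot k hne with h3 | h3
    · exact h3
    · have := h1.2 h3; omega

theorem Enm.map {α α' : Type} {p v : α → ℤ} {p' v' : α' → ℤ} {k y N y' N'} (h : Enm p v k y N) (h' : Enm p' v' k y' N')
    (hN : N ≤ N') : ∃ f : α → α', ∀ a b, (p a < p b → p' (f a) < p' (f b)) ∧ (v a < v b → v' (f a) < v' (f b)) := by
  choose g hg1 hg2 using h.1
  refine ⟨fun x => y' (g x), fun a b => ?_⟩
  have e := h.iff (hg1 a) (hg1 b)
  have e' := h'.2 (g a) (by have := hg1 a; omega) (g b) (by have := hg1 b; omega)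
  rw [hg2, hg2] at e
  exact ⟨fun hh => e'.1 (e.1 hh), fun hh => e'.2 (e.2 hh)⟩

theorem mapPLe {β β' : Permu} (f : Fin β.1 → Fin β'.1)
    (h : ∀ a b, (pp β a < pp β b → pp β' (f a) < pp β' (f b)) ∧ (vv β a < vv β b → vv β' (f a) < vv β' (f b))) : PLe β β' := by
  refine PLe.of f (fun i j hij => ?_) (fun i j hij => ?_)
  · have := (h i j).1 (by simp only [pp]; rw [Fin.lt_def] at hij; omega)
    simp only [pp] at this; rw [Fin.lt_def]; omega
  · have := (h i j).2 (by simp only [vv]; rw [Fin.lt_def] at hij; omega)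
    simp only [vv] at this; rw [Fin.lt_def]; omega

def VP (c : Fin 4) (β : Permu) : Fin β.1 → ℤ := match c with
  | 0 => pp β | 1 => vv β | 2 => ng (pp β) | 3 => ng (vv β)
def VV (c : Fin 4) (β : Permu) : Fin β.1 → ℤ := match c with
  | 0 => vv β | 1 => pp β | 2 => ng (vv β) | 3 => ng (pp β)

theorem Enm.cmp {c : Fin 4} {β β' : Permu} {k y N y' N'} (h : Enm (VP c β) (VV c β) k y N)
    (h' : Enm (VP c β') (VV c β') k y' N') (hN : N ≤ N') : PLe β β' := by
  obtain ⟨f, hf⟩ := h.map h' hN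
  refine mapPLe f fun a b => ?_
  have h1 := hf a b
  have h2 := hf b a
  match c, h1, h2 with
  | 0, h1, h2 => exact h1
  | 1, h1, h2 => exact h1.symm
  | 2, h1, h2 => simp only [VP, VV, ng] at h2; constructor <;> intro <;> omega
  | 3, h1, h2 => simp only [VP, VV, ng] at h2; constructor <;> intro <;> omega

section
variable {α : Type} [Fintype α] {κ : ℕ → ℕ} {eqv : Finset α → Finset α → Prop} {p v : α → ℤ}
variable {m : ℕ} {z : ℕ → α} {T : ℕ}

theorem Cx.one (h : Cx κ eqv p v m z T) {x} (hx : ∀ i ≤ T, z i ≠ x) (ha : ∀ j ≤ T, (Adj p v (z j) x ↔ j = 1)) (w : α) :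
    w = x ∨ ∃ i ≤ T, z i = w := by
  classical
  have hT := h.mT
  obtain ⟨A, hA, hA'⟩ := h.fork hx (i := 1) (by omega) (by omega) ((ha 1 (by omega)).2 rfl)
    (fun j hj h1 h2 h3 => h2 ((ha j hj).1 h3))
  have hm := h.three hA hA' (by omega)
  have far : ∀ w, w ≠ x → (∀ i ≤ T, z i ≠ w) → ∀ i ≤ T, ¬ Adj p v (z i) w := by
    intro w hwx hw i hi haw
    rcases h.N hw hi haw with h1 | h1
    · have hs := h.S.shift 0 (m-3) (by omega)
      have hz := h.sizes 0 {x, w} (by simpa using ⟨hx, hw⟩) (m-3) (by rw [Finset.card_pair hwx.symm]; omega) (by omega) (by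
        simp only [Finset.mem_insert, Finset.mem_singleton, forall_eq_or_imp, forall_eq]
        exact ⟨⟨1, by omega, (ha _ (by omega)).2 rfl⟩, ⟨1, by omega, (h1 _ (by omega)).2 rfl⟩⟩)
      have hf := fork1 h.C hs (by omega) (X := {x, w}) (by
        simp only [Finset.mem_insert, Finset.mem_singleton, forall_eq_or_imp, forall_eq, zero_add]
        exact ⟨⟨(ha _ (by omega)).2 rfl, fun i hi hi1 hh => hi1 ((ha i (by omega)).1 hh), fun i hi => hx i (by omega)⟩,
          ⟨(h1 _ (by omega)).2 rfl, fun i hi hi1 hh => hi1 ((h1 i (by omega)).1 hh), fun i hi => hw i (by omega)⟩⟩)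
      rw [Finset.card_pair hwx.symm] at hf
      exact h.four hA hA' (by omega) hz hf (by omega) (.inl (by omega))
    · obtain ⟨B, hB, hB'⟩ := h.deg hw (T - m + 2) (T-1) (by omega) (by omega) (by omega) h1
      exact h.four hA hA' (by omega) hB hB'.1 (by omega) (.inr hB'.2)
  by_contra hc
  push Not at hc
  have hex : WW z T {x} ≠ Finset.univ := fun he => by
    rcases mem_WW.1 (he ▸ Finset.mem_univ w) with ⟨i, hi, e⟩ | e
    · exact hc.2 i hi e
    · exact hc.1 (Finset.mem_singleton.1 e)
  obtain ⟨a, haS, y, -, hy, hay⟩ := h.G.con.2 (WW z T {x}) (Finset.subset_univ _) ⟨x, mem_WW.2 (.inr (by simp))⟩ hex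
  have hyx : y ≠ x := by rintro rfl; exact hy (mem_WW.2 (.inr (by simp)))
  have hyz : ∀ i ≤ T, z i ≠ y := fun i hi e => hy (mem_WW.2 (.inl ⟨i, hi, e⟩))
  have hf := far y hyx hyz
  rcases mem_WW.1 haS with ⟨i, hi, rfl⟩ | e
  · exact hf i hi hay
  obtain rfl := Finset.mem_singleton.1 e
  have := h.mx (fun i => if i = 0 then y else if i = 1 then a else z (i-1)) (T+1) ⟨fun i hi => ?_, fun i j hij hj => ?_⟩
  · omega
  · rcases Nat.eq_zero_or_pos i with rfl | h0
    · simpa using hay.symm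
    rcases Nat.lt_or_ge 1 i with h1 | h1
    · simp only [if_neg (show i ≠ 0 by omega), if_neg (show i + 1 ≠ 0 by omega), if_neg (show i ≠ 1 by omega), if_neg (show i + 1 ≠ 1 by omega)]
      exact (h.S.adj (by omega) (by omega)).2 (by omega)
    · obtain rfl : i = 1 := by omega
      simpa using ((ha 1 (by omega)).2 rfl).symm
  · simp only [if_neg (show j ≠ 0 by omega), if_neg (show j ≠ 1 by omega)]
    split_ifs with h0 h1
    · exact ⟨fun hh => hf _ (by omega) hh.symm, (hyz _ (by omega)).symm⟩
    · exact ⟨fun hh => by have := (ha _ (by omega)).1 hh.symm; omega, (hx _ (by omega)).symm⟩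
    · exact ⟨fun hh => by have := (h.S.adj (by omega) (by omega)).1 hh; omega,
        fun hh => by have := h.S.inj (by omega) (by omega) hh; omega⟩

theorem Cx.enm1 (h : Cx κ eqv p v m z T) {x} (hx : ∀ i ≤ T, z i ≠ x) (ha : ∀ j ≤ T, (Adj p v (z j) x ↔ j = 1)) :
    ∃ k y N, Enm p v k y N := by
  have hT := h.mT
  have q1 : ∀ j ≤ T, p (z j) ≠ p x := fun j hj e => hx j hj (h.G.pinj e)
  have q2 : ∀ j ≤ T, v (z j) ≠ v x := fun j hj e => hx j hj (h.G.vinj e)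
  have n : ∀ j ≤ T, j ≠ 1 → (p (z j) < p x ∧ v (z j) < v x) ∨ (p x < p (z j) ∧ v x < v (z j)) := fun j hj h1 => by
    have := q1 j hj; have := q2 j hj; have : ¬ Adj p v (z j) x := fun hh => h1 ((ha j hj).1 hh)
    simp only [Adj] at this; omega
  have u1 := (h.par (by omega) ((ha 1 (by omega)).2 rfl)).2 rfl
  have big : ∀ j, 2 ≤ j → j ≤ T → p x < p (z j) ∧ v x < v (z j) := by
    intro j hj hjT
    have nj := n j hjT (by omega)
    rcases Nat.lt_or_ge 2 j with h2 | h2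
    · have := h.S.1 1 j (by omega) hjT; omega
    · obtain rfl : j = 2 := by omega
      have n3 := n 3 (by omega) (by omega)
      have a := h.S.2.1 2 (by omega) rfl
      have b := h.S.1 1 3 (by omega) (by omega)
      norm_num at a; omega
  have n0 := n 0 (by omega) (by omega)
  let b : Bool := decide (p x < p (z 0))
  have hbt : b = true → p x < p (z 0) ∧ v x < v (z 0) := fun hb => by have := of_decide_eq_true hb; omega
  have hbf : b = false → p (z 0) < p x ∧ v (z 0) < v x := fun hb => by have := of_decide_eq_false hb; omega
  obtain ⟨s1, s2, s3⟩ := h.S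
  refine ⟨some b, fun i => if i = 0 then x else z (i-1), T+2, fun w => ?_, fun i hi j hj => ?_⟩
  · rcases h.one hx ha w with rfl | ⟨i, hi, rfl⟩
    · exact ⟨0, by omega, rfl⟩
    · exact ⟨i+1, by omega, by simp⟩
  · rcases i with _ | i <;> rcases j with _ | j
    · simp [RR, SS]
    · simp only [RR, SS, if_pos, if_neg (Nat.succ_ne_zero j), Nat.add_sub_cancel]
      constructor
      · rintro (⟨-, e, hb⟩ | ⟨-, e⟩ | e | e)
        · obtain rfl : j = 0 := by omega
          exact (hbt hb).1
        · rcases Nat.lt_or_ge 1 j with h1 | h1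
          · exact (big j h1 (by omega)).1
          · rw [show j = 1 by omega]; exact u1.1
        · omega
        · omega
      · rintro (⟨-, e, hb⟩ | ⟨-, e⟩ | e | e | e)
        · obtain rfl : j = 0 := by omega
          exact (hbt hb).2
        · exact (big j (by omega) (by omega)).2
        all_goals omega
    · simp only [RR, SS, if_pos, if_neg (Nat.succ_ne_zero i), Nat.add_sub_cancel]
      constructor
      · rintro (e | e | ⟨-, e, hb⟩ | e)
        · omega
        · omega
        · obtain rfl : i = 0 := by omega
          exact (hbf hb).1
        · omega
      · rintro (e | e | ⟨-, e, hb⟩ | e | e)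
        · omega
        · omega
        · obtain rfl : i = 0 := by omega
          exact (hbf hb).2
        · rw [show i = 1 by omega]; exact u1.2
        · omega
    · simp only [RR, SS, if_neg (Nat.succ_ne_zero i), if_neg (Nat.succ_ne_zero j), Nat.add_sub_cancel]
      constructor
      · rintro (e | e | e | ⟨-, -, e | ⟨e, e'⟩ | ⟨e, e'⟩⟩)
        · omega
        · omega
        · omega
        · exact (s1 i j (by omega) (by omega)).1
        · obtain rfl : j = i + 1 := by omega
          exact (s2 i (by omega) (by omega)).1
        · obtain rfl : i = j + 1 := by omega
          exact (s3 j (by omega) (by omega)).1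
      · rintro (e | e | e | e | ⟨-, -, e | ⟨e, e'⟩ | ⟨e, e'⟩⟩)
        · omega
        · omega
        · omega
        · omega
        · exact (s1 i j (by omega) (by omega)).2
        · obtain rfl : j = i + 1 := by omega
          exact (s3 i (by omega) (by omega)).2
        · obtain rfl : i = j + 1 := by omega
          exact (s2 j (by omega) (by omega)).2

theorem Cx.enm0 (h : Cx κ eqv p v m z T) (hz : ∀ x, ∃ i ≤ T, z i = x) : ∃ k y N, Enm p v k y N := by
  obtain ⟨s1, s2, s3⟩ := h.S
  refine ⟨none, z, T+1, fun w => ?_, fun i hi j hj => ?_⟩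
  · obtain ⟨i, hi, e⟩ := hz w; exact ⟨i, by omega, e⟩
  · simp only [RR, SS]
    constructor
    · rintro (e | ⟨rfl, e'⟩ | ⟨rfl, e'⟩)
      · exact (s1 i j e (by omega)).1
      · exact (s2 i (by omega) (by omega)).1
      · exact (s3 j (by omega) (by omega)).1
    · rintro (e | ⟨rfl, e'⟩ | ⟨rfl, e'⟩)
      · exact (s1 i j e (by omega)).2
      · exact (s3 i (by omega) (by omega)).2
      · exact (s2 j (by omega) (by omega)).2

theorem Cx.fin (h : Cx κ eqv p v m z T) : ∃ p' v', Var p v p' v' ∧ ∃ k y N, Enm p' v' k y N := by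
  classical
  by_cases hz : ∀ x, ∃ i ≤ T, z i = x
  · exact ⟨p, v, .inl ⟨rfl, rfl⟩, h.enm0 hz⟩
  push Not at hz
  obtain ⟨w, hw⟩ := hz
  obtain ⟨a, haS, x, -, hy, hay⟩ := h.G.con.2 (WW z T ∅) (Finset.subset_univ _) ⟨z 0, mem_WW.2 (.inl ⟨0, by omega, rfl⟩)⟩
    (fun he => by
      rcases mem_WW.1 (he ▸ Finset.mem_univ w) with ⟨i, hi, e⟩ | e
      · exact hw i hi e
      · simp at e)
  have hx : ∀ i ≤ T, z i ≠ x := fun i hi e => hy (mem_WW.2 (.inl ⟨i, hi, e⟩))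
  rcases mem_WW.1 haS with ⟨i, hi, rfl⟩ | e
  swap
  · simp at e
  rcases h.N hx hi hay with h1 | h1
  · exact ⟨p, v, .inl ⟨rfl, rfl⟩, h.enm1 hx h1⟩
  · obtain ⟨p', v', hV, h'⟩ := h.rev
    refine ⟨p', v', hV, h'.enm1 (x := x) (fun i hi => hx _ (by omega)) fun j hj => ?_⟩
    rw [hV.adj, h1 _ (by omega)]
    have := h.mT
    omega
end

theorem IP.le {α : Type} [Fintype α] {p v : α → ℤ} {z T} (h : IP (Adj p v) z T) : T ≤ Fintype.card α := by
  have : Set.InjOn z (Finset.range (T+1) : Finset ℕ) := by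
    have key : ∀ i j, i < j → j ≤ T → z i ≠ z j := by
      intro i j hij hj e
      rcases Nat.lt_or_ge (i+1) j with h1 | h1
      · exact (h.2 i j h1 hj).2 e
      · obtain rfl : j = i + 1 := by omega
        have := h.1 i (by omega); rw [e] at this; simp [Adj] at this
    intro i hi j hj e
    simp at hi hj
    rcases lt_trichotomy i j with h1 | h1 | h1
    · exact absurd e (key i j h1 (by omega))
    · exact h1
    · exact absurd e.symm (key j i h1 (by omega))
  have := Finset.card_le_card_of_injOn z (s := Finset.range (T+1)) (t := Finset.univ) (by simp) this
  simp at this; omega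

theorem Thin.basis {E} (hE : Thin E) : {β | Bas E β}.Finite := by
  classical
  obtain ⟨m, hm⟩ := hE.noP
  obtain ⟨k, hk⟩ := hE.free
  have hv := hE.vec (fun m => if m = 0 then 0 else if m ≤ 2 then 1 else 3) 6 (by simp) (by
    simp [Finset.sum_range_succ]; norm_num)
  set T0 := 4 * m + 20 with hT0
  obtain ⟨b, hb⟩ := many_breaks k (k * T0 + k + 2)
  have anti : ∀ x, Bas E x → ∀ y, Bas E y → PLe x y → x = y := fun x hx y hy hxy => by
    by_contra hne; exact hx.1 (hy.2 x hxy hne)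
  have f1 : {β | Bas E β ∧ (brks β).card ≤ b}.Finite :=
    few_breaks b _ (fun x hx y hy => anti x hx.1 y hy.1) (fun x hx => hx.2)
  have f2 : {β : Permu | β.1 ≤ k}.Finite := by
    refine ((Set.finite_Iic k).biUnion fun n _ => pset_finite Set.univ n).subset fun β hβ => ?_
    simp only [Set.mem_iUnion]
    exact ⟨β.1, hβ, Set.mem_univ _, rfl⟩
  have f3 : (⋃ q : Fin 4 × Option Bool, {β | Bas E β ∧ ∃ y N, Enm (VP q.1 β) (VV q.1 β) q.2 y N}).Finite := by
    refine Set.finite_iUnion fun q => Set.Subsingleton.finite ?_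
    rintro β ⟨h1, y, N, h2⟩ β' ⟨h1', y', N', h2'⟩
    rcases le_total N N' with hN | hN
    · exact anti β h1 β' h1' (h2.cmp h2' hN)
    · exact (anti β' h1' β h1 (h2'.cmp h2 hN)).symm
  refine ((f1.union f2).union f3).subset fun β hβ => ?_
  by_contra hc
  simp only [Set.mem_union, not_or, Set.mem_setOf_eq, not_and, not_le] at hc
  obtain ⟨⟨c1, c2⟩, c3⟩ := hc
  have hF := hk β hβ c2
  obtain ⟨c, hc⟩ := hb β hF.1 hF.2 (c1 hβ)
  have G := Bas.geo hE hβ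
  obtain ⟨z1, T1, hT1, hz1⟩ := long_path (pp_inj β) (vv_inj β) G.con hF.1 hc (T0 := T0) le_rfl
  let P : ℕ → Prop := fun T => ∃ z, IP (Adj (pp β) (vv β)) z T
  have hP1 : P T1 := ⟨z1, hz1⟩
  have hP := Nat.findGreatest_spec (P := P) hz1.le hP1
  have hmx : ∀ z' T', IP (Adj (pp β) (vv β)) z' T' → T' ≤ Nat.findGreatest P (Fintype.card (Fin β.1)) := fun z' T' h' =>
    Nat.le_findGreatest h'.le ⟨z', h'⟩
  have hT2 := hmx z1 T1 hz1
  set T := Nat.findGreatest P (Fintype.card (Fin β.1))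
  obtain ⟨z, hz⟩ := hP
  have hstd : ∃ p' v', Var (pp β) (vv β) p' v' ∧ Std p' v' 0 z T := by
    have n02 := hz.2 0 2 (by omega) (by omega)
    have a01 := hz.1 0 (by omega)
    have e1 : pp β (z 0) ≠ pp β (z 2) := fun h => n02.2 (pp_inj β h)
    have e2 : vv β (z 0) ≠ vv β (z 2) := fun h => n02.2 (vv_inj β h)
    have n := n02.1
    norm_num at a01
    simp only [Adj] at n a01
    have main : ∀ p' v', Var (pp β) (vv β) p' v' → p' (z 0) < p' (z 2) → p' (z 0) < p' (z 1) →
        ∃ p' v', Var (pp β) (vv β) p' v' ∧ Std p' v' 0 z T := fun p' v' hV h1 h2 =>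
      ⟨p', v', hV, IP.std (hV.geo G).pinj (hV.geo G).vinj (by rw [hV.adj]; exact hz) h1 h2 (by omega)⟩
    rcases lt_or_gt_of_ne e1 with h1 | h1 <;> rcases a01 with a | a
    · exact main _ _ (.inl ⟨rfl, rfl⟩) h1 a.1
    · exact main _ _ (.inr (.inl ⟨rfl, rfl⟩)) (by omega) a.2
    · exact main _ _ (.inr (.inr (.inr ⟨rfl, rfl⟩))) (by simp only [ng]; omega) (by simp only [ng]; omega)
    · exact main _ _ (.inr (.inr (.inl ⟨rfl, rfl⟩))) (by simp only [ng]; omega) (by simp only [ng]; omega)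
  obtain ⟨p', v', hV, hS⟩ := hstd
  have G' := hV.geo G
  have cx : Cx (KK E) (fun A B => pat β A = pat β B) p' v' m z T :=
    ⟨G', hS, by rw [hV.adj]; exact hmx, hm, m_ge G' hS (by omega) hm, by omega, noChain G' hS (by omega) hv⟩
  obtain ⟨p'', v'', hV', e, y, N, hy⟩ := cx.fin
  apply c3
  rw [Set.mem_iUnion]
  rcases hV.trans hV' with ⟨rfl, rfl⟩ | ⟨rfl, rfl⟩ | ⟨rfl, rfl⟩ | ⟨rfl, rfl⟩
  · exact ⟨(0, e), hβ, y, N, hy⟩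
  · exact ⟨(1, e), hβ, y, N, hy⟩
  · exact ⟨(2, e), hβ, y, N, hy⟩
  · exact ⟨(3, e), hβ, y, N, hy⟩

def Smll (r : ℝ) (X : Set Permu) : Prop := ∃ ρ K : ℝ, 0 < ρ ∧ ρ < r ∧ 0 < K ∧ ∀ n, (pcount X n : ℝ) ≤ K * ρ ^ n

theorem small_of_ugr {r : ℝ} {X} (hr : 0 < r) (h : ugr X < (r : EReal)) : Smll r X := by
  obtain ⟨s, h1, h2⟩ := EReal.lt_iff_exists_real_btwn.1 h
  obtain ⟨t, ht1, ht2⟩ := exists_between (max_lt (EReal.coe_lt_coe_iff.1 h2) hr)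
  have ht0 : 0 < t := lt_of_le_of_lt (le_max_right _ _) ht1
  have hts : s < t := lt_of_le_of_lt (le_max_left _ _) ht1
  obtain ⟨K, hK, hb⟩ := ugr_lt_bound ht0 (h1.trans (by exact_mod_cast hts))
  exact ⟨t, K, ht0, ht2, hK, hb⟩

theorem Smll.ugr {r : ℝ} {X} (h : Smll r X) : ugr X < (r : EReal) := by
  obtain ⟨ρ, K, h1, h2, -, h3⟩ := h
  exact (ugr_le_of_bound h1 h3).trans_lt (by exact_mod_cast h2)

theorem Smll.mono {r : ℝ} {X Y} (h : Smll r X) (hY : Y ⊆ X) : Smll r Y := by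
  obtain ⟨ρ, K, h1, h2, hK, h3⟩ := h
  exact ⟨ρ, K, h1, h2, hK, fun n => le_trans (by exact_mod_cast pcount_mono hY n) (h3 n)⟩

theorem Smll.union {r : ℝ} {X Y} (hX : Smll r X) (hY : Smll r Y) : Smll r (X ∪ Y) := by
  obtain ⟨ρ, K, h1, h2, hK, h3⟩ := hX
  obtain ⟨ρ', K', h1', h2', hK', h3'⟩ := hY
  refine ⟨max ρ ρ', K + K', lt_max_of_lt_left h1, max_lt h2 h2', by positivity, fun n => ?_⟩
  have e1 : (pcount (X ∪ Y) n : ℝ) ≤ pcount X n + pcount Y n := by exact_mod_cast pcount_union X Y n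
  have e2 : ρ ^ n ≤ (max ρ ρ') ^ n := pow_le_pow_left₀ h1.le (le_max_left _ _) n
  have e3 : ρ' ^ n ≤ (max ρ ρ') ^ n := pow_le_pow_left₀ h1'.le (le_max_right _ _) n
  nlinarith [h3 n, h3' n]

theorem small_of_ev {r θ K : ℝ} {X} (q N : ℕ) (h0 : 0 < θ) (h1 : θ < r)
    (h : ∀ n ≥ N, (pcount X n : ℝ) ≤ K * ((n : ℝ) + 1) ^ q * θ ^ n) : Smll r X := by
  obtain ⟨ρ, hρ1, hρ2⟩ := exists_between h1
  have hρ : 0 < ρ := h0.trans hρ1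
  have h3 : Tendsto (fun n : ℕ => (n : ℝ) ^ q * (θ / ρ) ^ n) atTop (nhds 0) :=
    tendsto_pow_const_mul_const_pow_of_lt_one q (by positivity) ((div_lt_one hρ).2 hρ1)
  have h4 : ∀ᶠ n : ℕ in atTop, (n : ℝ) ^ q * (θ / ρ) ^ n < 1 := h3.eventually (gt_mem_nhds one_pos)
  obtain ⟨M, hM⟩ := eventually_atTop.1 h4
  let f : ℕ → ℝ := fun n => (pcount X n : ℝ) / ρ ^ n
  have hf : ∀ n, 0 ≤ f n := fun n => by positivity
  let T := M + N + 1
  have hS : 0 ≤ ∑ n ∈ Finset.range T, f n := Finset.sum_nonneg (fun i _ => hf i)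
  refine ⟨ρ, 1 + |K| * 2 ^ q + ∑ n ∈ Finset.range T, f n, hρ, hρ2, by positivity, fun n => ?_⟩
  have hsn : 0 < ρ ^ n := pow_pos hρ n
  have hKq : 0 ≤ |K| * 2 ^ q := by positivity
  rcases Nat.lt_or_ge n T with hn | hn
  · have h2 : f n ≤ ∑ n ∈ Finset.range T, f n :=
      Finset.single_le_sum (f := f) (fun i _ => hf i) (Finset.mem_range.2 hn)
    have h3 : (pcount X n : ℝ) = f n * ρ ^ n := by simp only [f]; field_simp
    rw [h3]
    exact mul_le_mul_of_nonneg_right (by linarith) hsn.le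
  · have hn' : (1 : ℝ) ≤ n := by exact_mod_cast (by omega : 1 ≤ n)
    have e1 : ((n : ℝ) + 1) ^ q ≤ 2 ^ q * (n : ℝ) ^ q := by
      rw [← mul_pow]; exact pow_le_pow_left₀ (by positivity) (by linarith) _
    have e2 : (n : ℝ) ^ q * θ ^ n ≤ ρ ^ n := by
      have := (hM n (by omega)).le
      rw [div_pow, ← mul_div_assoc, div_le_one hsn] at this
      exact this
    calc (pcount X n : ℝ) ≤ K * ((n : ℝ) + 1) ^ q * θ ^ n := h n (by omega)
      _ ≤ |K| * (2 ^ q * (n : ℝ) ^ q) * θ ^ n := by gcongr; exact le_abs_self K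
      _ = |K| * 2 ^ q * ((n : ℝ) ^ q * θ ^ n) := by ring
      _ ≤ |K| * 2 ^ q * ρ ^ n := by gcongr
      _ ≤ _ := by gcongr; linarith

theorem id_on {α : Type*} [LinearOrder α] {A : Finset α} {φ : α → α} (h1 : ∀ i ∈ A, φ i ∈ A)
    (h2 : ∀ i ∈ A, ∀ j ∈ A, i < j → φ i < φ j) : ∀ i ∈ A, φ i = i := by
  classical
  intro i hi
  by_contra hne
  rcases lt_or_gt_of_ne hne with h | h
  · have hn : (A.filter (fun i => φ i < i)).Nonempty := ⟨i, by simp [hi, h]⟩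
    have hm := Finset.min'_mem _ hn
    rw [Finset.mem_filter] at hm
    have := Finset.min'_le (A.filter (fun i => φ i < i)) (φ (Finset.min' _ hn))
      (by rw [Finset.mem_filter]; exact ⟨h1 _ hm.1, h2 _ (h1 _ hm.1) _ hm.1 hm.2⟩)
    exact absurd hm.2 (not_lt.2 this)
  · have hn : (A.filter (fun i => i < φ i)).Nonempty := ⟨i, by simp [hi, h]⟩
    have hm := Finset.max'_mem _ hn
    rw [Finset.mem_filter] at hm
    have := Finset.le_max' (A.filter (fun i => i < φ i)) (φ (Finset.max' _ hn))
      (by rw [Finset.mem_filter]; exact ⟨h1 _ hm.1, h2 _ hm.1 _ (h1 _ hm.1) hm.2⟩)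
    exact absurd hm.2 (not_lt.2 this)

theorem eq_on {n : ℕ} {p p' : Equiv.Perm (Fin n)} {A : Finset (Fin n)}
    (h : ∀ i ∈ A, ∀ j ∈ A, p i < p j → p' i < p' j)
    (hv : ∀ i ∈ A, ∃ j ∈ A, p j = p' i) : ∀ i ∈ A, p i = p' i := by
  classical
  have key := id_on (A := A.image p) (φ := fun v => p' (p.symm v)) (by
    intro v hv'
    obtain ⟨i, hi, rfl⟩ := Finset.mem_image.1 hv'
    obtain ⟨j, hj, e⟩ := hv i hi
    simp only [Equiv.symm_apply_apply]
    exact Finset.mem_image.2 ⟨j, hj, e⟩) (by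
    intro v hv' w hw'
    obtain ⟨i, hi, rfl⟩ := Finset.mem_image.1 hv'
    obtain ⟨j, hj, rfl⟩ := Finset.mem_image.1 hw'
    simpa using h i hi j hj)
  intro i hi
  simpa using (key (p i) (Finset.mem_image_of_mem _ hi)).symm

theorem pat_inj {n : ℕ} {p p' : Equiv.Perm (Fin n)} {A : Finset (Fin n)}
    (h : pat ⟨n, p⟩ A = pat ⟨n, p'⟩ A) (hv : ∀ i ∈ A, ∃ j ∈ A, p j = p' i) : ∀ i ∈ A, p i = p' i := by
  intro i hi
  obtain ⟨φ, h1, h2, h3⟩ := pat_iso h ⟨i, hi⟩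
  have h4 := id_on (A := A) (φ := φ) (fun i hi => h1.1 hi) (fun i hi j hj => (h2 i hi j hj).1)
  refine eq_on (fun i hi j hj hij => ?_) hv i hi
  have := (h3 i hi j hj).1 hij
  rwa [h4 i hi, h4 j hj] at this

def lset (h : ℕ) (π : Permu) : Finset ℕ :=
  (Finset.range π.1).filter (fun v => ∃ i : Fin π.1, i.1 < h ∧ (π.2 i).1 = v)

theorem mem_lset {h : ℕ} {π : Permu} (i : Fin π.1) : (π.2 i).1 ∈ lset h π ↔ i.1 < h := by
  simp only [lset, Finset.mem_filter, Finset.mem_range]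
  refine ⟨fun ⟨_, j, h1, h2⟩ => ?_, fun h' => ⟨(π.2 i).2, i, h', rfl⟩⟩
  rwa [← π.2.injective (Fin.ext h2)]

def chg (n : ℕ) (V : Finset ℕ) : Finset ℕ := (Finset.range (n - 1)).filter (fun v => ¬ (v ∈ V ↔ v + 1 ∈ V))

theorem chg_inj {n : ℕ} {V W : Finset ℕ} (hV : V ⊆ Finset.range n) (hW : W ⊆ Finset.range n)
    (h : chg n V = chg n W) (h0 : 0 ∈ V ↔ 0 ∈ W) : V = W := by
  have key : ∀ v, v < n → (v ∈ V ↔ v ∈ W) := by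
    intro v
    induction v with
    | zero => exact fun _ => h0
    | succ v ih =>
      intro hv
      have h1 := ih (by omega)
      have h2 : v ∈ chg n V ↔ v ∈ chg n W := by rw [h]
      simp only [chg, Finset.mem_filter, Finset.mem_range, show v < n - 1 by omega, true_and] at h2
      tauto
  ext v
  by_cases hv : v < n
  · exact key v hv
  · exact ⟨fun h => absurd (Finset.mem_range.1 (hV h)) hv, fun h => absurd (Finset.mem_range.1 (hW h)) hv⟩

def few (n m : ℕ) : Finset (Finset ℕ) := (Finset.range n).powerset.filter (fun V => (chg n V).card ≤ m)

theorem few_card {n m : ℕ} {x : ℝ} (h0 : 0 < x) (h1 : x ≤ 1) : ((few n m).card : ℝ) * x ^ m ≤ 2 * (1 + x) ^ n := by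
  classical
  have e1 : ((few n m).card : ℝ) * x ^ m ≤ ∑ V ∈ few n m, x ^ (chg n V).card := by
    rw [← nsmul_eq_mul]
    apply Finset.card_nsmul_le_sum
    intro V hV
    exact pow_le_pow_of_le_one h0.le h1 (Finset.mem_filter.1 hV).2
  have e2 : ∑ V ∈ few n m, x ^ (chg n V).card ≤
      ∑ p ∈ (Finset.range n).powerset ×ˢ (Finset.univ : Finset Bool), x ^ p.1.card := by
    have : ∑ V ∈ few n m, x ^ (chg n V).card =
        ∑ p ∈ (few n m).image (fun V => (chg n V, decide (0 ∈ V))), x ^ p.1.card := by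
      rw [Finset.sum_image]
      intro V hV W hW h
      have hV := Finset.mem_powerset.1 (Finset.mem_filter.1 hV).1
      have hW := Finset.mem_powerset.1 (Finset.mem_filter.1 hW).1
      simp only [Prod.mk.injEq, decide_eq_decide] at h
      exact chg_inj hV hW h.1 h.2
    rw [this]
    apply Finset.sum_le_sum_of_subset_of_nonneg
    · intro p hp
      obtain ⟨V, -, rfl⟩ := Finset.mem_image.1 hp
      simp only [Finset.mem_product, Finset.mem_powerset, Finset.mem_univ, and_true]
      intro v hv
      have := (Finset.mem_filter.1 hv).1
      simp only [Finset.mem_range] at this ⊢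
      omega
    · intros; positivity
  have e3 : ∑ p ∈ (Finset.range n).powerset ×ˢ (Finset.univ : Finset Bool), x ^ p.1.card = 2 * (1 + x) ^ n := by
    rw [Finset.sum_product]
    have := Finset.sum_pow_mul_eq_add_pow x 1 (Finset.range n)
    simp only [one_pow, mul_one, Finset.card_range] at this
    simp only [Fintype.univ_bool, Finset.mem_singleton, Bool.true_eq_false, not_false_eq_true,
      Finset.sum_insert, Finset.sum_singleton, ← two_mul, ← Finset.mul_sum, this, add_comm x]
  linarith

theorem few_card' {n D : ℕ} {x : ℝ} (h0 : 0 < x) (h1 : x ≤ 1) (hD : 1 / x ≤ (1 + x) ^ D) :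
    ((few n (n / D)).card : ℝ) ≤ 2 * ((1 + x) ^ 2) ^ n := by
  have h2 := few_card (n := n) (m := n / D) h0 h1
  have h3 : (1 / x) ^ (n / D) ≤ (1 + x) ^ n := by
    calc (1 / x) ^ (n / D) ≤ ((1 + x) ^ D) ^ (n / D) := pow_le_pow_left₀ (by positivity) hD _
      _ = (1 + x) ^ (D * (n / D)) := (pow_mul _ _ _).symm
      _ ≤ _ := pow_le_pow_right₀ (by linarith) (Nat.mul_div_le n D)
  have h4 : 0 < x ^ (n / D) := pow_pos h0 _
  rw [one_div, inv_pow] at h3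
  rw [← le_div_iff₀ h4, div_eq_mul_inv] at h2
  calc _ ≤ _ := h2
    _ ≤ 2 * (1 + x) ^ n * (1 + x) ^ n := by gcongr
    _ = _ := by rw [← pow_mul]; ring

open Classical in
theorem pcount_eq (X : Set Permu) (n : ℕ) :
    pcount X n = (Finset.univ.filter (fun p : Equiv.Perm (Fin n) => (⟨n, p⟩ : Permu) ∈ X)).card := by
  rw [pcount, ← Set.ncard_coe_finset]
  symm
  have : {π : Permu | π ∈ X ∧ π.1 = n} =
      (fun p : Equiv.Perm (Fin n) => (⟨n, p⟩ : Permu)) '' {p | (⟨n, p⟩ : Permu) ∈ X} := by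
    ext ⟨m, p⟩
    constructor
    · rintro ⟨h, h'⟩
      simp only at h'
      subst h'
      exact ⟨p, h, rfl⟩
    · rintro ⟨q, h, h'⟩
      rw [← h']
      exact ⟨h, rfl⟩
  rw [this, Set.ncard_image_of_injective _ (fun p q h => by simpa using h)]
  simp

def cellP (n h : ℕ) (P : Finset ℕ) (c : Bool × Bool) : Finset (Fin n) :=
  Finset.univ.filter (fun i => (decide (i.1 < h), decide (i.1 ∈ P)) = c)

theorem mem_lset' {h n : ℕ} {p : Equiv.Perm (Fin n)} (i : Fin n) : i.1 ∈ lset h (pinv ⟨n, p⟩) ↔ (p i).1 < h := by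
  have := mem_lset (h := h) (π := pinv ⟨n, p⟩) (p i)
  simpa using this

theorem cell_inj {n h : ℕ} {P : Finset ℕ} {p p' : Equiv.Perm (Fin n)}
    (hV : lset h ⟨n, p⟩ = lset h ⟨n, p'⟩) (hP : lset h (pinv ⟨n, p⟩) = P)
    (hP' : lset h (pinv ⟨n, p'⟩) = P)
    (hc : ∀ c, pat ⟨n, p⟩ (cellP n h P c) = pat ⟨n, p'⟩ (cellP n h P c)) : p = p' := by
  ext i
  have := pat_inj (hc (decide (i.1 < h), decide (i.1 ∈ P))) ?_ i (by simp [cellP])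
  · rw [this]
  intro x hx
  refine ⟨p.symm (p' x), ?_, by simp⟩
  simp only [cellP, Finset.mem_filter, Finset.mem_univ, true_and] at hx ⊢
  rw [← hx, Prod.mk.injEq, decide_eq_decide, decide_eq_decide]
  have h1 := mem_lset (h := h) (π := ⟨n, p⟩) (p.symm (p' x))
  have h2 := mem_lset (h := h) (π := ⟨n, p'⟩) x
  have h3 := mem_lset' (h := h) (p := p) (p.symm (p' x))
  have h4 := mem_lset' (h := h) (p := p') x
  rw [hP] at h3
  rw [hP'] at h4
  simp only [Equiv.apply_symm_apply, hV] at h1 h3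
  exact ⟨h1.symm.trans h2, h3.trans h4.symm⟩

theorem cell_sum (n h : ℕ) (P : Finset ℕ) : ∑ c, (cellP n h P c).card = n := by
  have := Finset.card_eq_sum_card_fiberwise (s := (Finset.univ : Finset (Fin n)))
    (t := (Finset.univ : Finset (Bool × Bool)))
    (f := fun i => (decide (i.1 < h), decide (i.1 ∈ P))) (fun _ _ => Finset.mem_coe.2 (Finset.mem_univ _))
  rw [Finset.card_univ, Fintype.card_fin] at this
  exact this.symm

open Classical in
theorem fiber_card {C Z : Set Permu} (hcls : IsPermClass C) {K s ρ θ : ℝ} (hK : 0 < K) (hs : 0 < s) (hρ : 0 < ρ)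
    (hθ : 0 < θ) (hθ1 : θ ≤ 1) (hθ5 : ρ / s ≤ θ ^ 5) (hCb : ∀ n, (pcount C n : ℝ) ≤ K * s ^ n)
    (hZb : ∀ n, (pcount Z n : ℝ) ≤ K * ρ ^ n) (n h : ℕ) (V P : Finset ℕ) (d : Bool × Bool) :
    ((Finset.univ.filter (fun p : Equiv.Perm (Fin n) => (⟨n, p⟩ : Permu) ∈ C ∧ lset h ⟨n, p⟩ = V ∧
      lset h (pinv ⟨n, p⟩) = P ∧ pat ⟨n, p⟩ (cellP n h P d) ∈ Z ∧ n ≤ 5 * (cellP n h P d).card + 5)).card : ℝ) ≤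
    K ^ 4 * θ⁻¹ ^ 5 * (s * θ) ^ n := by
  by_cases hd : n ≤ 5 * (cellP n h P d).card + 5
  swap
  · rw [Finset.filter_false_of_mem (fun p _ => by tauto)]
    simp; positivity
  let T : Bool × Bool → Finset Permu := fun c =>
    (pset_finite (if c = d then Z else C) (cellP n h P c).card).toFinset
  have hT : ∀ c, ((T c).card : ℝ) ≤ K * s ^ (cellP n h P c).card * (if c = d then (ρ / s) ^ (cellP n h P c).card else 1) := by
    intro c
    have : (T c).card = pcount (if c = d then Z else C) (cellP n h P c).card :=
      (Set.ncard_eq_toFinset_card _ _).symm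
    rw [this]
    split_ifs
    · refine (hZb _).trans_eq ?_
      rw [div_pow]; field_simp
    · simpa using hCb _
  have h1 : (Finset.univ.filter (fun p : Equiv.Perm (Fin n) => (⟨n, p⟩ : Permu) ∈ C ∧ lset h ⟨n, p⟩ = V ∧
      lset h (pinv ⟨n, p⟩) = P ∧ pat ⟨n, p⟩ (cellP n h P d) ∈ Z ∧ n ≤ 5 * (cellP n h P d).card + 5)).card ≤
      (Fintype.piFinset T).card := by
    refine Finset.card_le_card_of_injOn (fun p c => pat ⟨n, p⟩ (cellP n h P c)) ?_ ?_
    · intro p hp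
      simp only [Finset.coe_filter, Finset.mem_univ, true_and, Set.mem_setOf_eq] at hp
      simp only [Finset.mem_coe, Fintype.mem_piFinset, T, Set.Finite.mem_toFinset, Set.mem_setOf_eq]
      intro c
      refine ⟨?_, rfl⟩
      split_ifs with hcd
      · rw [hcd]; exact hp.2.2.2.1
      · exact hcls _ _ (pat_le _ _) hp.1
    · intro p hp p' hp' he
      simp only [Finset.coe_filter, Finset.mem_univ, true_and, Set.mem_setOf_eq] at hp hp'
      exact cell_inj (hp.2.1.trans hp'.2.1.symm) hp.2.2.1 hp'.2.2.1 (fun c => congrFun he c)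
  rw [Fintype.card_piFinset] at h1
  have h2 : (∏ c, ((T c).card : ℝ)) ≤
      ∏ c, (K * s ^ (cellP n h P c).card * (if c = d then (ρ / s) ^ (cellP n h P c).card else 1)) :=
    Finset.prod_le_prod (fun _ _ => by positivity) (fun c _ => hT c)
  rw [Finset.prod_mul_distrib, Finset.prod_mul_distrib, Finset.prod_pow_eq_pow_sum, cell_sum,
    Finset.prod_ite_eq' Finset.univ d] at h2
  simp only [Finset.prod_const, Finset.card_univ, Fintype.card_prod, Fintype.card_bool, Finset.mem_univ,
    if_true] at h2
  have h3 : (ρ / s) ^ (cellP n h P d).card ≤ θ⁻¹ ^ 5 * θ ^ n := by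
    calc (ρ / s) ^ (cellP n h P d).card ≤ (θ ^ 5) ^ (cellP n h P d).card :=
          pow_le_pow_left₀ (by positivity) hθ5 _
      _ = θ⁻¹ ^ 5 * θ ^ (5 * (cellP n h P d).card + 5) := by rw [pow_add, pow_mul]; field_simp
      _ ≤ _ := by gcongr ?_ * ?_; exact pow_le_pow_of_le_one hθ.le hθ1 hd
  calc _ ≤ ((∏ c, (T c).card : ℕ) : ℝ) := by exact_mod_cast h1
    _ ≤ _ := by push_cast; exact h2
    _ ≤ K ^ 4 * s ^ n * (θ⁻¹ ^ 5 * θ ^ n) := by gcongr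
    _ = _ := by rw [mul_pow]; ring

theorem good_small {C Z : Set Permu} {r : ℝ} (hr : 0 < r) (hC : ugr C = r) (hcls : IsPermClass C)
    (hZ : Smll r Z) (hcut : ∀ n (p : Equiv.Perm (Fin n)), (⟨n, p⟩ : Permu) ∈ C → ∃ c,
      pat ⟨n, p⟩ (cellP n (n / 2) (lset (n / 2) (pinv ⟨n, p⟩)) c) ∈ Z ∧
      n ≤ 5 * (cellP n (n / 2) (lset (n / 2) (pinv ⟨n, p⟩)) c).card + 5) :
    ∃ D, 0 < D ∧ Smll r {π ∈ C | (chg π.1 (lset (π.1 / 2) π)).card ≤ π.1 / D ∧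
      (chg π.1 (lset (π.1 / 2) (pinv π))).card ≤ π.1 / D} := by
  classical
  obtain ⟨ρ, K1, hρ, hρr, hK1, hb1⟩ := hZ
  obtain ⟨θ, hθ0, hθ1, hθ5⟩ : ∃ θ : ℝ, 0 < θ ∧ θ < 1 ∧ ρ / r < θ ^ 5 := by
    have h1 : ρ / r < 1 := (div_lt_one hr).2 hρr
    have h2 : 0 < ρ / r := by positivity
    obtain ⟨y, hy1, hy2⟩ := exists_between h1
    refine ⟨y ^ ((5 : ℝ)⁻¹), by have : 0 < y := h2.trans hy1
                                positivity, Real.rpow_lt_one (h2.trans hy1).le hy2 (by norm_num), ?_⟩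
    have := Real.rpow_inv_natCast_pow (h2.trans hy1).le (n := 5) (by norm_num)
    push_cast at this
    rw [this]; exact hy1
  obtain ⟨x, hx0, hx1, hx⟩ : ∃ x : ℝ, 0 < x ∧ x ≤ 1 ∧ (1 + x) ^ 4 * (r * θ) < r := by
    have hc : ContinuousAt (fun x : ℝ => (1 + x) ^ 4 * (r * θ)) 0 := by fun_prop
    have h1 : (fun x : ℝ => (1 + x) ^ 4 * (r * θ)) 0 < r := by simp; nlinarith
    obtain ⟨ε, hε, h2⟩ := Metric.eventually_nhds_iff.1 (hc.eventually (gt_mem_nhds h1))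
    refine ⟨min 1 (ε / 2), by positivity, min_le_left _ _, h2 ?_⟩
    rw [Real.dist_eq, sub_zero, abs_of_pos (by positivity)]
    exact (min_le_right _ _).trans_lt (by linarith)
  obtain ⟨D, hD⟩ := pow_unbounded_of_one_lt (1 / x) (by linarith : 1 < 1 + x)
  have hD0 : D ≠ 0 := by
    rintro rfl
    rw [pow_zero, div_lt_one hx0] at hD; linarith
  obtain ⟨s, hs1, hs2⟩ : ∃ s : ℝ, r < s ∧ (1 + x) ^ 4 * (s * θ) < r := by
    have h1 : r < r / ((1 + x) ^ 4 * θ) := by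
      rw [lt_div_iff₀ (by positivity)]; linarith
    obtain ⟨s, h2, h3⟩ := exists_between h1
    refine ⟨s, h2, ?_⟩
    rw [lt_div_iff₀ (by positivity)] at h3; linarith
  have hs0 : 0 < s := hr.trans hs1
  obtain ⟨K2, hK2, hb2⟩ := ugr_lt_bound hs0 (C := C) (by rw [hC]; exact_mod_cast hs1)
  refine ⟨D, Nat.pos_of_ne_zero hD0, small_of_ev (θ := (1 + x) ^ 4 * (s * θ))
    (K := 4 * ((max K1 K2) ^ 4 * θ⁻¹ ^ 5) * 4) 0 0 (by positivity) hs2 (fun n _ => ?_)⟩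
  let K := max K1 K2
  have hK : 0 < K := lt_max_of_lt_left hK1
  have hfib := fun V P d => fiber_card hcls hK hs0 hρ hθ0 hθ1.le
    (((div_le_div_iff_of_pos_left hρ hs0 hr).2 hs1.le).trans hθ5.le)
    (fun n => (hb2 n).trans (mul_le_mul_of_nonneg_right (le_max_right K1 K2) (by positivity)))
    (fun n => (hb1 n).trans (mul_le_mul_of_nonneg_right (le_max_left K1 K2) (by positivity))) n (n / 2) V P d
  set X := {π ∈ C | (chg π.1 (lset (π.1 / 2) π)).card ≤ π.1 / D ∧
      (chg π.1 (lset (π.1 / 2) (pinv π))).card ≤ π.1 / D} with hX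
  rw [pcount_eq]
  set S := Finset.univ.filter (fun p : Equiv.Perm (Fin n) => (⟨n, p⟩ : Permu) ∈ X) with hS
  have h1 := Finset.card_le_mul_card_image_of_maps_to (s := S)
    (f := fun p => (lset (n / 2) ⟨n, p⟩, lset (n / 2) (pinv ⟨n, p⟩)))
    (t := few n (n / D) ×ˢ few n (n / D)) (by
      intro p hp
      have hp := (Finset.mem_filter.1 hp).2
      simp only [Finset.mem_product, few, Finset.mem_filter, Finset.mem_powerset]
      exact ⟨⟨Finset.filter_subset _ _, hp.2.1⟩, ⟨Finset.filter_subset _ _, hp.2.2⟩⟩)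
    ⌊4 * (K ^ 4 * θ⁻¹ ^ 5 * (s * θ) ^ n)⌋₊ (by
      rintro ⟨V, P⟩ -
      apply Nat.le_floor
      have : S.filter (fun p => (lset (n / 2) ⟨n, p⟩, lset (n / 2) (pinv ⟨n, p⟩)) = (V, P)) ⊆
          Finset.univ.biUnion (fun d => (Finset.univ.filter (fun p : Equiv.Perm (Fin n) => (⟨n, p⟩ : Permu) ∈ C ∧
            lset (n / 2) ⟨n, p⟩ = V ∧ lset (n / 2) (pinv ⟨n, p⟩) = P ∧ pat ⟨n, p⟩ (cellP n (n / 2) P d) ∈ Z ∧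
            n ≤ 5 * (cellP n (n / 2) P d).card + 5))) := by
        intro p hp
        simp only [Finset.mem_filter, Prod.mk.injEq, hS, Finset.mem_univ, true_and] at hp
        obtain ⟨c, hc⟩ := hcut n p hp.1.1
        rw [hp.2.2] at hc
        simp only [Finset.mem_biUnion, Finset.mem_filter, Finset.mem_univ, true_and]
        exact ⟨c, hp.1.1, hp.2.1, hp.2.2, hc⟩
      calc _ ≤ ((∑ d : Bool × Bool, (Finset.univ.filter (fun p : Equiv.Perm (Fin n) => (⟨n, p⟩ : Permu) ∈ C ∧
            lset (n / 2) ⟨n, p⟩ = V ∧ lset (n / 2) (pinv ⟨n, p⟩) = P ∧ pat ⟨n, p⟩ (cellP n (n / 2) P d) ∈ Z ∧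
            n ≤ 5 * (cellP n (n / 2) P d).card + 5)).card : ℕ) : ℝ) := by
              exact_mod_cast (Finset.card_le_card this).trans Finset.card_biUnion_le
        _ ≤ ∑ d : Bool × Bool, K ^ 4 * θ⁻¹ ^ 5 * (s * θ) ^ n := by
              push_cast; exact Finset.sum_le_sum (fun d _ => hfib V P d)
        _ = _ := by rw [Finset.sum_const]; simp)
  have h2 := few_card' (n := n) hx0 hx1 hD.le
  have h3 : 0 ≤ K ^ 4 * θ⁻¹ ^ 5 * (s * θ) ^ n := by positivity
  rw [Finset.card_product] at h1
  have h4 : (S.card : ℝ) ≤ (⌊4 * (K ^ 4 * θ⁻¹ ^ 5 * (s * θ) ^ n)⌋₊ : ℝ) *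
      (((few n (n / D)).card : ℝ) * (few n (n / D)).card) := by exact_mod_cast h1
  refine le_trans (le_of_eq ?_) (h4.trans ?_)
  · congr
  calc _
    _ ≤ 4 * (K ^ 4 * θ⁻¹ ^ 5 * (s * θ) ^ n) * (2 * ((1 + x) ^ 2) ^ n * (2 * ((1 + x) ^ 2) ^ n)) := by
      gcongr
      exact Nat.floor_le (by positivity)
    _ = 4 * (K ^ 4 * θ⁻¹ ^ 5) * 4 * ((s * θ) ^ n * (((1 + x) ^ 2) ^ n * ((1 + x) ^ 2) ^ n)) := by ring
    _ = 4 * (K ^ 4 * θ⁻¹ ^ 5) * 4 * ((1 + x) ^ 4 * (s * θ)) ^ n := by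
      rw [← mul_pow, ← mul_pow]; congr 2; ring
    _ = _ := by simp [K]

theorem PLe_pat_get {σ π : Permu} {A : Finset (Fin π.1)} (h : PLe σ (pat π A)) : ∃ f : Fin σ.1 → Fin π.1,
    (∀ i, f i ∈ A) ∧ (∀ i j, i < j → f i < f j) ∧ (∀ i j, σ.2 i < σ.2 j → π.2 (f i) < π.2 (f j)) := by
  obtain ⟨f, h1, h2⟩ := h
  exact ⟨fun i => pemb π A (f i), fun i => pemb_mem _ _ _, fun i j h => pemb_mono π A (h1 h),
    fun i j h => pat_lt.1 ((h2 i j).1 h)⟩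

theorem prev_get {σ π : Permu} {A : Finset (Fin π.1)} (h : PLe (prev σ) (pat π A)) :
    ∃ f : Fin σ.1 → Fin (prev π).1, (∀ i, (f i).rev ∈ A) ∧ (∀ i j, i < j → f i < f j) ∧
      (∀ i j, σ.2 i < σ.2 j → (prev π).2 (f i) < (prev π).2 (f j)) := by
  obtain ⟨f, h1, h2, h3⟩ := PLe_pat_get h
  refine ⟨fun i => (f i.rev).rev, fun i => by simpa using h1 _,
    fun i j h => Fin.rev_lt_rev.2 (h2 _ _ (Fin.rev_lt_rev.2 h)), fun i j h => ?_⟩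
  simpa using h3 i.rev j.rev (by simpa using h)

theorem cut_exists {C : Set Permu} (hcls : IsPermClass C) {σ1 τ1 σ2 τ2 : Permu} (hd : dsum σ1 τ1 ∉ C)
    (hs : prev (dsum σ2 τ2) ∉ C) (n : ℕ) (p : Equiv.Perm (Fin n)) (hp : (⟨n, p⟩ : Permu) ∈ C) : ∃ c,
      pat ⟨n, p⟩ (cellP n (n / 2) (lset (n / 2) (pinv ⟨n, p⟩)) c) ∈
        {π ∈ C | ¬ PLe σ1 π} ∪ {π ∈ C | ¬ PLe τ1 π} ∪ {π ∈ C | ¬ PLe (prev σ2) π} ∪ {π ∈ C | ¬ PLe (prev τ2) π} ∧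
      n ≤ 5 * (cellP n (n / 2) (lset (n / 2) (pinv ⟨n, p⟩)) c).card + 5 := by
  set P := lset (n / 2) (pinv ⟨n, p⟩) with hP
  have hmem : ∀ a b i, i ∈ cellP n (n / 2) P (a, b) ↔ decide (i.1 < n / 2) = a ∧ decide ((p i).1 < n / 2) = b := by
    intro a b i
    simp [cellP, hP, mem_lset']
  have inC : ∀ c, pat ⟨n, p⟩ (cellP n (n / 2) P c) ∈ C := fun c => hcls _ _ (pat_le _ _) hp
  have c1 : (cellP n (n / 2) P (true, true)).card + (cellP n (n / 2) P (true, false)).card = n / 2 := by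
    rw [← Finset.card_union_of_disjoint (Finset.disjoint_left.2 (fun i h1 h2 => by simp [hmem] at h1 h2; omega))]
    have : cellP n (n / 2) P (true, true) ∪ cellP n (n / 2) P (true, false) =
        Finset.univ.filter (fun i : Fin n => i.1 < n / 2) := by ext i; simp [hmem]; omega
    rw [this, Fin.card_filter_val_lt]; omega
  have c2 : (cellP n (n / 2) P (true, true)).card + (cellP n (n / 2) P (false, true)).card = n / 2 := by
    rw [← Finset.card_union_of_disjoint (Finset.disjoint_left.2 (fun i h1 h2 => by simp [hmem] at h1 h2; omega))]
    have : cellP n (n / 2) P (true, true) ∪ cellP n (n / 2) P (false, true) =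
        (Finset.univ.filter (fun i : Fin n => i.1 < n / 2)).map p.symm.toEmbedding := by
      ext i; simp only [Finset.mem_union, hmem, Finset.mem_map_equiv, Finset.mem_filter, Finset.mem_univ]
      simp; omega
    rw [this, Finset.card_map, Fin.card_filter_val_lt]; omega
  have c3 := cell_sum n (n / 2) P
  rw [Fintype.sum_prod_type, Fintype.sum_bool, Fintype.sum_bool, Fintype.sum_bool] at c3
  have A : PLe σ1 (pat ⟨n, p⟩ (cellP n (n / 2) P (true, true))) →
      PLe τ1 (pat ⟨n, p⟩ (cellP n (n / 2) P (false, false))) → False := by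
    intro ha hb
    obtain ⟨f, f1, f2, f3⟩ := PLe_pat_get ha
    obtain ⟨g, g1, g2, g3⟩ := PLe_pat_get hb
    simp only [hmem, decide_eq_true_eq, decide_eq_false_iff_not] at f1 g1
    refine hd (hcls _ _ (dsum_PLe f g f2 f3 g2 g3 (fun i j => ?_) (fun i j => ?_)) hp)
    · have := f1 i; have := g1 j; rw [Fin.lt_def]; omega
    · have := f1 i; have := g1 j; simp only; rw [Fin.lt_def]; omega
  have B : PLe (prev σ2) (pat ⟨n, p⟩ (cellP n (n / 2) P (false, true))) →
      PLe (prev τ2) (pat ⟨n, p⟩ (cellP n (n / 2) P (true, false))) → False := by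
    intro ha hb
    obtain ⟨f, f1, f2, f3⟩ := prev_get ha
    obtain ⟨g, g1, g2, g3⟩ := prev_get hb
    simp only [hmem, decide_eq_true_eq, decide_eq_false_iff_not] at f1 g1
    have hh := dsum_PLe f g f2 f3 g2 g3 (fun i j => ?_) (fun i j => ?_)
    · have := isSym_prev.le _ _ hh
      rw [isSym_prev.invol] at this
      exact hs (hcls _ _ this hp)
    · have h1 := f1 i; have h2 := g1 j; rw [← Fin.rev_lt_rev, Fin.lt_def]; omega
    · have := f1 i; have := g1 j
      simp only [prev, Equiv.trans_apply, Fin.revPerm_apply]; rw [Fin.lt_def]; omega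
  simp only [Set.mem_union, Set.mem_setOf_eq]
  by_cases hq : (cellP n (n / 2) P (true, true)).card ≥ (cellP n (n / 2) P (true, false)).card
  · by_cases ha : PLe σ1 (pat ⟨n, p⟩ (cellP n (n / 2) P (true, true)))
    · exact ⟨(false, false), .inl (.inl (.inr ⟨inC _, fun hb => A ha hb⟩)), by omega⟩
    · exact ⟨(true, true), .inl (.inl (.inl ⟨inC _, ha⟩)), by omega⟩
  · by_cases ha : PLe (prev σ2) (pat ⟨n, p⟩ (cellP n (n / 2) P (false, true)))
    · exact ⟨(true, false), .inr ⟨inC _, fun hb => B ha hb⟩, by omega⟩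
    · exact ⟨(false, true), .inl (.inr ⟨inC _, ha⟩), by omega⟩

theorem init_lem {α β : Type*} [DecidableEq α] [DecidableEq β] {U T : Finset α} {U' T' : Finset β} {φ : α → β}
    (hb : Set.BijOn φ U U') (hT : T ⊆ U) (hT' : T' ⊆ U') (hc : T.card = T'.card)
    (hR : ∀ x ∈ T, ∀ y ∈ U, y ∉ T → φ y ∈ T' → φ x ∈ T') : ∀ x ∈ U, (x ∈ T ↔ φ x ∈ T') := by
  have hinj : Set.InjOn φ T := hb.2.1.mono (by exact_mod_cast hT)
  have hci : (T.image φ).card = T.card := Finset.card_image_of_injOn hinj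
  have key : T.image φ = T' := by
    by_contra hne
    have h1 : ¬ T.image φ ⊆ T' := fun h => hne (Finset.eq_of_subset_of_card_le h (by omega))
    have h2 : ¬ T' ⊆ T.image φ := fun h => hne (Finset.eq_of_subset_of_card_le h (by omega)).symm
    obtain ⟨a, ha, ha'⟩ := Finset.not_subset.1 h1
    obtain ⟨b, hb1, hb2⟩ := Finset.not_subset.1 h2
    obtain ⟨x, hx, rfl⟩ := Finset.mem_image.1 ha
    obtain ⟨y, hy, rfl⟩ := hb.2.2 (hT' hb1)
    exact ha' (hR x hx y hy (fun h => hb2 (Finset.mem_image_of_mem _ h)) hb1)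
  intro x hx
  rw [← key, Finset.mem_image]
  exact ⟨fun h => ⟨x, h, rfl⟩, fun ⟨y, hy, hxy⟩ => hb.2.1 (hT hy) hx hxy ▸ hy⟩

structure EOK (π : Permu) (k : ℕ) (e f : ℕ → Fin π.1) : Prop where
  ne : ∀ i < k, ∀ j < k, e i ≠ f j
  sep : ∀ i < k, ∀ l < k, i ≠ l → ¬ ((e i < f i ↔ e l < f i) ∧ (π.2 (e i) < π.2 (f i) ↔ π.2 (e l) < π.2 (f i)) ∧
    (e i < f l ↔ e l < f l) ∧ (π.2 (e i) < π.2 (f l) ↔ π.2 (e l) < π.2 (f l)))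
  rc : (∀ i < k, ∀ j < k, e i < f j) ∨ (∀ i < k, ∀ j < k, π.2 (e i) < π.2 (f j)) ∨
    (∀ i < k, ∀ j < k, π.2 (f j) < π.2 (e i)) ∨
    ∃ b : Prop, (∀ i < k, f i < e i ∧ ((f i < e i ↔ π.2 (f i) < π.2 (e i)) ↔ b)) ∧
      ∀ i < k, ∀ j < k, i ≠ j → ∀ x y, (x = e i ∨ x = f i) → (y = e j ∨ y = f j) →
        ((x < y ↔ π.2 x < π.2 y) ↔ ¬ b)

structure GOK (π : Permu) (k : ℕ) (f s : ℕ → Fin π.1) : Prop where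
  fs : ∀ i < k, ∀ j < k, f i < s j
  v : ∀ i j, i < j → j < k → π.2 (f i) < π.2 (f j) ∧ π.2 (f i) < π.2 (s j) ∧ π.2 (s i) < π.2 (f j) ∧
    π.2 (s i) < π.2 (s j)

def WU {π : Permu} (e f s : ℕ → Fin π.1) (w : ℕ × Finset ℕ × Finset ℕ) : Finset (Fin π.1) :=
  w.2.1.image s ∪ (Finset.range w.1 \ w.2.1).image f ∪ w.2.2.image e

structure Wok (n : ℕ) (w : ℕ × Finset ℕ × Finset ℕ) : Prop where
  b : w.2.1 ⊆ Finset.range w.1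
  t : w.2.2 ⊆ Finset.range w.1
  d : ∀ j ∈ w.2.2, j ∉ w.2.1
  n : w.1 + w.2.2.card = n

section
variable {π : Permu} {k n : ℕ} {e f s : ℕ → Fin π.1} {w w' : ℕ × Finset ℕ × Finset ℕ}

theorem mem_WU {x : Fin π.1} : x ∈ WU e f s w ↔ (∃ j ∈ w.2.1, s j = x) ∨ (∃ j, j < w.1 ∧ j ∉ w.2.1 ∧ f j = x) ∨
    ∃ j ∈ w.2.2, e j = x := by
  simp [WU, or_assoc, and_assoc]

theorem EOK.inj (h : EOK π k e f) {i j : ℕ} (hi : i < k) (hj : j < k) (he : e i = e j) : i = j := by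
  by_contra hne
  apply h.sep i hi j hj hne
  simp [he]

theorem GOK.inj (hG : GOK π k f s) {i j : ℕ} (hi : i < k) (hj : j < k) : (f i = f j → i = j) ∧ (s i = s j → i = j) := by
  rcases lt_trichotomy i j with h | h | h
  · have := hG.v i j h hj
    exact ⟨fun e => absurd this.1 (by simp [e]), fun e => absurd this.2.2.2 (by simp [e])⟩
  · exact ⟨fun _ => h, fun _ => h⟩
  · have := hG.v j i h hi
    exact ⟨fun e => absurd this.1 (by simp [e]), fun e => absurd this.2.2.2 (by simp [e])⟩

theorem WU_card (hG : GOK π k f s) (hk : n ≤ k)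
    (hE : w.2.2.Nonempty → EOK π k e f ∧ ∀ i < k, ∀ j < k, e i < s j) (hw : Wok n w) : (WU e f s w).card = n := by
  have hlt : ∀ j, j ∈ Finset.range w.1 → j < k := fun j hj => by
    have := hw.n; have := Finset.mem_range.1 hj; omega
  have c1 : (w.2.1.image s).card = w.2.1.card := Finset.card_image_of_injOn
    (fun i hi j hj h => (hG.inj (hlt _ (hw.b hi)) (hlt _ (hw.b hj))).2 h)
  have c2 : ((Finset.range w.1 \ w.2.1).image f).card = (Finset.range w.1 \ w.2.1).card :=
    Finset.card_image_of_injOn (fun i hi j hj h => (hG.inj (hlt _ (Finset.mem_sdiff.1 hi).1)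
      (hlt _ (Finset.mem_sdiff.1 hj).1)).1 h)
  have c3 : (w.2.2.image e).card = w.2.2.card := Finset.card_image_of_injOn
    (fun i hi j hj h => (hE ⟨i, hi⟩).1.inj (hlt _ (hw.t hi)) (hlt _ (hw.t hj)) h)
  rw [WU, Finset.card_union_of_disjoint, Finset.card_union_of_disjoint, c1, c2, c3, Finset.card_sdiff_of_subset hw.b]
  · have := Finset.card_le_card hw.b
    have := hw.n
    simp at *; omega
  · rw [Finset.disjoint_left]
    simp only [Finset.mem_image, Finset.mem_sdiff]
    rintro x ⟨i, hi, rfl⟩ ⟨j, hj, h⟩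
    exact (hG.fs _ (hlt _ hj.1) _ (hlt _ (hw.b hi))).ne h
  · rw [Finset.disjoint_left]
    simp only [Finset.mem_union, Finset.mem_image, Finset.mem_sdiff]
    rintro x (⟨i, hi, rfl⟩ | ⟨i, hi, rfl⟩) ⟨j, hj, h⟩
    · exact ((hE ⟨j, hj⟩).2 _ (hlt _ (hw.t hj)) _ (hlt _ (hw.b hi))).ne h
    · exact (hE ⟨j, hj⟩).1.ne _ (hlt _ (hw.t hj)) _ (hlt _ hi.1) h

theorem WU_inj (hG : GOK π k f s) (hk : n ≤ k)
    (hE : w.2.2.Nonempty → EOK π k e f ∧ ∀ i < k, ∀ j < k, e i < s j) (hw : Wok n w) (hw' : Wok n w') (hB : w.2.1.card = w'.2.1.card) (hT : w.2.2.card = w'.2.2.card)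
    (hp : pat π (WU e f s w) = pat π (WU e f s w')) : w = w' := by
  classical
  obtain ⟨m, B, T⟩ := w
  obtain ⟨m', B', T'⟩ := w'
  have hm : m = m' := by have := hw.n; have := hw'.n; simp only at *; omega
  subst hm
  simp only at hB hT hE
  have hmk : m ≤ k := by have := hw.n; simp only at this; omega
  have bm : ∀ j ∈ B, j < m := fun j hj => Finset.mem_range.1 (hw.b hj)
  have bm' : ∀ j ∈ B', j < m := fun j hj => Finset.mem_range.1 (hw'.b hj)
  have tm : ∀ j ∈ T, j < m := fun j hj => Finset.mem_range.1 (hw.t hj)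
  have tm' : ∀ j ∈ T', j < m := fun j hj => Finset.mem_range.1 (hw'.t hj)
  have td : ∀ j ∈ T, j ∉ B := hw.d
  have td' : ∀ j ∈ T', j ∉ B' := hw'.d
  have hE' : T'.Nonempty → EOK π k e f ∧ ∀ i < k, ∀ j < k, e i < s j := fun h =>
    hE (Finset.card_pos.1 (by rw [hT]; exact Finset.card_pos.2 h))
  rcases Nat.eq_zero_or_pos m with rfl | hm0
  · have h1 : B = ∅ := Finset.subset_empty.1 hw.b
    have h2 : B' = ∅ := Finset.subset_empty.1 hw'.b
    have h3 : T = ∅ := Finset.subset_empty.1 hw.t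
    have h4 : T' = ∅ := Finset.subset_empty.1 hw'.t
    rw [h1, h2, h3, h4]
  set U := WU e f s (m, B, T) with hU
  set U' := WU e f s (m, B', T') with hU'
  let G := fun j => if j ∈ B then s j else f j
  let G' := fun j => if j ∈ B' then s j else f j
  have mG : ∀ j < m, G j ∈ U := by
    intro j hj
    rw [hU, mem_WU]; simp only [G]
    split_ifs with h
    · exact .inl ⟨j, h, rfl⟩
    · exact .inr (.inl ⟨j, hj, h, rfl⟩)
  have hUG : ∀ x, x ∈ U ↔ (∃ j < m, G j = x) ∨ ∃ j ∈ T, e j = x := by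
    intro x
    refine ⟨fun h => ?_, ?_⟩
    · rcases mem_WU.1 h with ⟨j, hj, rfl⟩ | ⟨j, hj, hj', rfl⟩ | h
      · exact .inl ⟨j, bm j hj, by simp [G, hj]⟩
      · exact .inl ⟨j, hj, by simp only [G]; rw [if_neg hj']⟩
      · exact .inr h
    · rintro (⟨j, hj, rfl⟩ | h)
      · exact mG j hj
      · exact mem_WU.2 (.inr (.inr h))
  have hUG' : ∀ x, x ∈ U' → (∃ j < m, G' j = x) ∨ ∃ j ∈ T', e j = x := by
    intro x h
    rcases mem_WU.1 h with ⟨j, hj, rfl⟩ | ⟨j, hj, hj', rfl⟩ | h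
    · exact .inl ⟨j, bm' j hj, by simp [G', hj]⟩
    · exact .inl ⟨j, hj, by simp only [G']; rw [if_neg hj']⟩
    · exact .inr h
  obtain ⟨φ, hb, hφ1, hφ2⟩ := pat_iso hp ⟨G 0, mG 0 hm0⟩
  have hmem : ∀ x ∈ U, φ x ∈ U' := fun x hx => hb.1 hx
  have hS := init_lem (T := B.image s) (T' := B'.image s) hb
    (fun x hx => mem_WU.2 (.inl (by simpa using hx))) (fun x hx => mem_WU.2 (.inl (by simpa using hx)))
    (by
      rw [Finset.card_image_of_injOn, Finset.card_image_of_injOn, hB]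
      · exact fun i hi j hj h => (hG.inj (by have := bm' i hi; omega) (by have := bm' j hj; omega)).2 h
      · exact fun i hi j hj h => (hG.inj (by have := bm i hi; omega) (by have := bm j hj; omega)).2 h)
    (by
      intro x hx y hy hyT hyT'
      obtain ⟨i, hi, rfl⟩ := Finset.mem_image.1 hx
      have h1 : y < s i := by
        have hik := bm i hi
        rcases mem_WU.1 hy with ⟨j, hj, rfl⟩ | ⟨j, hj, -, rfl⟩ | ⟨j, hj, rfl⟩
        · exact absurd (Finset.mem_image_of_mem _ hj) hyT
        · exact hG.fs _ (by omega) _ (by omega)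
        · have := tm j hj
          exact (hE ⟨j, hj⟩).2 _ (by omega) _ (by omega)
      have hsU : s i ∈ U := mem_WU.2 (.inl ⟨i, hi, rfl⟩)
      have h2 := (hφ1 _ hy _ hsU).1 h1
      obtain ⟨l, hl, hl'⟩ := Finset.mem_image.1 hyT'
      have hlk := bm' l hl
      rcases mem_WU.1 (hmem _ hsU) with ⟨j, hj, hj'⟩ | ⟨j, hj, -, hj'⟩ | ⟨j, hj, hj'⟩
      · exact hj' ▸ Finset.mem_image_of_mem _ hj
      · rw [← hl', ← hj'] at h2
        exact absurd h2 (hG.fs _ (by omega) _ (by omega)).asymm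
      · rw [← hl', ← hj'] at h2
        have := tm' j hj
        exact absurd h2 ((hE' ⟨j, hj⟩).2 _ (by omega) _ (by omega)).asymm)
  have notS : ∀ x ∈ U, x ∉ B.image s → (∃ j, j < m ∧ j ∉ B ∧ f j = x) ∨ ∃ j ∈ T, e j = x := by
    intro x hx hxs
    rcases mem_WU.1 hx with ⟨j, hj, rfl⟩ | h
    · exact absurd (Finset.mem_image_of_mem _ hj) hxs
    · exact h
  have notS' : ∀ x ∈ U', x ∉ B'.image s → (∃ j, j < m ∧ j ∉ B' ∧ f j = x) ∨ ∃ j ∈ T', e j = x := by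
    intro x hx hxs
    rcases mem_WU.1 hx with ⟨j, hj, rfl⟩ | h
    · exact absurd (Finset.mem_image_of_mem _ hj) hxs
    · exact h
  have fS : ∀ j < m, f j ∉ B.image s := by
    intro j hj h
    obtain ⟨l, hl, hl'⟩ := Finset.mem_image.1 h
    have := bm l hl
    exact (hG.fs j (by omega) l (by omega)).ne hl'.symm
  have fS' : ∀ j < m, f j ∉ B'.image s := by
    intro j hj h
    obtain ⟨l, hl, hl'⟩ := Finset.mem_image.1 h
    have := bm' l hl
    exact (hG.fs j (by omega) l (by omega)).ne hl'.symm
  have eS : ∀ j ∈ T, e j ∉ B.image s := by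
    intro j hj h
    obtain ⟨l, hl, hl'⟩ := Finset.mem_image.1 h
    have := bm l hl
    have := tm j hj
    exact ((hE ⟨j, hj⟩).2 j (by omega) l (by omega)).ne hl'.symm
  have eS' : ∀ j ∈ T', e j ∉ B'.image s := by
    intro j hj h
    obtain ⟨l, hl, hl'⟩ := Finset.mem_image.1 h
    have := bm' l hl
    have := tm' j hj
    exact ((hE' ⟨j, hj⟩).2 j (by omega) l (by omega)).ne hl'.symm
  have hEE : ∀ x ∈ U, (x ∈ T.image e ↔ φ x ∈ T'.image e) := by
    rcases T.eq_empty_or_nonempty with hTe | hTe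
    · have : T' = ∅ := Finset.card_eq_zero.1 (by rw [← hT, hTe]; rfl)
      simp [hTe, this]
    obtain ⟨hOK, -⟩ := hE hTe
    refine init_lem hb (fun x hx => mem_WU.2 (.inr (.inr (by simpa using hx))))
      (fun x hx => mem_WU.2 (.inr (.inr (by simpa using hx)))) ?_ ?_
    · rw [Finset.card_image_of_injOn, Finset.card_image_of_injOn, hT]
      · exact fun i hi j hj h => hOK.inj (by have := tm' i hi; omega) (by have := tm' j hj; omega) h
      · exact fun i hi j hj h => hOK.inj (by have := tm i hi; omega) (by have := tm j hj; omega) h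
    intro x hx y hy hyT hyT'
    obtain ⟨i, hi, rfl⟩ := Finset.mem_image.1 hx
    obtain ⟨l, hl, hl'⟩ := Finset.mem_image.1 hyT'
    have hik := tm i hi
    have hlk := tm' l hl
    have heU : e i ∈ U := mem_WU.2 (.inr (.inr ⟨i, hi, rfl⟩))
    have hyS : y ∉ B.image s := fun h => eS' l hl (hl' ▸ (hS y hy).1 h)
    rcases notS y hy hyS with ⟨j, hj, hjB, rfl⟩ | ⟨j, hj, rfl⟩
    swap
    · exact absurd (Finset.mem_image_of_mem _ hj) hyT
    rcases notS' _ (hmem _ heU) (fun h => eS i hi ((hS _ heU).2 h)) with ⟨a, ha, haB, ha'⟩ | ⟨a, ha, ha'⟩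
    swap
    · exact ha' ▸ Finset.mem_image_of_mem _ ha
    exfalso
    have p1 := hφ1 _ heU _ hy
    have p2 := hφ2 _ heU _ hy
    have p3 := hφ2 _ hy _ heU
    rw [← ha', ← hl'] at p1 p2 p3
    rcases hOK.rc with h | h | h | ⟨b, h1, h2⟩
    · exact absurd (p1.1 (h i (by omega) j (by omega))) (h l (by omega) a (by omega)).asymm
    · exact absurd (p2.1 (h i (by omega) j (by omega))) (h l (by omega) a (by omega)).asymm
    · exact absurd (p3.1 (h i (by omega) j (by omega))) (h l (by omega) a (by omega)).asymm
    · -- partner of e i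
      have hfU : f i ∈ U := mem_WU.2 (.inr (.inl ⟨i, hik, td i hi, rfl⟩))
      have q1 := hφ1 _ hfU _ heU
      have q2 := hφ2 _ hfU _ heU
      have g1 := h1 i (by omega)
      rw [← ha'] at q1 q2
      rw [q1, q2] at g1
      have hlt : φ (f i) < f a := g1.1
      rcases notS' _ (hmem _ hfU) (fun h => fS i hik ((hS _ hfU).2 h)) with ⟨c, hc, hcB, hc'⟩ | ⟨c, hc, hc'⟩
      · rw [← hc'] at g1 hlt
        by_cases hca : c = a
        · rw [hca] at hlt; exact lt_irrefl _ hlt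
        · have := h2 c (by omega) a (by omega) hca _ _ (.inr rfl) (.inr rfl)
          exact iff_not_self (g1.2.symm.trans this)
      · have := tm' c hc
        rw [← hc'] at g1 hlt
        by_cases hca : c = a
        · rw [hca] at hlt; exact absurd hlt (h1 a (by omega)).1.asymm
        · have := h2 c (by omega) a (by omega) hca _ _ (.inl rfl) (.inr rfl)
          exact iff_not_self (g1.2.symm.trans this)
  have GT : ∀ j < m, G j ∉ T.image e := by
    intro j hj h
    obtain ⟨l, hl, hl'⟩ := Finset.mem_image.1 h
    have hlm := tm l hl
    simp only [G] at hl'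
    split_ifs at hl' with hjB
    · exact ((hE ⟨l, hl⟩).2 l (by omega) j (by omega)).ne hl'
    · exact (hE ⟨l, hl⟩).1.ne l (by omega) j (by omega) hl'
  have hψ : ∀ j, ∃ l, j < m → l < m ∧ φ (G j) = G' l := by
    intro j
    by_cases hj : j < m
    · rcases hUG' _ (hmem _ (mG j hj)) with ⟨l, hl, h⟩ | ⟨l, hl, h⟩
      · exact ⟨l, fun _ => ⟨hl, h.symm⟩⟩
      · exact absurd ((hEE _ (mG j hj)).2 (h ▸ Finset.mem_image_of_mem _ hl)) (GT j hj)
    · exact ⟨0, fun h => absurd h hj⟩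
  choose ψ hψ using hψ
  have Gm : ∀ i j, i < j → j < m → π.2 (G i) < π.2 (G j) := by
    intro i j hij hj
    have := hG.v i j hij (by omega)
    simp only [G]; split_ifs <;> tauto
  have Gm' : ∀ i j, i < j → j < m → π.2 (G' i) < π.2 (G' j) := by
    intro i j hij hj
    have := hG.v i j hij (by omega)
    simp only [G']; split_ifs <;> tauto
  have hid := id_on (A := Finset.range m) (φ := ψ) (fun i hi => Finset.mem_range.2 (hψ i (Finset.mem_range.1 hi)).1)
    (by
      intro i hi j hj hij
      simp only [Finset.mem_range] at hi hj
      have h1 := (hφ2 _ (mG i hi) _ (mG j hj)).1 (Gm i j hij hj)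
      rw [(hψ i hi).2, (hψ j hj).2] at h1
      by_contra hc
      rcases (not_lt.1 hc).lt_or_eq with h | h
      · exact absurd h1 (Gm' _ _ h (hψ i hi).1).asymm
      · rw [h] at h1; exact lt_irrefl _ h1)
  have hGG : ∀ j < m, φ (G j) = G' j := fun j hj => by
    rw [(hψ j hj).2, hid j (Finset.mem_range.2 hj)]
  have hBB : B = B' := by
    ext j
    by_cases hj : j < m
    swap
    · exact ⟨fun h => absurd (bm j h) hj, fun h => absurd (bm' j h) hj⟩
    have h1 := hS _ (mG j hj)
    rw [hGG j hj] at h1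
    have h2 : G j ∈ B.image s ↔ j ∈ B := by
      simp only [G]; split_ifs with h
      · exact ⟨fun _ => h, fun h => Finset.mem_image_of_mem _ h⟩
      · exact ⟨fun h' => absurd h' (fS j hj), fun h' => absurd h' h⟩
    have h3 : G' j ∈ B'.image s ↔ j ∈ B' := by
      simp only [G']; split_ifs with h
      · exact ⟨fun _ => h, fun h => Finset.mem_image_of_mem _ h⟩
      · exact ⟨fun h' => absurd h' (fS' j hj), fun h' => absurd h' h⟩
    rw [← h2, h1, h3]
  subst hBB
  have hTT : T ⊆ T' := by
    intro i hi
    have hik := tm i hi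
    have heU : e i ∈ U := mem_WU.2 (.inr (.inr ⟨i, hi, rfl⟩))
    obtain ⟨l, hl, hl'⟩ := Finset.mem_image.1 ((hEE _ heU).1 (Finset.mem_image_of_mem _ hi))
    have hlk := tm' l hl
    by_contra hne
    have hil : i ≠ l := fun h => hne (h ▸ hl)
    refine (hE ⟨i, hi⟩).1.sep i (by omega) l (by omega) hil ?_
    have Gf : ∀ j, j ∉ B → G j = f j := fun j hj => by simp only [G]; rw [if_neg hj]
    have a1 : ∀ j, j < m → j ∉ B → f j ∈ U ∧ φ (f j) = f j := fun j hj hjB =>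
      ⟨Gf j hjB ▸ mG j hj, by have := hGG j hj; rw [Gf j hjB] at this; exact this.trans (Gf j hjB)⟩
    obtain ⟨u1, v1⟩ := a1 i hik (td i hi)
    obtain ⟨u2, v2⟩ := a1 l hlk (td' l hl)
    have y1 := hφ1 _ heU _ u1
    have y2 := hφ2 _ heU _ u1
    have y3 := hφ1 _ heU _ u2
    have y4 := hφ2 _ heU _ u2
    rw [v1, ← hl'] at y1 y2
    rw [v2, ← hl'] at y3 y4
    exact ⟨y1, y2, y3, y4⟩
  rw [Finset.eq_of_subset_of_card_le hTT hT.ge]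

end

def wset (q : Bool) : ℕ → Finset (ℕ × Finset ℕ × Finset ℕ)
  | 0 => {(0, ∅, ∅)}
  | 1 => {(1, ∅, ∅), (1, {0}, ∅)}
  | n + 2 => (wset q (n + 1)).image (fun w => (w.1 + 1, w.2.1, w.2.2)) ∪
      (wset q (n + 1)).image (fun w => (w.1 + 1, insert w.1 w.2.1, w.2.2)) ∪
      if q then (wset q n).image (fun w => (w.1 + 1, w.2.1, insert w.1 w.2.2)) else ∅

theorem wset_ok (q : Bool) (n : ℕ) : ∀ w ∈ wset q n, Wok n w ∧ (w.2.2.Nonempty → q = true) := by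
  have lift : ∀ {m : ℕ} {S : Finset ℕ}, S ⊆ Finset.range m → S ⊆ Finset.range (m + 1) :=
    fun h => h.trans (Finset.range_subset_range.2 (by omega))
  have ins : ∀ {m : ℕ} {S : Finset ℕ}, S ⊆ Finset.range m → insert m S ⊆ Finset.range (m + 1) :=
    fun h => Finset.insert_subset (by simp) (lift h)
  have nm : ∀ {m : ℕ} {S : Finset ℕ}, S ⊆ Finset.range m → m ∉ S := fun h h' => by simpa using h h'
  induction n using Nat.twoStepInduction with
  | zero => simp only [wset, Finset.mem_singleton]; rintro w rfl; exact ⟨⟨by simp, by simp, by simp, by simp⟩, by simp⟩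
  | one =>
    simp only [wset, Finset.mem_insert, Finset.mem_singleton]
    rintro w (rfl | rfl) <;> exact ⟨⟨by simp, by simp, by simp, by simp⟩, by simp⟩
  | more n ih1 ih2 =>
    intro w hw
    simp only [wset, Finset.mem_union, Finset.mem_image] at hw
    rcases hw with (⟨u, hu, rfl⟩ | ⟨u, hu, rfl⟩) | h
    · obtain ⟨h1, h2⟩ := ih2 u hu
      exact ⟨⟨lift h1.b, lift h1.t, h1.d, by have := h1.n; simp only; omega⟩, h2⟩
    · obtain ⟨h1, h2⟩ := ih2 u hu
      refine ⟨⟨ins h1.b, lift h1.t, fun j hj => ?_, by have := h1.n; simp only; omega⟩, h2⟩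
      simp only [Finset.mem_insert, not_or]
      exact ⟨fun h => nm h1.t (h ▸ hj), h1.d j hj⟩
    · split_ifs at h with hq
      · obtain ⟨u, hu, rfl⟩ := Finset.mem_image.1 h
        obtain ⟨h1, h2⟩ := ih1 u hu
        refine ⟨⟨lift h1.b, ins h1.t, fun j hj => ?_, ?_⟩, fun _ => hq⟩
        · rcases Finset.mem_insert.1 hj with rfl | hj
          · exact nm h1.b
          · exact h1.d j hj
        · have := h1.n; simp only [Finset.card_insert_of_notMem (nm h1.t)]; omega
      · simp at h

theorem wset_card (q : Bool) (n : ℕ) :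
    (wset q (n + 2)).card = 2 * (wset q (n + 1)).card + if q then (wset q n).card else 0 := by
  have nm : ∀ {m : ℕ} {S : Finset ℕ}, S ⊆ Finset.range m → m ∉ S := fun h h' => by simpa using h h'
  have b : ∀ n, ∀ w ∈ wset q n, w.1 ∉ w.2.1 := fun n w hw => nm (wset_ok q n w hw).1.b
  have t : ∀ n, ∀ w ∈ wset q n, w.1 ∉ w.2.2 := fun n w hw => nm (wset_ok q n w hw).1.t
  have e : ∀ {m : ℕ} {S T : Finset ℕ}, m ∉ S → m ∉ T → insert m S = insert m T → S = T := by
    intro m S T h1 h2 h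
    rw [← Finset.erase_insert h1, h, Finset.erase_insert h2]
  rw [wset, Finset.card_union_of_disjoint, Finset.card_union_of_disjoint, Finset.card_image_of_injective,
    Finset.card_image_of_injOn]
  · rw [two_mul]; congr 1
    split_ifs
    · rw [Finset.card_image_of_injOn]
      rintro ⟨m, B, T⟩ h ⟨m', B', T'⟩ h' he
      simp only [Prod.mk.injEq, Nat.add_right_cancel_iff] at he
      obtain ⟨rfl, rfl, h3⟩ := he
      have h5 : T = T' := e (m := m) (t n (m, B, T) h) (t n (m, B, T') h') h3
      rw [h5]
    · rfl
  · rintro ⟨m, B, T⟩ h ⟨m', B', T'⟩ h' he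
    simp only [Prod.mk.injEq, Nat.add_right_cancel_iff] at he
    obtain ⟨rfl, h3, rfl⟩ := he
    have h5 : B = B' := e (m := m) (b _ (m, B, T) h) (b _ (m, B', T) h') h3
    rw [h5]
  · rintro ⟨m, B, T⟩ ⟨m', B', T'⟩ he
    simpa using he
  · rw [Finset.disjoint_left]
    simp only [Finset.mem_image]
    rintro _ ⟨u, hu, rfl⟩ ⟨v, hv, he⟩
    simp only [Prod.mk.injEq, Nat.add_right_cancel_iff] at he
    have := b _ u hu
    rw [← he.2.1, ← he.1] at this
    simp at this
  · rw [Finset.disjoint_left]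
    intro x hx hx'
    split_ifs at hx' with hq
    · obtain ⟨v, hv, he⟩ := Finset.mem_image.1 hx'
      rcases Finset.mem_union.1 hx with h | h
      · obtain ⟨u, hu, rfl⟩ := Finset.mem_image.1 h
        simp only [Prod.mk.injEq, Nat.add_right_cancel_iff] at he
        have := t _ u hu
        rw [← he.2.2, ← he.1] at this
        simp at this
      · obtain ⟨u, hu, rfl⟩ := Finset.mem_image.1 h
        simp only [Prod.mk.injEq, Nat.add_right_cancel_iff] at he
        have := t _ u hu
        rw [← he.2.2, ← he.1] at this
        simp at this
    · simp at hx'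

theorem words_bound {C : Set Permu} (hC : IsPermClass C) (q : Bool)
    (h : ∀ k, ∃ π ∈ C, ∃ e f s : ℕ → Fin π.1, GOK π k f s ∧
      (q = true → EOK π k e f ∧ ∀ i < k, ∀ j < k, e i < s j)) :
    ((if q then 12 / 5 else 2 : ℝ) : EReal) ≤ ugr C := by
  classical
  have hW : ∀ n, (wset q n).card ≤ (n + 1) ^ 2 * pcount C n := by
    intro n
    obtain ⟨π, hπ, e, f, s, hG, hE⟩ := h n
    have := Finset.card_le_card_of_injOn (s := wset q n)
      (t := (Finset.range (n + 1) ×ˢ Finset.range (n + 1)) ×ˢ (pset_finite C n).toFinset)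
      (fun w => ((w.2.1.card, w.2.2.card), pat π (WU e f s w))) ?_ ?_
    · rw [Finset.card_product, Finset.card_product, ← Set.ncard_eq_toFinset_card _ (pset_finite C n)] at this
      simp only [Finset.card_range] at this
      rw [sq]; exact this
    · intro w hw
      obtain ⟨h1, h2⟩ := wset_ok q n w hw
      have c1 := Finset.card_le_card h1.b
      have c2 := h1.n
      simp only [Finset.card_range] at c1
      simp only [Finset.mem_coe, Finset.mem_product, Finset.mem_range, Set.Finite.mem_toFinset, Set.mem_setOf_eq]
      exact ⟨⟨by omega, by omega⟩, hC _ _ (pat_le _ _) hπ,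
        (pat_card _ _).trans (WU_card hG le_rfl (fun h => hE (h2 h)) h1)⟩
    · intro w hw w' hw' he
      simp only [Prod.mk.injEq] at he
      exact WU_inj hG le_rfl (fun h => hE ((wset_ok q n w hw).2 h)) (wset_ok q n w hw).1 (wset_ok q n w' hw').1
        he.1.1 he.1.2 he.2
  have hlow : ∀ n, (5 / 6 : ℝ) * (if q then 12 / 5 else 2 : ℝ) ^ n ≤ (wset q n).card := by
    intro n
    induction n using Nat.twoStepInduction with
    | zero => simp [wset]; norm_num
    | one => rw [wset, Finset.card_pair (by simp)]; split_ifs <;> norm_num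
    | more n ih1 ih2 =>
      rw [wset_card]
      push_cast
      split_ifs at * with hq
      · have : (0 : ℝ) < (12 / 5) ^ n := by positivity
        rw [pow_succ] at ih2
        rw [pow_add]
        linarith
      · rw [pow_succ]; simp; linarith
  refine le_ugr_of_bound (c := 5 / 6) (q := 2) (by norm_num) (by split_ifs <;> norm_num) (fun n => (hlow n).trans ?_)
  exact_mod_cast hW n

structure Grp (π : Permu) (M h : ℕ) (t : Fin 3 → ℕ → Fin π.1) (s : ℕ → Fin π.1) : Prop where
  p : ∀ j < M, (t 0 j).1 < (t 1 j).1 ∧ (t 1 j).1 < (t 2 j).1 ∧ (t 2 j).1 < h ∧ h ≤ (s j).1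
  m : ∀ j < M, ¬ ((π.2 (t 0 j)).1 < (π.2 (t 1 j)).1 ∧ (π.2 (t 1 j)).1 < (π.2 (t 2 j)).1) ∧
    ¬ ((π.2 (t 1 j)).1 < (π.2 (t 0 j)).1 ∧ (π.2 (t 2 j)).1 < (π.2 (t 1 j)).1)
  v : ∀ i j, i < j → j < M → ∀ x y, (x = t 0 i ∨ x = t 2 i ∨ x = s i) → (y = t 0 j ∨ y = t 2 j ∨ y = s j) →
    (π.2 x).1 < (π.2 y).1

theorem Grp.core {π : Permu} {k h : ℕ} {t : Fin 3 → ℕ → Fin π.1} {s : ℕ → Fin π.1} (G : Grp π (3 * k + 3) h t s)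
    {A B H L T : Prop} (hc : ∀ i j, i < j → j < 3 * k + 3 → ((t 2 i).1 < (t 0 j).1 ↔ A) ∧ ((t 2 j).1 < (t 0 i).1 ↔ B) ∧
      ((π.2 (t 0 j)).1 < (π.2 (t 1 i)).1 ↔ H) ∧ ((π.2 (t 1 j)).1 < (π.2 (t 0 i)).1 ↔ L) ∧
      ((π.2 (t 0 i)).1 < (π.2 (t 2 i)).1 ↔ T)) :
    ∃ e f s : ℕ → Fin π.1, GOK π k f s ∧ EOK π k e f ∧ ∀ i < k, ∀ j < k, e i < s j := by
  have val : ∀ {a b : Fin π.1}, a ≠ b → (π.2 a).1 ≠ (π.2 b).1 := fun h h' => h (π.2.injective (Fin.ext h'))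
  have hv : ∀ i j, i < j → j < 3 * k + 3 → (π.2 (t 0 i)).1 < (π.2 (t 0 j)).1 ∧ (π.2 (t 0 i)).1 < (π.2 (t 2 j)).1 ∧
      (π.2 (t 0 i)).1 < (π.2 (s j)).1 ∧ (π.2 (t 2 i)).1 < (π.2 (t 0 j)).1 ∧ (π.2 (t 2 i)).1 < (π.2 (t 2 j)).1 ∧
      (π.2 (t 2 i)).1 < (π.2 (s j)).1 ∧ (π.2 (s i)).1 < (π.2 (t 0 j)).1 ∧ (π.2 (s i)).1 < (π.2 (t 2 j)).1 ∧
      (π.2 (s i)).1 < (π.2 (s j)).1 := by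
    intro i j hij hj
    have := G.v i j hij hj
    refine ⟨?_, ?_, ?_, ?_, ?_, ?_, ?_, ?_, ?_⟩ <;> apply this <;> simp
  have hp := G.p
  by_cases hsep : ¬ A ∧ ¬ B
  · refine ⟨fun j => t 0 (3 * j + 1), fun j => t 2 (3 * j + 1), fun j => s (3 * j + 1), ⟨?_, ?_⟩, ?_, ?_⟩
    · intro i hi j hj
      have := hp (3 * i + 1) (by omega); have := hp (3 * j + 1) (by omega)
      simp only [Fin.lt_def]; omega
    · intro i j hij hj
      have := hv (3 * i + 1) (3 * j + 1) (by omega) (by omega)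
      simp only [Fin.lt_def]; omega
    · have key : ∀ i < k, ∀ j < k, t 0 (3 * i + 1) < t 2 (3 * j + 1) := by
        intro i hi j hj
        rw [Fin.lt_def]
        rcases lt_trichotomy i j with h | rfl | h
        · have := hv (3 * i + 1) (3 * j + 1) (by omega) (by omega)
          have h1 := hc (3 * i + 1) (3 * j + 1) (by omega) (by omega)
          have h2 : ¬ (t 2 (3 * j + 1)).1 < (t 0 (3 * i + 1)).1 := fun h => hsep.2 (h1.2.1.1 h)
          have h3 : (t 2 (3 * j + 1)).1 ≠ (t 0 (3 * i + 1)).1 := by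
            intro h; rw [Fin.ext h] at this; omega
          omega
        · have := hp (3 * i + 1) (by omega); omega
        · have := hv (3 * j + 1) (3 * i + 1) (by omega) (by omega)
          have h1 := hc (3 * j + 1) (3 * i + 1) (by omega) (by omega)
          have h2 : ¬ (t 2 (3 * j + 1)).1 < (t 0 (3 * i + 1)).1 := fun h => hsep.1 (h1.1.1 h)
          have h3 : (t 2 (3 * j + 1)).1 ≠ (t 0 (3 * i + 1)).1 := by
            intro h; rw [Fin.ext h] at this; omega
          omega
      refine ⟨fun i hi j hj => (key i hi j hj).ne, ?_, .inl key⟩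
      rintro i hi l hl hne ⟨-, h1, -, h2⟩
      have c1 := (hc (3 * i + 1) (3 * i + 2) (by omega) (by omega)).2.2.2.2
      have c2 := (hc (3 * l + 1) (3 * l + 2) (by omega) (by omega)).2.2.2.2
      rw [← c2] at c1
      simp only [Fin.lt_def] at h1 h2
      rcases lt_or_gt_of_ne hne with h | h
      · have := hv (3 * i + 1) (3 * l + 1) (by omega) (by omega); omega
      · have := hv (3 * l + 1) (3 * i + 1) (by omega) (by omega); omega
    · intro i hi j hj
      have := hp (3 * i + 1) (by omega); have := hp (3 * j + 1) (by omega)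
      simp only [Fin.lt_def]; omega
  have hpos : ∀ i j, i < j → j < 3 * k + 3 → ((t 2 i).1 < (t 0 j).1 ∧ A) ∨ ((t 2 j).1 < (t 0 i).1 ∧ ¬ A) := by
    intro i j hij hj
    have h1 := hc i j hij hj
    by_cases hA : A
    · exact .inl ⟨h1.1.2 hA, hA⟩
    · exact .inr ⟨h1.2.1.2 (by tauto), hA⟩
  by_cases hHL : H ∨ L
  · have hGOK : GOK π k (fun j => t 2 (3 * j + 1)) (fun j => s (3 * j + 1)) := by
      refine ⟨?_, ?_⟩
      · intro i hi j hj
        have := hp (3 * i + 1) (by omega); have := hp (3 * j + 1) (by omega)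
        simp only [Fin.lt_def]; omega
      · intro i j hij hj
        have := hv (3 * i + 1) (3 * j + 1) (by omega) (by omega)
        simp only [Fin.lt_def]; omega
    have hne : ∀ i < k, ∀ j < k, t 1 (3 * i + 1) ≠ t 2 (3 * j + 1) := by
      intro i hi j hj he
      have he := congrArg Fin.val he
      have h1 := hp (3 * i + 1) (by omega)
      have h2 := hp (3 * j + 1) (by omega)
      rcases lt_trichotomy i j with h | rfl | h
      · have := hpos (3 * i + 1) (3 * j + 1) (by omega) (by omega); omega
      · omega
      · have := hpos (3 * j + 1) (3 * i + 1) (by omega) (by omega); omega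
    refine ⟨fun j => t 1 (3 * j + 1), fun j => t 2 (3 * j + 1), fun j => s (3 * j + 1), hGOK, ⟨hne, ?_, ?_⟩, ?_⟩
    · rintro i hi l hl hne ⟨h1, -, h2, -⟩
      simp only [Fin.lt_def] at h1 h2
      have h3 := hp (3 * i + 1) (by omega)
      have h4 := hp (3 * l + 1) (by omega)
      rcases lt_or_gt_of_ne hne with h | h
      · have := hpos (3 * i + 1) (3 * l + 1) (by omega) (by omega); omega
      · have := hpos (3 * l + 1) (3 * i + 1) (by omega) (by omega); omega
    · rcases hHL with hH | hL
      · refine .inr (.inr (.inl fun i hi j hj => ?_))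
        have h1 := (hc (3 * i + 1) (3 * k + 2) (by omega) (by omega)).2.2.1.2 hH
        have h2 := hv (3 * j + 1) (3 * k + 2) (by omega) (by omega)
        simp only [Fin.lt_def]; omega
      · refine .inr (.inl fun i hi j hj => ?_)
        have h1 := (hc 0 (3 * i + 1) (by omega) (by omega)).2.2.2.1.2 hL
        have h2 := hv 0 (3 * j + 1) (by omega) (by omega)
        simp only [Fin.lt_def]; omega
    · intro i hi j hj
      have := hp (3 * i + 1) (by omega); have := hp (3 * j + 1) (by omega)
      simp only [Fin.lt_def]; omega
  push Not at hHL
  have hch : ∀ j, ∃ e f : Fin 3, j < k → (t f (3 * j + 1)).1 < (t e (3 * j + 1)).1 ∧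
      (((π.2 (t e (3 * j + 1))).1 < (π.2 (t f (3 * j + 1))).1 ∧ A) ∨
        ((π.2 (t f (3 * j + 1))).1 < (π.2 (t e (3 * j + 1))).1 ∧ ¬ A)) := by
    intro j
    by_cases hj : j < k
    · have h1 := hp (3 * j + 1) (by omega)
      have h2 := G.m (3 * j + 1) (by omega)
      have n1 := @val (t 0 (3 * j + 1)) (t 1 (3 * j + 1)) (fun h => by rw [h] at h1; omega)
      have n2 := @val (t 1 (3 * j + 1)) (t 2 (3 * j + 1)) (fun h => by rw [h] at h1; omega)
      by_cases hA : A
      · by_cases h3 : (π.2 (t 0 (3 * j + 1))).1 < (π.2 (t 1 (3 * j + 1))).1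
        · exact ⟨2, 1, fun _ => ⟨h1.2.1, .inl ⟨by omega, hA⟩⟩⟩
        · exact ⟨1, 0, fun _ => ⟨h1.1, .inl ⟨by omega, hA⟩⟩⟩
      · by_cases h3 : (π.2 (t 0 (3 * j + 1))).1 < (π.2 (t 1 (3 * j + 1))).1
        · exact ⟨1, 0, fun _ => ⟨h1.1, .inr ⟨by omega, hA⟩⟩⟩
        · exact ⟨2, 1, fun _ => ⟨h1.2.1, .inr ⟨by omega, hA⟩⟩⟩
    · exact ⟨0, 0, fun h => absurd h hj⟩
  choose e f hef using hch
  have lo : ∀ j < k, ∀ a : Fin 3, (π.2 (t a (3 * j + 1))).1 ≤ (π.2 (t 0 (3 * j + 2))).1 := by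
    intro j hj a
    have h1 := hv (3 * j + 1) (3 * j + 2) (by omega) (by omega)
    have h2 := hc (3 * j + 1) (3 * j + 2) (by omega) (by omega)
    have h3 : ¬ (π.2 (t 0 (3 * j + 2))).1 < (π.2 (t 1 (3 * j + 1))).1 := fun h => hHL.1 (h2.2.2.1.1 h)
    fin_cases a <;> simp only [Fin.mk_one, Fin.zero_eta, Fin.reduceFinMk] <;> omega
  have hi : ∀ j < k, ∀ a : Fin 3, (π.2 (t 0 (3 * j))).1 ≤ (π.2 (t a (3 * j + 1))).1 := by
    intro j hj a
    have h1 := hv (3 * j) (3 * j + 1) (by omega) (by omega)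
    have h2 := hc (3 * j) (3 * j + 1) (by omega) (by omega)
    have h3 : ¬ (π.2 (t 1 (3 * j + 1))).1 < (π.2 (t 0 (3 * j))).1 := fun h => hHL.2 (h2.2.2.2.1.1 h)
    fin_cases a <;> simp only [Fin.mk_one, Fin.zero_eta, Fin.reduceFinMk] <;> omega
  have step : ∀ i j, i < j → j < k → (π.2 (t 0 (3 * i + 2))).1 < (π.2 (t 0 (3 * j))).1 := fun i j h h' =>
    (hv (3 * i + 2) (3 * j) (by omega) (by omega)).1
  have pl : ∀ j < k, ∀ a : Fin 3, (t 0 (3 * j + 1)).1 ≤ (t a (3 * j + 1)).1 ∧ (t a (3 * j + 1)).1 ≤ (t 2 (3 * j + 1)).1 := by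
    intro j hj a
    have := hp (3 * j + 1) (by omega)
    fin_cases a <;> simp only [Fin.mk_one, Fin.zero_eta, Fin.reduceFinMk] <;> omega
  have vv : ∀ i j, i < j → j < k → ∀ a b : Fin 3, (π.2 (t a (3 * i + 1))).1 < (π.2 (t b (3 * j + 1))).1 := by
    intro i j h h' a b
    have := lo i (by omega) a; have := hi j h' b; have := step i j h h'; omega
  have pp : ∀ i j, i < j → j < k → ∀ a b : Fin 3, ((t a (3 * i + 1)).1 < (t b (3 * j + 1)).1 ∧ A) ∨
      ((t b (3 * j + 1)).1 < (t a (3 * i + 1)).1 ∧ ¬ A) := by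
    intro i j h h' a b
    have := pl i (by omega) a; have := pl j h' b
    rcases hpos (3 * i + 1) (3 * j + 1) (by omega) (by omega) with h | h
    · exact .inl ⟨by omega, h.2⟩
    · exact .inr ⟨by omega, h.2⟩
  refine ⟨fun j => t (e j) (3 * j + 1), fun j => t (f j) (3 * j + 1), fun j => s (3 * j + 1), ⟨?_, ?_⟩, ⟨?_, ?_, ?_⟩, ?_⟩
  · intro i hi j hj
    have := hp (3 * i + 1) (by omega); have := hp (3 * j + 1) (by omega); have := pl i hi (f i)
    simp only [Fin.lt_def]; omega
  · intro i j hij hj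
    have h1 := hv (3 * i + 1) (3 * i + 2) (by omega) (by omega)
    have h2 := hv (3 * j) (3 * j + 1) (by omega) (by omega)
    have := lo i (by omega) (f i); have := hi j hj (f j); have := step i j hij hj
    simp only [Fin.lt_def]; omega
  · intro i hi j hj he
    rcases lt_trichotomy i j with h | rfl | h
    · have := vv i j h hj (e i) (f j); rw [he] at this; omega
    · have := hef i hi; rw [he] at this; omega
    · have := vv j i h hi (f j) (e i); rw [he] at this; omega
  · rintro i hi l hl hne ⟨-, h1, -, h2⟩
    simp only [Fin.lt_def] at h1 h2
    have e1 := hef i hi; have e2 := hef l hl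
    rcases lt_or_gt_of_ne hne with h | h
    · have := vv i l h hl (e i) (f l); have := vv i l h hl (f i) (e l)
      by_cases hA : A <;> simp only [hA, and_true, and_false, or_false, false_or, not_true, not_false_iff] at e1 e2 <;> omega
    · have := vv l i h hi (e l) (f i); have := vv l i h hi (f l) (e i)
      by_cases hA : A <;> simp only [hA, and_true, and_false, or_false, false_or, not_true, not_false_iff] at e1 e2 <;> omega
  · refine .inr (.inr (.inr ⟨¬ A, ?_, ?_⟩))
    · intro i hi
      have := hef i hi
      simp only [Fin.lt_def]
      by_cases hA : A <;> simp only [hA, and_true, and_false, or_false, false_or, not_true, not_false_iff, iff_true, iff_false] at this ⊢ <;> omega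
    · have key : ∀ i j, i < j → j < k → ∀ a b : Fin 3,
          (((t a (3 * i + 1)).1 < (t b (3 * j + 1)).1 ↔ (π.2 (t a (3 * i + 1))).1 < (π.2 (t b (3 * j + 1))).1) ↔ ¬ ¬ A) ∧
          (((t b (3 * j + 1)).1 < (t a (3 * i + 1)).1 ↔ (π.2 (t b (3 * j + 1))).1 < (π.2 (t a (3 * i + 1))).1) ↔ ¬ ¬ A) := by
        intro i j h hj a b
        have h1 := vv i j h hj a b
        have h2 := pp i j h hj a b
        by_cases hA : A <;> simp only [hA, and_true, and_false, or_false, false_or, not_true, not_false_iff, iff_true, iff_false] at h2 ⊢ <;> omega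
      intro i hi j hj hne x y hx hy
      simp only [Fin.lt_def]
      rcases lt_or_gt_of_ne hne with h | h <;> rcases hx with rfl | rfl <;> rcases hy with rfl | rfl
      all_goals first | exact (key i j h hj _ _).1 | exact (key j i h hi _ _).2
  · intro i hi j hj
    have := hp (3 * i + 1) (by omega); have := hp (3 * j + 1) (by omega); have := pl i hi (e i)
    simp only [Fin.lt_def]; omega

theorem lemG {C : Set Permu} (hC : IsPermClass C)
    (h : ∀ k, ∃ π ∈ C, ∃ h t s, Grp π k h t s) : ((12 / 5 : ℝ) : EReal) ≤ ugr C := by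
  have := words_bound hC true ?_
  · simpa using this
  intro k
  obtain ⟨N, hN⟩ := ramsey (Prop × Prop × Prop × Prop × Prop) (3 * k + 3)
  obtain ⟨π, hπ, h, t, s, G⟩ := h N
  obtain ⟨f, ⟨A, B, H, L, T⟩, h1, h2, h3⟩ := hN (fun i j => ((t 2 i).1 < (t 0 j).1, (t 2 j).1 < (t 0 i).1,
      (π.2 (t 0 j)).1 < (π.2 (t 1 i)).1, (π.2 (t 1 j)).1 < (π.2 (t 0 i)).1,
      (π.2 (t 0 i)).1 < (π.2 (t 2 i)).1))
  have G' : Grp π (3 * k + 3) h (fun a j => t a (f j)) (fun j => s (f j)) :=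
    ⟨fun j hj => G.p _ (h2 j hj), fun j hj => G.m _ (h2 j hj), fun i j hij hj => G.v _ _ (h1 i j hij hj) (h2 j hj)⟩
  obtain ⟨e, f, s, a, b, c⟩ := G'.core (A := A) (B := B) (H := H) (L := L) (T := T) (by
    intro i j hij hj
    have := h3 i j hij hj
    simp only [Prod.mk.injEq] at this
    obtain ⟨a, b, c, d, e⟩ := this
    exact ⟨iff_of_eq a, iff_of_eq b, iff_of_eq c, iff_of_eq d, iff_of_eq e⟩)
  exact ⟨π, hπ, e, f, s, a, fun _ => ⟨b, c⟩⟩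

theorem enum_fin (S : Finset ℕ) : ∃ o : ℕ → ℕ, (∀ a < S.card, o a ∈ S) ∧
    ∀ a b, a ≤ b → b < S.card → o a + (b - a) ≤ o b := by
  refine ⟨fun a => if h : a < S.card then S.orderEmbOfFin rfl ⟨a, h⟩ else 0, fun a ha => ?_, fun a b hab => ?_⟩
  · simp only [ha, dite_true]; exact Finset.orderEmbOfFin_mem _ _ _
  · induction b, hab using Nat.le_induction with
    | base => intro; simp
    | succ b hb ih =>
      intro h
      have h1 := ih (by omega)
      have h2 : S.orderEmbOfFin rfl ⟨b, by omega⟩ < S.orderEmbOfFin rfl ⟨b + 1, h⟩ :=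
        (S.orderEmbOfFin rfl).strictMono (by rw [Fin.lt_def]; simp)
      simp only [h, show b < S.card by omega, show a < S.card by omega, dite_true] at h1 ⊢
      omega

theorem chg_get {π : Permu} {h v : ℕ} (hv : v ∈ chg π.1 (lset h π)) : ∃ f s : Fin π.1, f.1 < h ∧ h ≤ s.1 ∧
    v ≤ (π.2 f).1 ∧ (π.2 f).1 < v + 2 ∧ v ≤ (π.2 s).1 ∧ (π.2 s).1 < v + 2 := by
  simp only [chg, Finset.mem_filter, Finset.mem_range] at hv
  obtain ⟨hv1, hv2⟩ := hv
  have h1 := mem_lset (h := h) (π := π) (π.2.symm ⟨v, by omega⟩)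
  have h2 := mem_lset (h := h) (π := π) (π.2.symm ⟨v + 1, by omega⟩)
  simp only [Equiv.apply_symm_apply] at h1 h2
  rw [h1, h2] at hv2
  by_cases h3 : (π.2.symm ⟨v, by omega⟩).1 < h
  · exact ⟨_, π.2.symm ⟨v + 1, by omega⟩, h3, by omega, by simp, by simp, by simp, by simp⟩
  · exact ⟨π.2.symm ⟨v + 1, by omega⟩, π.2.symm ⟨v, by omega⟩, by omega, by omega, by simp, by simp, by simp, by simp⟩

def BadT (π : Permu) (a b g v : ℕ) : Prop := ∃ x y z : Fin π.1, a ≤ x.1 ∧ x.1 < y.1 ∧ y.1 < z.1 ∧ z.1 < b ∧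
  v ≤ (π.2 x).1 ∧ (π.2 x).1 < v + g ∧ v ≤ (π.2 z).1 ∧ (π.2 z).1 < v + g ∧
  ¬ ((π.2 x).1 < (π.2 y).1 ∧ (π.2 y).1 < (π.2 z).1) ∧ ¬ ((π.2 y).1 < (π.2 x).1 ∧ (π.2 z).1 < (π.2 y).1)

theorem noL {π : Permu} {k h g : ℕ} (hk0 : 0 < k) (hno : ∀ t s, ¬ Grp π k h t s) {w : ℕ → ℕ} {I : Finset ℕ} (hk : k ≤ I.card)
    (hB : ∀ i ∈ I, BadT π 0 h g (w i)) (hs : ∀ i ∈ I, ∃ s : Fin π.1, h ≤ s.1 ∧ w i ≤ (π.2 s).1 ∧ (π.2 s).1 < w i + g)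
    (hw : ∀ i ∈ I, ∀ j ∈ I, i < j → w i + g ≤ w j) : False := by
  obtain ⟨o, ho1, ho2⟩ := enum_fin I
  have : ∀ j, ∃ x y z s : Fin π.1, j < k → x.1 < y.1 ∧ y.1 < z.1 ∧ z.1 < h ∧
      w (o j) ≤ (π.2 x).1 ∧ (π.2 x).1 < w (o j) + g ∧ w (o j) ≤ (π.2 z).1 ∧ (π.2 z).1 < w (o j) + g ∧
      (¬ ((π.2 x).1 < (π.2 y).1 ∧ (π.2 y).1 < (π.2 z).1) ∧ ¬ ((π.2 y).1 < (π.2 x).1 ∧ (π.2 z).1 < (π.2 y).1)) ∧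
      h ≤ s.1 ∧ w (o j) ≤ (π.2 s).1 ∧ (π.2 s).1 < w (o j) + g := by
    intro j
    by_cases hj : j < k
    · obtain ⟨x, y, z, -, h1⟩ := hB _ (ho1 j (by omega))
      obtain ⟨s, h2⟩ := hs _ (ho1 j (by omega))
      exact ⟨x, y, z, s, fun _ => by tauto⟩
    · obtain ⟨x, -⟩ := hB _ (ho1 0 (by omega))
      exact ⟨x, x, x, x, fun h => absurd h hj⟩
  choose x y z s hh using this
  refine hno ![x, y, z] s ⟨fun j hj => ?_, fun j hj => ?_, fun i j hij hj a b ha hb => ?_⟩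
  · have := hh j hj
    simp only [Matrix.cons_val]; omega
  · exact (hh j hj).2.2.2.2.2.2.2.1
  · have h1 := hh i (by omega)
    have h2 := hh j hj
    have h3 := hw _ (ho1 i (by omega)) _ (ho1 j (by omega)) (by have := ho2 i j hij.le (by omega); omega)
    simp only [Matrix.cons_val] at ha hb
    rcases ha with rfl | rfl | rfl <;> rcases hb with rfl | rfl | rfl <;> omega

theorem two_sided {π : Permu} {k h g : ℕ} (hk : 0 < k) (hg : 2 ≤ g) (hL : ∀ t s, ¬ Grp π k h t s)
    (hR : ∀ h t s, ¬ Grp (prev π) k h t s) (hc : 2 * k * g < (chg π.1 (lset h π)).card) :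
    ∃ v, v + g ≤ π.1 ∧ ¬ BadT π 0 h g v ∧ ¬ BadT π h π.1 g v := by
  classical
  by_contra hno
  push Not at hno
  obtain ⟨o, ho1, ho2⟩ := enum_fin (chg π.1 (lset h π))
  have hlt : ∀ i, i ≤ 2 * k → i * g < (chg π.1 (lset h π)).card := fun i hi =>
    lt_of_le_of_lt (Nat.mul_le_mul_right g hi) hc
  have hw : ∀ i j, i < j → j ≤ 2 * k → o (i * g) + g ≤ o (j * g) := by
    intro i j hij hj
    have h1 : (i + 1) * g ≤ j * g := Nat.mul_le_mul_right g hij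
    have := ho2 (i * g) (j * g) (by linarith) (hlt j hj)
    rw [add_mul, one_mul] at h1
    omega
  have hend : ∀ i < 2 * k, o (i * g) + g ≤ π.1 := by
    intro i hi
    have h1 := hw i (2 * k) hi le_rfl
    have h2 := ho1 (2 * k * g) (hlt _ le_rfl)
    simp only [chg, Finset.mem_filter, Finset.mem_range] at h2
    omega
  let I := (Finset.range (2 * k)).filter (fun i => BadT π 0 h g (o (i * g)))
  let I' := (Finset.range (2 * k)).filter (fun i => ¬ BadT π 0 h g (o (i * g)))
  have hcard : I.card + I'.card = 2 * k := by
    have := Finset.card_filter_add_card_filter_not (s := Finset.range (2 * k)) (fun i => BadT π 0 h g (o (i * g)))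
    rw [Finset.card_range] at this; exact this
  have hmI : ∀ i ∈ I, i < 2 * k ∧ BadT π 0 h g (o (i * g)) := fun i hi => by simpa [I] using hi
  have hmI' : ∀ i ∈ I', i < 2 * k ∧ ¬ BadT π 0 h g (o (i * g)) := fun i hi => by simpa [I'] using hi
  rcases (by omega : k ≤ I.card ∨ k ≤ I'.card) with hI | hI
  · refine noL hk hL hI (fun i hi => (hmI i hi).2) (fun i hi => ?_)
      (fun i _ j hj hij => hw i j hij (hmI j hj).1.le)
    obtain ⟨f, s, h1⟩ := chg_get (ho1 (i * g) (hlt i (hmI i hi).1.le))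
    exact ⟨s, by omega⟩
  · refine noL hk (hR (π.1 - h)) hI (w := fun i => o (i * g)) (fun i hi => ?_) (fun i hi => ?_)
      (fun i _ j hj hij => hw i j hij (hmI' j hj).1.le)
    · obtain ⟨x, y, z, h1⟩ := hno _ (hend i (hmI' i hi).1) (hmI' i hi).2
      refine ⟨Fin.rev z, Fin.rev y, Fin.rev x, ?_⟩
      simp only [prev, Equiv.trans_apply, Fin.revPerm_apply, Fin.rev_rev, Fin.val_rev] at h1 ⊢
      omega
    · obtain ⟨f, s, h1⟩ := chg_get (ho1 (i * g) (hlt i (hmI' i hi).1.le))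
      refine ⟨Fin.rev f, ?_⟩
      simp only [prev, Equiv.trans_apply, Fin.revPerm_apply, Fin.rev_rev, Fin.val_rev] at h1 ⊢
      omega

def SD {n : ℕ} (p : Equiv.Perm (Fin n)) (lo hi g v : ℕ) (a : Fin (n + 1) × Fin (n + 1)) (d : Bool) : Prop :=
  (∀ i : Fin n, lo ≤ i.1 → i.1 < hi → ((v ≤ (p i).1 ∧ (p i).1 < v + g) ↔ (a.1.1 ≤ i.1 ∧ i.1 < a.2.1))) ∧
  ∀ i j : Fin n, lo ≤ i.1 → i.1 < j.1 → j.1 < hi → v ≤ (p i).1 → (p i).1 < v + g → v ≤ (p j).1 → (p j).1 < v + g →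
    ((p i).1 < (p j).1 ↔ d = true)

theorem SD_ex {n : ℕ} (p : Equiv.Perm (Fin n)) {lo hi g v : ℕ} (h : ¬ BadT ⟨n, p⟩ lo hi g v) : ∃ a d, SD p lo hi g v a d := by
  classical
  let A := Finset.univ.filter (fun i : Fin n => lo ≤ i.1 ∧ i.1 < hi ∧ v ≤ (p i).1 ∧ (p i).1 < v + g)
  have hA : ∀ i, i ∈ A ↔ lo ≤ i.1 ∧ i.1 < hi ∧ v ≤ (p i).1 ∧ (p i).1 < v + g := by simp [A]
  rcases A.eq_empty_or_nonempty with he | hne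
  · have hA' : ∀ i : Fin n, ¬ (lo ≤ i.1 ∧ i.1 < hi ∧ v ≤ (p i).1 ∧ (p i).1 < v + g) := fun i hi => by
      rw [← hA, he] at hi; simp at hi
    refine ⟨(0, 0), true, fun i h1 h2 => ?_, fun i j h1 h2 h3 h4 h5 => absurd ⟨h1, by omega, h4, h5⟩ (hA' i)⟩
    have := hA' i
    simp only [Fin.val_zero]
    constructor
    · intro h; omega
    · intro h; omega
  have tri : ∀ x y z : Fin n, x ∈ A → z ∈ A → x.1 < y.1 → y.1 < z.1 →
      ((p x).1 < (p y).1 ∧ (p y).1 < (p z).1) ∨ ((p y).1 < (p x).1 ∧ (p z).1 < (p y).1) := by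
    intro x y z hx hz hxy hyz
    by_contra hc
    rw [hA] at hx hz
    rw [not_or] at hc
    exact h ⟨x, y, z, hx.1, hxy, hyz, hz.2.1, hx.2.2.1, hx.2.2.2, hz.2.2.1, hz.2.2.2, hc.1, hc.2⟩
  set m := A.min' hne with hm
  set M := A.max' hne with hM
  have hmA := A.min'_mem hne
  have hMA := A.max'_mem hne
  rw [← hm] at hmA
  rw [← hM] at hMA
  have hm' : ∀ i ∈ A, m.1 ≤ i.1 := fun i hi => A.min'_le i hi
  have hM' : ∀ i ∈ A, i.1 ≤ M.1 := fun i hi => A.le_max' i hi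
  have dir : ∃ d : Bool, ∀ i j : Fin n, i ∈ A → j ∈ A → i.1 < j.1 → ((p i).1 < (p j).1 ↔ d = true) := by
    have d2 : ∀ i j : Fin n, i ∈ A → j ∈ A → m.1 < i.1 → i.1 < j.1 →
        ((p i).1 < (p j).1 ↔ (p m).1 < (p i).1) ∧ ((p m).1 < (p j).1 ↔ (p m).1 < (p i).1) := by
      intro i j hi hj h1 h2
      have := tri m i j hmA hj h1 h2; omega
    by_cases hd : ∃ i ∈ A, m.1 < i.1 ∧ (p m).1 < (p i).1
    · obtain ⟨i0, h0, h1, h2⟩ := hd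
      have h3 : ∀ i ∈ A, m.1 < i.1 → (p m).1 < (p i).1 := by
        intro i hi hmi
        rcases lt_trichotomy i.1 i0.1 with h | h | h
        · have := d2 i i0 hi h0 hmi h; omega
        · rw [Fin.ext h]; exact h2
        · have := d2 i0 i h0 hi h1 h; omega
      refine ⟨true, fun i j hi hj hij => ?_⟩
      simp only [iff_true]
      rcases (hm' i hi).eq_or_lt with h | h
      · rw [← Fin.ext h]; exact h3 j hj (by omega)
      · have := d2 i j hi hj h hij; have := h3 i hi h; omega
    · push Not at hd
      refine ⟨false, fun i j hi hj hij => ?_⟩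
      simp only [Bool.false_eq_true, iff_false, not_lt]
      rcases (hm' i hi).eq_or_lt with h | h
      · rw [← Fin.ext h]; exact hd j hj (by omega)
      · have := d2 i j hi hj h hij; have := hd i hi h; omega
  obtain ⟨d, hd⟩ := dir
  refine ⟨(⟨m.1, by omega⟩, ⟨M.1 + 1, by omega⟩), d, fun i h1 h2 => ?_, fun i j h1 h2 h3 h4 h5 h6 h7 =>
    hd i j ((hA i).2 ⟨h1, by omega, h4, h5⟩) ((hA j).2 ⟨by omega, h3, h6, h7⟩) h2⟩
  simp only
  constructor
  · intro hh
    have hi := (hA i).2 ⟨h1, h2, hh⟩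
    have := hm' i hi; have := hM' i hi; omega
  · intro hh
    rcases hh.1.eq_or_lt with h | h
    · rw [← Fin.ext h]; exact ((hA m).1 hmA).2.2
    · rcases (by omega : i.1 = M.1 ∨ i.1 < M.1) with h' | h'
      · rw [Fin.ext h']; exact ((hA M).1 hMA).2.2
      · have := tri m i M hmA hMA h h'
        have := (hA m).1 hmA; have := (hA M).1 hMA; omega

def Aset {n : ℕ} (p : Equiv.Perm (Fin n)) (g v : ℕ) : Finset (Fin n) :=
  Finset.univ.filter (fun i => ¬ (v ≤ (p i).1 ∧ (p i).1 < v + g))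

theorem Aset_card {n : ℕ} (p : Equiv.Perm (Fin n)) {g v : ℕ} (h : v + g ≤ n) : (Aset p g v).card = n - g := by
  have h1 : (Aset p g v).card = (Finset.univ.filter (fun i : Fin n => ¬ (v ≤ i.1 ∧ i.1 < v + g))).card := by
    apply Finset.card_bij (fun i _ => p i)
    · intro i hi; simpa [Aset] using hi
    · intro i _ j _ h; exact p.injective h
    · intro j hj; exact ⟨p.symm j, by simpa [Aset] using hj, by simp⟩
  have h2 : (Finset.univ.filter (fun i : Fin n => v ≤ i.1 ∧ i.1 < v + g)).card = g := by
    have : (Finset.univ.filter (fun i : Fin n => v ≤ i.1 ∧ i.1 < v + g)).map Fin.valEmbedding = Finset.Ico v (v + g) := by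
      ext x
      simp only [Finset.mem_map, Finset.mem_filter, Finset.mem_univ, true_and, Finset.mem_Ico, Fin.valEmbedding_apply]
      exact ⟨fun ⟨a, ha, e⟩ => e ▸ ha, fun hx => ⟨⟨x, by omega⟩, hx, rfl⟩⟩
    rw [← Finset.card_map Fin.valEmbedding, this]; simp
  have h3 := Finset.card_filter_add_card_filter_not (s := (Finset.univ : Finset (Fin n))) (fun i => v ≤ i.1 ∧ i.1 < v + g)
  rw [h2, Finset.card_univ, Fintype.card_fin] at h3
  omega

structure KD {n : ℕ} (p : Equiv.Perm (Fin n)) (h g v : ℕ) (X : Finset (Fin g)) (a b : Fin (n + 1) × Fin (n + 1))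
    (d e : Bool) : Prop where
  X : ∀ x : Fin g, x ∈ X ↔ v + x.1 ∈ lset h ⟨n, p⟩
  L : SD p 0 h g v a d
  R : SD p h n g v b e

theorem KD_inj {n : ℕ} {p p' : Equiv.Perm (Fin n)} {h g v : ℕ} {X : Finset (Fin g)} {a b : Fin (n + 1) × Fin (n + 1)}
    {d e : Bool} (H : KD p h g v X a b d e) (H' : KD p' h g v X a b d e)
    (hp : pat ⟨n, p⟩ (Aset p g v) = pat ⟨n, p'⟩ (Aset p' g v)) : p = p' := by
  classical
  have hJ : ∀ i, (v ≤ (p i).1 ∧ (p i).1 < v + g) ↔ (v ≤ (p' i).1 ∧ (p' i).1 < v + g) := by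
    intro i
    rcases lt_or_ge i.1 h with hi | hi
    · rw [H.L.1 i (by omega) hi, H'.L.1 i (by omega) hi]
    · rw [H.R.1 i hi i.2, H'.R.1 i hi i.2]
  have hAA : Aset p' g v = Aset p g v := by
    ext i; simp only [Aset, Finset.mem_filter, Finset.mem_univ, true_and]; rw [hJ]
  rw [hAA] at hp
  have side : ∀ i j, p j = p' i → v ≤ (p j).1 → (p j).1 < v + g → (j.1 < h ↔ i.1 < h) := by
    intro i j e1 h1 h2
    have e2 := mem_lset (h := h) (π := ⟨n, p⟩) j
    have e3 := mem_lset (h := h) (π := ⟨n, p'⟩) i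
    simp only at e2 e3
    have e4 := H.X ⟨(p j).1 - v, by omega⟩
    have e5 := H'.X ⟨(p j).1 - v, by omega⟩
    simp only [show v + ((p j).1 - v) = (p j).1 by omega] at e4 e5
    rw [← e2, ← e3, ← e1, ← e4, ← e5]
  have onside : ∀ lo hi c f, SD p lo hi g v c f → SD p' lo hi g v c f →
      (∀ i j : Fin n, (j.1 < h ↔ i.1 < h) → lo ≤ i.1 → i.1 < hi → lo ≤ j.1 ∧ j.1 < hi) →
      ∀ i : Fin n, lo ≤ i.1 → i.1 < hi → v ≤ (p i).1 → (p i).1 < v + g → p i = p' i := by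
    intro lo hi c f h1 h2 h3 i e1 e2 e3 e4
    refine eq_on (A := Finset.univ.filter (fun i : Fin n => lo ≤ i.1 ∧ i.1 < hi ∧ v ≤ (p i).1 ∧ (p i).1 < v + g))
      ?_ ?_ i (by simp [e1, e2, e3, e4])
    · intro i hi' j hj hij
      simp only [Finset.mem_filter, Finset.mem_univ, true_and] at hi' hj
      have j1 := (hJ i).1 ⟨by omega, by omega⟩
      have j2 := (hJ j).1 ⟨by omega, by omega⟩
      have hne : i ≠ j := fun h => by rw [h] at hij; exact lt_irrefl _ hij
      rcases lt_or_gt_of_ne hne with h | h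
      · exact (h2.2 i j (by omega) h (by omega) (by omega) (by omega) (by omega) (by omega)).2
          ((h1.2 i j (by omega) h (by omega) (by omega) (by omega) (by omega) (by omega)).1 hij)
      · have k1 := h2.2 j i (by omega) h (by omega) (by omega) (by omega) (by omega) (by omega)
        have k2 := h1.2 j i (by omega) h (by omega) (by omega) (by omega) (by omega) (by omega)
        rw [← k2] at k1
        have k3 : (p' i).1 ≠ (p' j).1 := fun h => hne (p'.injective (Fin.ext h))
        rw [Fin.lt_def] at hij ⊢
        omega
    · intro i hi'
      simp only [Finset.mem_filter, Finset.mem_univ, true_and] at hi' ⊢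
      have j1 := (hJ i).1 ⟨by omega, by omega⟩
      refine ⟨p.symm (p' i), ?_, by simp⟩
      have := h3 i (p.symm (p' i)) (side i _ (by simp) (by simp; omega) (by simp; omega)) (by omega) (by omega)
      simp only [Equiv.apply_symm_apply]; omega
  ext i
  congr 1
  by_cases hi : v ≤ (p i).1 ∧ (p i).1 < v + g
  · rcases lt_or_ge i.1 h with h1 | h1
    · exact onside 0 h a d H.L H'.L (fun i j => by omega) i (by omega) h1 hi.1 hi.2
    · exact onside h n b e H.R H'.R (fun i j => by omega) i h1 i.2 hi.1 hi.2
  · refine pat_inj hp (fun i hi => ?_) i (by simp [Aset]; omega)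
    refine ⟨p.symm (p' i), ?_, by simp⟩
    simp only [Aset, Finset.mem_filter, Finset.mem_univ, true_and, Equiv.apply_symm_apply] at hi ⊢
    rwa [← hJ]

theorem KD_count {C Y : Set Permu} (hC : IsPermClass C) {n h g : ℕ} (hYC : Y ⊆ C)
    (hY : ∀ p : Equiv.Perm (Fin n), (⟨n, p⟩ : Permu) ∈ Y →
      ∃ v, v + g ≤ n ∧ ¬ BadT ⟨n, p⟩ 0 h g v ∧ ¬ BadT ⟨n, p⟩ h n g v) :
    pcount Y n ≤ 4 * (n + 1) ^ 5 * 2 ^ g * pcount C (n - g) := by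
  classical
  have hk : ∀ p : Equiv.Perm (Fin n), ∃ K : Fin (n + 1) × Finset (Fin g) × (Fin (n + 1) × Fin (n + 1)) ×
      (Fin (n + 1) × Fin (n + 1)) × Bool × Bool, (⟨n, p⟩ : Permu) ∈ Y →
      K.1.1 + g ≤ n ∧ KD p h g K.1.1 K.2.1 K.2.2.1 K.2.2.2.1 K.2.2.2.2.1 K.2.2.2.2.2 := by
    intro p
    by_cases hp : (⟨n, p⟩ : Permu) ∈ Y
    · obtain ⟨v, h1, h2, h3⟩ := hY p hp
      obtain ⟨a, d, h4⟩ := SD_ex p h2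
      obtain ⟨b, e, h5⟩ := SD_ex p h3
      exact ⟨(⟨v, by omega⟩, Finset.univ.filter (fun x => v + x.1 ∈ lset h ⟨n, p⟩), a, b, d, e), fun _ => ⟨h1, by simp, h4, h5⟩⟩
    · exact ⟨(0, ∅, (0, 0), (0, 0), true, true), fun h => absurd h hp⟩
  choose K hK using hk
  have := Finset.card_le_card_of_injOn (s := Finset.univ.filter (fun p : Equiv.Perm (Fin n) => (⟨n, p⟩ : Permu) ∈ Y))
      (t := Finset.univ ×ˢ (pset_finite C (n - g)).toFinset)
      (fun p => (K p, pat ⟨n, p⟩ (Aset p g (K p).1.1))) ?_ ?_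
  · rw [Finset.card_product, ← Set.ncard_eq_toFinset_card _ (pset_finite C (n - g)), Finset.card_univ] at this
    simp only [Fintype.card_prod, Fintype.card_fin, Fintype.card_finset, Fintype.card_bool] at this
    rw [pcount_eq]
    refine le_trans (le_of_eq ?_) (this.trans (le_of_eq ?_))
    · congr
    · rw [pcount]; ring
  · intro p hp
    have hp : (⟨n, p⟩ : Permu) ∈ Y := by simpa using hp
    simp only [Finset.mem_coe, Finset.mem_product, Finset.mem_univ, true_and, Set.Finite.mem_toFinset, Set.mem_setOf_eq]
    exact ⟨hC _ _ (pat_le _ _) (hYC hp), (pat_card _ _).trans (Aset_card p (hK p hp).1)⟩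
  · intro p hp p' hp' he
    have hp : (⟨n, p⟩ : Permu) ∈ Y := by simpa using hp
    have hp' : (⟨n, p'⟩ : Permu) ∈ Y := by simpa using hp'
    simp only [Prod.mk.injEq] at he
    have h1 := (hK p hp).2
    have h2 := (hK p' hp').2
    rw [← he.1] at h2
    rw [← he.1] at he
    exact KD_inj h1 h2 he.2

theorem Grp.mono {π : Permu} {k k' h : ℕ} {t s} (G : Grp π k h t s) (hk : k' ≤ k) : Grp π k' h t s :=
  ⟨fun j hj => G.p j (by omega), fun j hj => G.m j (by omega), fun i j hij hj => G.v i j hij (by omega)⟩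

theorem bad_small {C : Set Permu} {r : ℝ} (hcls : IsPermClass C) (hr : 0 < r) (hu : ugr C = r) (h12 : r < 12 / 5)
    (h2 : r ≠ 2) {D : ℕ} (hD : 0 < D) : Smll r {π ∈ C | π.1 / D < (chg π.1 (lset (π.1 / 2) π)).card} := by
  classical
  rcases lt_or_gt_of_ne h2 with h2 | h2
  · have : ¬ ∀ k, ∃ π ∈ C, ∃ e f s : ℕ → Fin π.1, GOK π k f s ∧
      (false = true → EOK π k e f ∧ ∀ i < k, ∀ j < k, e i < s j) := by
      intro h
      have := words_bound hcls false h
      rw [hu] at this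
      simp only [Bool.false_eq_true, if_false, EReal.coe_le_coe_iff] at this
      linarith
    push Not at this
    obtain ⟨k, hk⟩ := this
    refine small_of_ev (θ := r / 2) (K := 0) 0 (D * (2 * k + 1)) (by linarith) (by linarith) (fun n hn => ?_)
    have : pcount {π ∈ C | π.1 / D < (chg π.1 (lset (π.1 / 2) π)).card} n = 0 := by
      rw [pcount, Set.ncard_eq_zero (pset_finite _ n), Set.eq_empty_iff_forall_notMem]
      rintro ⟨m, p⟩ ⟨⟨hp, hb⟩, hm⟩
      obtain rfl : m = n := hm
      have hn1 : 2 * k + 1 ≤ m / D := by rw [Nat.le_div_iff_mul_le hD]; linarith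
      obtain ⟨o, ho1, ho2⟩ := enum_fin (chg m (lset (m / 2) ⟨m, p⟩))
      simp only at hb
      have : ∀ j, ∃ f s : Fin m, j < k → f.1 < m / 2 ∧ m / 2 ≤ s.1 ∧
        o (2 * j) ≤ (p f).1 ∧ (p f).1 < o (2 * j) + 2 ∧ o (2 * j) ≤ (p s).1 ∧ (p s).1 < o (2 * j) + 2 := by
        intro j
        by_cases hj : j < k
        · obtain ⟨f, s, h⟩ := chg_get (ho1 (2 * j) (by omega))
          exact ⟨f, s, fun _ => h⟩
        · have : 0 < m := by
            rcases Nat.eq_zero_or_pos m with rfl | h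
            · simp at hn1
            · exact h
          exact ⟨⟨0, this⟩, ⟨0, this⟩, fun h => absurd h hj⟩
      choose f s hfs using this
      have := (hk ⟨m, p⟩ hp f f s ⟨fun i hi j hj => ?_, fun i j hij hj => ?_⟩).1
      · simp at this
      · have := hfs i hi; have := hfs j hj
        rw [Fin.lt_def]; omega
      · have := hfs i (by omega); have := hfs j hj; have := ho2 (2 * i) (2 * j) (by omega) (by omega)
        simp only [Fin.lt_def]; omega
    rw [this]; simp
  · have hLk : ¬ ∀ k, ∃ π ∈ C, ∃ h t s, Grp π k h t s := by
      intro h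
      have := lemG hcls h
      rw [hu, EReal.coe_le_coe_iff] at this; linarith
    have hRk : ¬ ∀ k, ∃ π ∈ prev ⁻¹' C, ∃ h t s, Grp π k h t s := by
      intro h
      have := lemG (isSym_prev.cls hcls) h
      rw [isSym_prev.ugr, hu, EReal.coe_le_coe_iff] at this; linarith
    push Not at hLk hRk
    obtain ⟨k1, hk1⟩ := hLk
    obtain ⟨k2, hk2⟩ := hRk
    set k := k1 + k2 + 1 with hk
    set G0 := D * (2 * k) with hG0
    have hG0p : 0 < G0 := by positivity
    obtain ⟨θ, hθ0, hθ1, hθ5⟩ : ∃ θ : ℝ, 0 < θ ∧ θ < 1 ∧ 2 / r < θ ^ G0 := by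
      have h1 : 2 / r < 1 := (div_lt_one hr).2 h2
      have h2 : 0 < 2 / r := by positivity
      obtain ⟨y, hy1, hy2⟩ := exists_between h1
      have hG : (0 : ℝ) < G0 := by exact_mod_cast hG0p
      refine ⟨y ^ ((G0 : ℝ)⁻¹), by have : 0 < y := h2.trans hy1
                                   positivity, Real.rpow_lt_one (h2.trans hy1).le hy2 (by positivity), ?_⟩
      rw [Real.rpow_inv_natCast_pow (h2.trans hy1).le hG0p.ne']; exact hy1
    obtain ⟨s, hs1, hs2⟩ : ∃ s : ℝ, r < s ∧ s * θ < r := by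
      have h1 : r < r / θ := by
        rw [lt_div_iff₀ (by positivity)]; nlinarith
      obtain ⟨s, h2, h3⟩ := exists_between h1
      refine ⟨s, h2, ?_⟩
      rwa [lt_div_iff₀ (by positivity)] at h3
    have hs0 : 0 < s := hr.trans hs1
    obtain ⟨K, hK, hb⟩ := ugr_lt_bound hs0 (C := C) (by rw [hu]; exact_mod_cast hs1)
    refine small_of_ev (θ := s * θ) (K := 4 * K / θ ^ G0) 5 (G0 * 2) (by positivity) hs2 (fun n hn => ?_)
    set g := n / G0 with hg
    have hg2 : 2 ≤ g := by rw [hg, Nat.le_div_iff_mul_le hG0p]; linarith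
    have hgn : G0 * g ≤ n := Nat.mul_div_le n G0
    have hng : n < G0 * g + G0 := by
      have := Nat.lt_mul_div_succ n hG0p; rw [← hg] at this; linarith
    have hgn' : g ≤ n := le_trans (Nat.le_mul_of_pos_left g hG0p) hgn
    have h1 := KD_count (Y := {π ∈ C | π.1 / D < (chg π.1 (lset (π.1 / 2) π)).card}) hcls (n := n) (h := n / 2) (g := g)
      (fun π h => h.1) (fun p hp => two_sided (π := ⟨n, p⟩) (k := k) (by omega) hg2
        (fun t s G => hk1 _ hp.1 _ _ _ (G.mono (by omega)))
        (fun h t s G => hk2 (prev ⟨n, p⟩) (by rw [Set.mem_preimage, isSym_prev.invol]; exact hp.1) _ _ _ (G.mono (by omega)))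
        (lt_of_le_of_lt (by
          simp only
          rw [Nat.le_div_iff_mul_le hD]
          refine le_trans (le_of_eq ?_) hgn
          rw [hG0]; ring) hp.2))
    have h2' : (pcount {π ∈ C | π.1 / D < (chg π.1 (lset (π.1 / 2) π)).card} n : ℝ) ≤
        4 * ((n : ℝ) + 1) ^ 5 * 2 ^ g * pcount C (n - g) := by exact_mod_cast h1
    have h3 : (2 : ℝ) ^ g * s ^ (n - g) * θ ^ G0 ≤ (s * θ) ^ n := by
      have e1 : (2 : ℝ) ≤ s * θ ^ G0 := by
        rw [div_lt_iff₀ hr] at hθ5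
        have : 0 < θ ^ G0 := by positivity
        nlinarith
      calc (2 : ℝ) ^ g * s ^ (n - g) * θ ^ G0 ≤ (s * θ ^ G0) ^ g * s ^ (n - g) * θ ^ G0 := by gcongr
        _ = s ^ (g + (n - g)) * θ ^ (G0 * g + G0) := by rw [mul_pow, pow_add, pow_add, pow_mul]; ring
        _ ≤ s ^ n * θ ^ n := by
          rw [show g + (n - g) = n by omega]
          exact mul_le_mul_of_nonneg_left (pow_le_pow_of_le_one hθ0.le hθ1.le hng.le) (by positivity)
        _ = _ := by rw [mul_pow]
    calc _ ≤ _ := h2'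
      _ ≤ 4 * ((n : ℝ) + 1) ^ 5 * 2 ^ g * (K * s ^ (n - g)) := by gcongr; exact hb _
      _ = 4 * K / θ ^ G0 * ((n : ℝ) + 1) ^ 5 * (2 ^ g * s ^ (n - g) * θ ^ G0) := by
        field_simp
      _ ≤ _ := by gcongr

theorem no_cut {C : Set Permu} {r : ℝ} (hcls : IsPermClass C) (hr : 0 < r) (hu : ugr C = r) (h12 : r < 12 / 5)
    (h2 : r ≠ 2) {σ1 τ1 σ2 τ2 : Permu} (hd : dsum σ1 τ1 ∉ C) (hs : prev (dsum σ2 τ2) ∉ C)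
    (a : Smll r {π ∈ C | ¬ PLe σ1 π}) (b : Smll r {π ∈ C | ¬ PLe τ1 π})
    (c : Smll r {π ∈ C | ¬ PLe (prev σ2) π}) (d : Smll r {π ∈ C | ¬ PLe (prev τ2) π}) : False := by
  obtain ⟨D, hD, hg⟩ := good_small hr hu hcls (((a.union b).union c).union d) (cut_exists hcls hd hs)
  have h1 := bad_small hcls hr hu h12 h2 hD
  have h3 := bad_small (isSym_pinv.cls hcls) hr ((isSym_pinv.ugr C).trans hu) h12 h2 hD
  have h4 : Smll r {π ∈ C | π.1 / D < (chg π.1 (lset (π.1 / 2) (pinv π))).card} := by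
    obtain ⟨ρ, K, e1, e2, e3, e4⟩ := h3
    refine ⟨ρ, K, e1, e2, e3, fun n => ?_⟩
    rw [← isSym_pinv.pcount]
    exact e4 n
  have h5 := ((hg.union (h1.union h4)).mono (Y := C) (fun π hπ => by
    by_cases k1 : (chg π.1 (lset (π.1 / 2) π)).card ≤ π.1 / D
    · by_cases k2 : (chg π.1 (lset (π.1 / 2) (pinv π))).card ≤ π.1 / D
      · exact .inl ⟨hπ, k1, k2⟩
      · exact .inr (.inr ⟨hπ, not_le.1 k2⟩)
    · exact .inr (.inl ⟨hπ, not_le.1 k1⟩))).ugr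
  rw [hu] at h5
  exact lt_irrefl _ h5

open Classical in
noncomputable def chain (C : Set Permu) (r : ℝ) (f : ℕ → Permu) : ℕ → Set Permu
  | 0 => C
  | n + 1 => if ugr {π ∈ chain C r f n | ¬ PLe (f n) π} = (r : EReal) then {π ∈ chain C r f n | ¬ PLe (f n) π}
      else chain C r f n

def AvF (B : Finset Permu) : Set Permu := {π | ∀ β ∈ B, ¬ PLe β π}

theorem ex_bas {E : Set Permu} {π : Permu} (h : π ∉ E) : ∃ β, Bas E β ∧ PLe β π := by
  obtain ⟨n, hn⟩ : ∃ n, π.1 = n := ⟨_, rfl⟩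
  induction n using Nat.strong_induction_on generalizing π with
  | _ n ih =>
    by_cases hb : Bas E π
    · exact ⟨π, hb, PLe.refl _⟩
    · simp only [Bas, not_and, not_forall] at hb
      obtain ⟨σ, h1, h2, h3⟩ := hb h
      have : σ.1 < n := by
        by_contra hc
        exact h2 (h1.eq (by omega))
      obtain ⟨β, h4, h5⟩ := ih _ this h3 rfl
      exact ⟨β, h4, h5.trans h1⟩

theorem isSym_id : IsSym id := ⟨fun _ => rfl, fun _ => rfl, fun _ _ h => h⟩

theorem main_case {C : Set Permu} {r ξ : ℝ} (hcls : IsPermClass C) (hr : 0 < r) (h2 : r ≠ 2) (hu : ugr C = r)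
    (hξ : r < ξ) (hroot : ξ ^ 5 - 2 * ξ ^ 4 - ξ ^ 2 - ξ - 1 = 0) : ∃ B : Finset Permu, ugr (AvF B) = r := by
  classical
  have hpos : 0 < ξ := hr.trans hξ
  have h12 : r < 12 / 5 := by have := xi_hi hpos hroot; norm_num at this ⊢; linarith
  obtain ⟨f, hf⟩ := exists_surjective_nat Permu
  set c := chain C r f with hc
  have hstep : ∀ n, (c (n + 1) = {π ∈ c n | ¬ PLe (f n) π} ∧ ugr (c (n + 1)) = r) ∨
      (c (n + 1) = c n ∧ ugr {π ∈ c n | ¬ PLe (f n) π} ≠ r) := by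
    intro n
    have : c (n + 1) = if ugr {π ∈ c n | ¬ PLe (f n) π} = (r : EReal) then {π ∈ c n | ¬ PLe (f n) π} else c n := by
      rw [hc, chain]
    by_cases h : ugr {π ∈ c n | ¬ PLe (f n) π} = (r : EReal)
    · rw [if_pos h] at this; left; rw [this]; exact ⟨rfl, h⟩
    · rw [if_neg h] at this; right; exact ⟨this, h⟩
  have ccls : ∀ n, IsPermClass (c n) := by
    intro n
    induction n with
    | zero => exact hcls
    | succ n ih =>
      rcases hstep n with h | h <;> rw [h.1]
      · exact fun σ π h1 h2 => ⟨ih _ _ h1 h2.1, fun h3 => h2.2 (h3.trans h1)⟩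
      · exact ih
  have cu : ∀ n, ugr (c n) = r := by
    intro n
    induction n with
    | zero => exact hu
    | succ n ih =>
      rcases hstep n with h | h
      · exact h.2
      · rw [h.1]; exact ih
  have anti : Antitone c := by
    refine antitone_nat_of_succ_le (fun n => ?_)
    rcases hstep n with h | h <;> rw [h.1]
    exact fun π h => h.1
  set E := ⋂ n, c n with hE
  have hin : ∀ σ ∈ E, ∃ i, ∀ j ≥ i, Smll r {π ∈ c j | ¬ PLe σ π} := by
    intro σ hσ
    obtain ⟨i, rfl⟩ := hf σ
    have h1 : f i ∈ c (i + 1) := Set.mem_iInter.1 hσ _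
    refine ⟨i, fun j hj => ?_⟩
    rcases hstep i with h | h
    · rw [h.1] at h1; exact absurd (PLe.refl _) h1.2
    · refine (small_of_ugr hr (lt_of_le_of_ne ?_ h.2)).mono (fun π hπ => ⟨anti hj hπ.1, hπ.2⟩)
      rw [← cu i]; exact ugr_mono (fun π h => h.1)
  have hout : ∀ σ, σ ∉ E → ∃ i, ∀ j ≥ i, σ ∉ c j := by
    intro σ hσ
    rw [hE, Set.mem_iInter] at hσ
    push Not at hσ
    obtain ⟨i, hi⟩ := hσ
    exact ⟨i, fun j hj h => hi (anti hj h)⟩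
  have Ecls : IsPermClass E := fun σ π h h' => Set.mem_iInter.2 (fun n => ccls n _ _ h (Set.mem_iInter.1 h' n))
  have hone : pone ∈ E := by
    refine Set.mem_iInter.2 (fun n => ?_)
    by_contra hno
    have h0 : ∀ m, 0 < m → pcount (c n) m = 0 := by
      intro m hm
      rw [pcount, Set.ncard_eq_zero (pset_finite _ m), Set.eq_empty_iff_forall_notMem]
      rintro π ⟨h1, h2⟩
      refine hno (ccls n pone π (PLe.of (fun _ => ⟨0, by omega⟩) ?_ ?_) h1)
      · intro i j hij
        have : Subsingleton (Fin pone.1) := inferInstanceAs (Subsingleton (Fin 1))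
        rw [Subsingleton.elim i j] at hij; exact absurd hij (lt_irrefl _)
      · intro i j hij
        have : Subsingleton (Fin pone.1) := inferInstanceAs (Subsingleton (Fin 1))
        rw [Subsingleton.elim i j] at hij; exact absurd hij (lt_irrefl _)
    have := ugr_le_of_bound (C := c n) (K := pcount (c n) 0) (s := r / 2) (by linarith) (fun m => by
      rcases Nat.eq_zero_or_pos m with rfl | h
      · simp
      · rw [h0 m h]; simp; positivity)
    rw [cu, EReal.coe_le_coe_iff] at this
    linarith
  have hEu : ugr E ≤ r := by rw [← cu 0]; exact ugr_mono (Set.iInter_subset _ 0)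
  have fin : ∀ s, IsSym s → s pone = pone → SumClosed (s ⁻¹' E) → ∃ B : Finset Permu, ugr (AvF B) = r := by
    intro s hs h1 hsum
    have hT : Thin (s ⁻¹' E) := ⟨hs.cls Ecls, hsum, by rw [Set.mem_preimage, h1]; exact hone,
      ξ, hpos, hroot, by rw [hs.ugr]; exact hEu.trans_lt (by exact_mod_cast hξ)⟩
    set B := hT.basis.toFinset with hB
    have hmB : ∀ β, β ∈ B ↔ Bas (s ⁻¹' E) β := by simp [hB]
    have hAv : AvF B = s ⁻¹' E := by
      ext π
      constructor
      · intro h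
        by_contra hc
        obtain ⟨β, h2, h3⟩ := ex_bas hc
        exact h β ((hmB β).2 h2) h3
      · intro h β hβ hle
        exact ((hmB β).1 hβ).1 (hT.cls _ _ hle h)
    refine ⟨B, ?_⟩
    rw [hAv, hs.ugr]
    refine le_antisymm hEu ?_
    have : ∀ β : Permu, ∃ i, β ∈ B → ∀ j ≥ i, s β ∉ c j := by
      intro β
      by_cases hβ : β ∈ B
      · obtain ⟨i, hi⟩ := hout (s β) ((hmB β).1 hβ).1
        exact ⟨i, fun _ => hi⟩
      · exact ⟨0, fun h => absurd h hβ⟩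
    choose i hi using this
    rw [← cu (B.sup i)]
    refine ugr_mono (fun π hπ => ?_)
    by_contra hc
    obtain ⟨β, h2, h3⟩ := ex_bas (E := s ⁻¹' E) (π := s π) (by rw [Set.mem_preimage, hs.invol]; exact hc)
    have h4 := hs.le _ _ h3
    rw [hs.invol] at h4
    exact hi β ((hmB β).2 h2) _ (Finset.le_sup ((hmB β).2 h2)) (ccls _ _ _ h4 hπ)
  by_cases s1 : SumClosed E
  · exact fin id isSym_id rfl s1
  by_cases s2 : SumClosed (prev ⁻¹' E)
  · exact fin prev isSym_prev (Sigma.ext rfl (heq_of_eq (@Subsingleton.elim (Equiv.Perm (Fin 1)) _ _ _))) s2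
  simp only [SumClosed, not_forall] at s1 s2
  obtain ⟨σ1, a1, τ1, a2, a3⟩ := s1
  obtain ⟨σ2, b1, τ2, b2, b3⟩ := s2
  obtain ⟨i1, k1⟩ := hin _ a1
  obtain ⟨i2, k2⟩ := hin _ a2
  obtain ⟨i3, k3⟩ := hin _ b1
  obtain ⟨i4, k4⟩ := hin _ b2
  obtain ⟨i5, k5⟩ := hout _ a3
  obtain ⟨i6, k6⟩ := hout _ b3
  set j := i1 + i2 + i3 + i4 + i5 + i6
  exact (no_cut (ccls j) hr (cu j) h12 h2 (k5 j (by omega)) (k6 j (by omega)) (k1 j (by omega)) (k2 j (by omega))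
    (k3 j (by omega)) (k4 j (by omega))).elim

/-- There are only countably many upper growth rates of permutation
classes below `ξ`, the unique positive root of `x⁵ − 2x⁴ − x² − x − 1`. -/
theorem countable_upper_growth_rates_below_xi
    (ξ : ℝ) (hpos : 0 < ξ) (hroot : ξ ^ 5 - 2 * ξ ^ 4 - ξ ^ 2 - ξ - 1 = 0) :
    Set.Countable
      {r : ℝ | r < ξ ∧ ∃ C : Set Permu, IsPermClass C ∧ ugr C = (r : EReal)} := by
  refine (((Set.countable_singleton (0 : ℝ)).union (Set.countable_singleton (2 : ℝ))).union
    (Set.countable_range (fun B : Finset Permu => (ugr (AvF B)).toReal))).mono ?_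
  rintro r ⟨h1, C, hC, hu⟩
  by_cases h0 : r = 0
  · exact Or.inl (Or.inl h0)
  by_cases h2 : r = 2
  · exact Or.inl (Or.inr h2)
  have hr : 0 ≤ r := by
    have : (0 : EReal) ≤ ugr C := by
      refine le_limsup_of_frequently_le (Frequently.of_forall fun n => ?_)
      exact_mod_cast (by positivity : (0 : ℝ) ≤ (pcount C n : ℝ) ^ ((n : ℝ)⁻¹))
    rw [hu] at this
    exact_mod_cast this
  obtain ⟨B, hB⟩ := main_case hC (lt_of_le_of_ne hr (Ne.symm h0)) h2 hu h1 hroot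
  exact Or.inr ⟨B, by simp [hB]⟩
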